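/- Let N ≥ 3, let Σ be a domain of the unit sphere S^{N−1} and r > 0. Let V ∈ L^∞(Σ) with V ≥ 0 and ‖V‖_{L^∞(Σ)} ≤ μ(C_Σ). Define μ_V(C_Σ) := inf{(∫_{C_Σ}|∇φ|² dx − ∫_{C_Σ} V(x/|x|)|x|^{−2}φ² dx) / ∫_{C_Σ}|x|^{−2}φ² dx : φ ∈ C_c^∞(C_Σ), φ ≢ 0} (so that μ_V(C_Σ) = (N−2)²/4 + λ_{1,V}, where λ_{1,V} is the first Dirichlet eigenvalue of −Δ_{S^{N−1}} − V on Σ, and μ_V(C_Σ) ≥ 0). Let u ∈ L¹_loc(C_Σ^r) be positive almost everywhere with V(x/|x|)|x|^{−2}u ∈ L¹_loc(C_Σ^r), and let f ∈ L¹_loc(C_Σ^r) be nonnegative and not almost everywhere zero, such that ∫ u(−Δφ − V(x/|x|)|x|^{−2}φ) dx ≥ ∫ fφ dx for every nonnegative φ ∈ C_c^∞(C_Σ^r). Then for every subdomain Σ̃ compactly contained in Σ there exists a constant C > 0 such that u(x) ≥ C|x|^{(2−N)/2 + √(μ_V(C_Σ))} for almost every x ∈ C_{Σ̃}^{r/2}.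 -/

import Mathlib

open MeasureTheory Metric Filter
open scoped Topology ENNReal NNReal RealInnerProductSpace

noncomputable section

/-- `ℝ^N` as a Euclidean space. -/
abbrev Euc (N : ℕ) : Type := EuclideanSpace ℝ (Fin N)

/-- `φ ∈ C_c^∞(Ω)`: smooth functions with compact support contained in `Ω`. -/
def IsTestFun {N : ℕ} (Ω : Set (Euc N)) (φ : Euc N → ℝ) : Prop :=
  ContDiff ℝ (⊤ : ℕ∞) φ ∧ HasCompactSupport φ ∧ tsupport φ ⊆ Ω

/-- The classical Laplacian of `φ` at `x`: the sum of the pure second partial derivatives. -/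
def lap {N : ℕ} (φ : Euc N → ℝ) (x : Euc N) : ℝ :=
  ∑ i : Fin N, iteratedFDeriv ℝ 2 φ x ![EuclideanSpace.single i 1, EuclideanSpace.single i 1]

/-- The best constant `μ(Ω)` in the Hardy inequality on `Ω` with the weight `|x|⁻²`. -/
def hardyConst {N : ℕ} (Ω : Set (Euc N)) : ℝ :=
  sInf {t : ℝ | ∃ φ : Euc N → ℝ, IsTestFun Ω φ ∧ φ ≠ 0 ∧
    t = (∫ x in Ω, ‖gradient φ x‖ ^ 2) / (∫ x in Ω, ‖x‖ ^ (-2 : ℝ) * φ x ^ 2)}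

/-- `Σ` is a domain (nonempty relatively open connected subset) of the unit sphere `S^{N-1}`. -/
def IsSphereDomain (N : ℕ) (S : Set (Euc N)) : Prop :=
  S.Nonempty ∧ S ⊆ sphere (0 : Euc N) 1 ∧
    (∃ U : Set (Euc N), IsOpen U ∧ S = U ∩ sphere (0 : Euc N) 1) ∧ IsConnected S

/-- The open cone `C_Σ = {rσ : r > 0, σ ∈ Σ}` over a subset `S` of the unit sphere. -/
def sphCone {N : ℕ} (S : Set (Euc N)) : Set (Euc N) :=
  {x | ∃ r : ℝ, 0 < r ∧ ∃ σ ∈ S, x = r • σ}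

/-- The cone-like domain `C_Σ^R = C_Σ ∩ B_R(0)`. -/
def coneLike {N : ℕ} (S : Set (Euc N)) (R : ℝ) : Set (Euc N) :=
  sphCone S ∩ ball (0 : Euc N) R

/-- `μ_V(C_Σ)`, the best constant in the Hardy inequality on the cone `C_Σ` for the
operator `-Δ - V(x/|x|)|x|⁻²`, relative to the weight `|x|⁻²`. -/
def hardyConstV {N : ℕ} (S : Set (Euc N)) (V : Euc N → ℝ) : ℝ :=
  sInf {t : ℝ | ∃ φ : Euc N → ℝ, IsTestFun (sphCone S) φ ∧ φ ≠ 0 ∧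
    t = ((∫ x in sphCone S, ‖gradient φ x‖ ^ 2)
          - ∫ x in sphCone S, V (‖x‖⁻¹ • x) * ‖x‖ ^ (-2 : ℝ) * φ x ^ 2)
        / ∫ x in sphCone S, ‖x‖ ^ (-2 : ℝ) * φ x ^ 2}

set_option linter.unusedSimpArgs false
noncomputable section

/-! ### Part 1 : gradient calculus and integration by parts -/

theorem two_le_infty : (2 : WithTop ℕ∞) ≤ ((⊤ : ℕ∞) : WithTop ℕ∞) := by
  exact WithTop.coe_le_coe.mpr (le_top : (2 : ℕ∞) ≤ ⊤)

theorem one_le_infty : (1 : WithTop ℕ∞) ≤ ((⊤ : ℕ∞) : WithTop ℕ∞) := by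
  exact WithTop.coe_le_coe.mpr (le_top : (1 : ℕ∞) ≤ ⊤)

theorem infty_ne_zero : ((⊤ : ℕ∞) : WithTop ℕ∞) ≠ 0 := by simp

theorem hg_mul {N : ℕ} {f g : Euc N → ℝ} {f' g' x : Euc N} (hf : HasGradientAt f f' x)
    (hg : HasGradientAt g g' x) :
    HasGradientAt (fun y => f y * g y) (f x • g' + g x • f') x := by
  rw [hasGradientAt_iff_hasFDerivAt] at *
  exact (hf.mul hg).congr_fderiv (by ext y; simp [inner_add_left, inner_smul_left])

theorem hg_add {N : ℕ} {f g : Euc N → ℝ} {f' g' x : Euc N} (hf : HasGradientAt f f' x)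
    (hg : HasGradientAt g g' x) :
    HasGradientAt (fun y => f y + g y) (f' + g') x := by
  rw [hasGradientAt_iff_hasFDerivAt] at *
  exact (hf.add hg).congr_fderiv (by ext y; simp [inner_add_left])

theorem hg_comp {N : ℕ} {F : ℝ → ℝ} {F' : ℝ} {f : Euc N → ℝ} {f' x : Euc N}
    (hF : HasDerivAt F F' (f x)) (hf : HasGradientAt f f' x) :
    HasGradientAt (fun y => F (f y)) (F' • f') x := by
  rw [hasGradientAt_iff_hasFDerivAt] at *
  exact (hF.comp_hasFDerivAt x hf).congr_fderiv (by ext y; simp [inner_smul_left])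

theorem hg_const_mul {N : ℕ} {f : Euc N → ℝ} {f' x : Euc N} (c : ℝ) (hf : HasGradientAt f f' x) :
    HasGradientAt (fun y => c * f y) (c • f') x := by
  have := hg_mul (hasGradientAt_const x c) hf
  simpa using this

theorem hg_normsq {N : ℕ} (x : Euc N) :
    HasGradientAt (fun y : Euc N => ‖y‖ ^ 2) ((2:ℝ) • x) x := by
  rw [hasGradientAt_iff_hasFDerivAt]
  exact (hasStrictFDerivAt_norm_sq x).hasFDerivAt.congr_fderiv
    (by ext y; simp [inner_smul_left])

theorem hg_radial {N : ℕ} {G : ℝ → ℝ} {G' : ℝ} {x : Euc N} (hG : HasDerivAt G G' (‖x‖ ^ 2)) :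
    HasGradientAt (fun y : Euc N => G (‖y‖ ^ 2)) ((2 * G') • x) x := by
  have := hg_comp (f := fun y : Euc N => ‖y‖ ^ 2) hG (hg_normsq x)
  convert this using 1
  rw [smul_smul, mul_comm]

theorem grad_mul {N : ℕ} {f g : Euc N → ℝ} {x : Euc N} (hf : DifferentiableAt ℝ f x)
    (hg : DifferentiableAt ℝ g x) :
    gradient (fun y => f y * g y) x = f x • gradient g x + g x • gradient f x :=
  (hg_mul hf.hasGradientAt hg.hasGradientAt).gradient

theorem grad_eq_zero_of_notMem_tsupport {N : ℕ} {f : Euc N → ℝ} {x : Euc N}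
    (hx : x ∉ tsupport f) : gradient f x = 0 := by
  have h : f =ᶠ[𝓝 x] fun _ => 0 := notMem_tsupport_iff_eventuallyEq.mp hx
  rw [h.gradient_eq, gradient_fun_const]

theorem continuous_gradient {N : ℕ} {f : Euc N → ℝ} (hf : ContDiff ℝ 1 f) :
    Continuous (gradient f) := by
  unfold gradient
  exact (LinearIsometryEquiv.continuous _).comp (hf.continuous_fderiv (by norm_num))

theorem grad_apply {N : ℕ} (f : Euc N → ℝ) (x : Euc N) (i : Fin N) :
    gradient f x i = fderiv ℝ f x (EuclideanSpace.single i 1) := by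
  rw [← inner_gradient_left, EuclideanSpace.inner_single_right]
  simp

theorem tsupport_gradient_subset {N : ℕ} (f : Euc N → ℝ) :
    tsupport (gradient f) ⊆ tsupport f := by
  apply closure_minimal _ (isClosed_tsupport f)
  intro x hx
  by_contra h
  exact hx (grad_eq_zero_of_notMem_tsupport h)

theorem norm_grad_eq {N : ℕ} (f : Euc N → ℝ) (x : Euc N) : ‖gradient f x‖ = ‖fderiv ℝ f x‖ := by
  rw [← toDual_gradient (𝕜 := ℝ)]; exact (LinearIsometryEquiv.norm_map _ _).symm

theorem integral_fderiv_zero {N : ℕ} {k : Euc N → ℝ} (hk : ContDiff ℝ 1 k)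
    (hc : HasCompactSupport k) (v : Euc N) : ∫ x, fderiv ℝ k x v = 0 := by
  have hint : Integrable (fun x => fderiv ℝ k x v) := by
    apply Continuous.integrable_of_hasCompactSupport
    · exact (hk.continuous_fderiv (by norm_num)).clm_apply continuous_const
    · exact hc.fderiv_apply ℝ v
  have := integral_mul_fderiv_eq_neg_fderiv_mul_of_integrable (μ := (volume : Measure (Euc N)))
    (f := fun _ => (1:ℝ)) (g := k) (v := v)
    (by simp) (by simpa using hint)
    (by simpa using hk.continuous.integrable_of_hasCompactSupport hc)
    (fun x _ => by simp) (fun x _ => (hk.differentiable (by norm_num)) x)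
  simpa using this

/-- `∫ x·∇k = -N ∫ k`. -/
theorem integral_inner_grad {N : ℕ} {k : Euc N → ℝ} (hk : ContDiff ℝ 1 k)
    (hc : HasCompactSupport k) : ∫ x, ⟪x, gradient k x⟫ = -(N:ℝ) * ∫ x, k x := by
  have hd := hk.differentiable (by norm_num)
  have key : ∀ i : Fin N, ∫ x : Euc N, x i * gradient k x i = - ∫ x, k x := by
    intro i
    have hp : ContDiff ℝ 1 (fun x : Euc N => x i * k x) :=
      (by fun_prop : ContDiff ℝ 1 (fun x : Euc N => x i)).mul hk
    have h0 := integral_fderiv_zero hp (hc.mul_left) (EuclideanSpace.single i 1)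
    have e : ∀ x, fderiv ℝ (fun x : Euc N => x i * k x) x (EuclideanSpace.single i 1)
        = x i * gradient k x i + k x := by
      intro x
      rw [grad_apply]
      have h1 : HasFDerivAt (fun x : Euc N => x i) (EuclideanSpace.proj i : Euc N →L[ℝ] ℝ) x :=
        (EuclideanSpace.proj i : Euc N →L[ℝ] ℝ).hasFDerivAt
      rw [HasFDerivAt.fderiv (f := fun x : Euc N => x i * k x) (h1.mul (hd x).hasFDerivAt)]
      simp
    simp_rw [e] at h0
    rw [integral_add] at h0
    · linarith
    · apply Continuous.integrable_of_hasCompactSupport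
      · have := continuous_gradient hk
        fun_prop
      · refine HasCompactSupport.mul_left (f := fun x : Euc N => x i) ?_
        simp_rw [grad_apply]
        exact hc.fderiv_apply ℝ _
    · exact hk.continuous.integrable_of_hasCompactSupport hc
  have e2 : ∀ x : Euc N, ⟪x, gradient k x⟫ = ∑ i, x i * gradient k x i := by
    intro x
    rw [PiLp.inner_apply]
    exact Finset.sum_congr rfl (fun i _ => by simp [mul_comm])
  simp_rw [e2]
  rw [integral_finsetSum]
  · simp [key]
  · intro i _
    apply Continuous.integrable_of_hasCompactSupport
    · have := continuous_gradient hk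
      fun_prop
    · refine HasCompactSupport.mul_left (f := fun x : Euc N => x i) ?_
      simp_rw [grad_apply]
      exact hc.fderiv_apply ℝ _

theorem lap_eq {N : ℕ} {φ : Euc N → ℝ} (hφ : ContDiff ℝ 2 φ) (x : Euc N) :
    lap φ x = ∑ i : Fin N, fderiv ℝ (fun y => fderiv ℝ φ y (EuclideanSpace.single i 1)) x
      (EuclideanSpace.single i 1) := by
  unfold lap
  apply Finset.sum_congr rfl
  intro i _
  rw [iteratedFDeriv_two_apply]
  have hd : DifferentiableAt ℝ (fderiv ℝ φ) x :=
    (hφ.fderiv_right (m := 1) (by norm_num)).differentiable (by norm_num) x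
  rw [fderiv_clm_apply hd (by fun_prop)]
  simp

theorem continuous_lap {N : ℕ} {φ : Euc N → ℝ} (hφ : ContDiff ℝ 2 φ) : Continuous (lap φ) := by
  have : lap φ = fun x => ∑ i : Fin N,
      fderiv ℝ (fun y => fderiv ℝ φ y (EuclideanSpace.single i 1)) x
      (EuclideanSpace.single i 1) := by
    ext x; exact lap_eq hφ x
  rw [this]
  apply continuous_finsetSum
  intro i _
  have : ContDiff ℝ 1 (fun y => fderiv ℝ φ y (EuclideanSpace.single i (1:ℝ))) :=
    (hφ.fderiv_right (m := 1) (by norm_num)).clm_apply contDiff_const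
  exact (this.continuous_fderiv (by norm_num)).clm_apply continuous_const

theorem lap_congr {N : ℕ} {f g : Euc N → ℝ} {x : Euc N} (h : f =ᶠ[𝓝 x] g) : lap f x = lap g x := by
  unfold lap
  rw [(h.iteratedFDeriv ℝ 2).eq_of_nhds]

theorem lap_eq_zero_of_notMem_tsupport {N : ℕ} {f : Euc N → ℝ} {x : Euc N}
    (hx : x ∉ tsupport f) : lap f x = 0 := by
  have h : f =ᶠ[𝓝 x] fun _ => 0 := notMem_tsupport_iff_eventuallyEq.mp hx
  rw [lap_congr h, lap_eq contDiff_const]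
  simp

theorem hasCompactSupport_lap {N : ℕ} {f : Euc N → ℝ} (hf : HasCompactSupport f) :
    HasCompactSupport (lap f) := by
  apply HasCompactSupport.of_support_subset_isCompact hf
  intro x hx
  by_contra h
  exact hx (lap_eq_zero_of_notMem_tsupport h)

theorem integral_grad_grad {N : ℕ} {U ξ : Euc N → ℝ} (hU : ContDiff ℝ 2 U) (hξ : ContDiff ℝ 1 ξ)
    (hc : HasCompactSupport ξ) :
    ∫ x, ⟪gradient U x, gradient ξ x⟫ = - ∫ x, lap U x * ξ x := by
  have hd1 : ∀ i : Fin N, ContDiff ℝ 1 (fun y => fderiv ℝ U y (EuclideanSpace.single i (1:ℝ))) :=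
    fun i => (hU.fderiv_right (m := 1) (by norm_num)).clm_apply contDiff_const
  have hdx := hξ.differentiable (by norm_num)
  have e2 : ∀ x : Euc N, ⟪gradient U x, gradient ξ x⟫ = ∑ i, gradient U x i * gradient ξ x i := by
    intro x
    rw [PiLp.inner_apply]
    exact Finset.sum_congr rfl (fun i _ => by simp [mul_comm])
  have hcg : ∀ i : Fin N, HasCompactSupport (fun x => fderiv ℝ ξ x (EuclideanSpace.single i (1:ℝ))) :=
    fun i => hc.fderiv_apply ℝ _
  have hi1 : ∀ i : Fin N, Integrable (fun x => fderiv ℝ U x (EuclideanSpace.single i (1:ℝ)) *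
      fderiv ℝ ξ x (EuclideanSpace.single i (1:ℝ))) := by
    intro i
    apply Continuous.integrable_of_hasCompactSupport
    · exact (hd1 i).continuous.mul
        ((hξ.continuous_fderiv (by norm_num)).clm_apply continuous_const)
    · exact (hcg i).mul_left
  have hi2 : ∀ i : Fin N, Integrable (fun x =>
      fderiv ℝ (fun y => fderiv ℝ U y (EuclideanSpace.single i (1:ℝ))) x
      (EuclideanSpace.single i 1) * ξ x) := by
    intro i
    apply Continuous.integrable_of_hasCompactSupport
    · exact (((hd1 i).continuous_fderiv (by norm_num)).clm_apply continuous_const).mul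
        hξ.continuous
    · exact hc.mul_left
  simp_rw [e2, lap_eq hU, grad_apply, Finset.sum_mul]
  rw [integral_finsetSum _ (fun i _ => hi1 i), integral_finsetSum _ (fun i _ => hi2 i),
    ← Finset.sum_neg_distrib]
  apply Finset.sum_congr rfl
  intro i _
  apply integral_mul_fderiv_eq_neg_fderiv_mul_of_integrable (hi2 i) (hi1 i)
  · apply Continuous.integrable_of_hasCompactSupport
    · exact (hd1 i).continuous.mul hξ.continuous
    · exact hc.mul_left
  · exact fun x _ => (hd1 i).differentiable (by norm_num) x
  · exact fun x _ => hdx x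

/-- Laplacian of a radial function. -/
theorem lap_radial {N : ℕ} {G : ℝ → ℝ} (hG : ContDiff ℝ 2 G) (x : Euc N) :
    lap (fun y : Euc N => G (‖y‖ ^ 2)) x
      = 4 * ‖x‖ ^ 2 * deriv (deriv G) (‖x‖ ^ 2) + 2 * N * deriv G (‖x‖ ^ 2) := by
  have hG1 : Differentiable ℝ G := hG.differentiable (by norm_num)
  have hGd : ContDiff ℝ 1 (deriv G) := by
    have : ContDiff ℝ (1+1) G := by simpa [one_add_one_eq_two] using hG
    exact (contDiff_succ_iff_deriv.mp this).2.2
  have hG2 : Differentiable ℝ (deriv G) := hGd.differentiable (by norm_num)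
  rw [lap_eq (φ := fun y : Euc N => G (‖y‖ ^ 2)) (hG.comp (contDiff_norm_sq ℝ))]
  have e1 : ∀ (i : Fin N) (y : Euc N),
      fderiv ℝ (fun y : Euc N => G (‖y‖ ^ 2)) y (EuclideanSpace.single i 1)
      = 2 * deriv G (‖y‖ ^ 2) * y i := by
    intro i y
    rw [← grad_apply, (hg_radial (hG1 _).hasDerivAt).gradient]
    simp
  simp_rw [e1]
  have e2 : ∀ (i : Fin N), fderiv ℝ (fun y : Euc N => 2 * deriv G (‖y‖ ^ 2) * y i) x
      (EuclideanSpace.single i 1)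
      = 4 * deriv (deriv G) (‖x‖ ^ 2) * (x i) ^ 2 + 2 * deriv G (‖x‖ ^ 2) := by
    intro i
    have h1 : HasFDerivAt (fun x : Euc N => x i) (EuclideanSpace.proj i : Euc N →L[ℝ] ℝ) x :=
        (EuclideanSpace.proj i : Euc N →L[ℝ] ℝ).hasFDerivAt
    have h2 := hg_const_mul 2 (hg_radial (x := x) (hG2 _).hasDerivAt)
    rw [hasGradientAt_iff_hasFDerivAt] at h2
    rw [HasFDerivAt.fderiv (f := fun y : Euc N => 2 * deriv G (‖y‖ ^ 2) * y i) (h2.mul h1)]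
    simp [inner_smul_left, EuclideanSpace.inner_single_right]
    ring
  simp_rw [e2]
  rw [Finset.sum_add_distrib, ← Finset.mul_sum]
  simp [EuclideanSpace.norm_sq_eq]
  ring
end

set_option linter.unusedSimpArgs false
noncomputable section

/-! ### Part 2 : mollification -/

def th0 (t : ℝ) : ℝ := expNegInvGlue (1 - t)

theorem th0_contDiff {n : ℕ∞} : ContDiff ℝ n th0 :=
  expNegInvGlue.contDiff.comp (contDiff_const.sub contDiff_id)

theorem th0_nonneg (t : ℝ) : 0 ≤ th0 t := expNegInvGlue.nonneg _

theorem th0_zero {t : ℝ} (h : 1 ≤ t) : th0 t = 0 := expNegInvGlue.zero_of_nonpos (by linarith)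

theorem th0_pos {t : ℝ} (h : t < 1) : 0 < th0 t := expNegInvGlue.pos_of_pos (by linarith)

theorem th0_anti : Antitone th0 := fun a b h => expNegInvGlue.monotone (by linarith)

theorem th0_deriv_zero {t : ℝ} (h : 1 < t) : deriv th0 t = 0 := by
  have : th0 =ᶠ[𝓝 t] fun _ => 0 := by
    filter_upwards [lt_mem_nhds h] with s hs using th0_zero hs.le
  rw [this.deriv_eq]; simp

/-- Primitive of `-th0` vanishing for `t ≥ 1`. -/
def Th (t : ℝ) : ℝ := ∫ s in t..1, th0 s

theorem Th_hasDerivAt (t : ℝ) : HasDerivAt Th (-th0 t) t := by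
  unfold Th
  have hc : Continuous th0 := (th0_contDiff (n := 0)).continuous
  exact intervalIntegral.integral_hasDerivAt_left (hc.intervalIntegrable _ _)
    (hc.stronglyMeasurableAtFilter _ _) hc.continuousAt

theorem Th_deriv : deriv Th = fun t => -th0 t := funext fun t => (Th_hasDerivAt t).deriv

theorem Th_contDiff : ContDiff ℝ (⊤ : ℕ∞) Th := by
  have : ContDiff ℝ ((⊤ : ℕ∞) : WithTop ℕ∞) Th := by
    rw [contDiff_infty_iff_deriv]
    exact ⟨fun t => (Th_hasDerivAt t).differentiableAt, by rw [Th_deriv]; exact th0_contDiff.neg⟩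
  exact this

theorem Th_zero {t : ℝ} (h : 1 ≤ t) : Th t = 0 := by
  unfold Th
  rw [intervalIntegral.integral_symm, intervalIntegral.integral_zero_ae, neg_zero]
  filter_upwards with x hx
  rw [Set.uIoc_of_le h] at hx
  exact th0_zero hx.1.le

theorem Th_nonneg (t : ℝ) : 0 ≤ Th t := by
  rcases le_total 1 t with h | h
  · rw [Th_zero h]
  · exact intervalIntegral.integral_nonneg h (fun s _ => th0_nonneg s)

def mollC (N : ℕ) : ℝ := ∫ x : Euc N, th0 (‖x‖ ^ 2)

def mker (N : ℕ) (v : ℝ) (z : Euc N) : ℝ := (mollC N)⁻¹ * v ^ N * th0 (v ^ 2 * ‖z‖ ^ 2)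

theorem th0_normsq_contDiff (N : ℕ) (v : ℝ) :
    ContDiff ℝ (⊤ : ℕ∞) (fun z : Euc N => th0 (v ^ 2 * ‖z‖ ^ 2)) :=
  th0_contDiff.comp (contDiff_const.mul (contDiff_norm_sq ℝ))

theorem compact_radial {N : ℕ} {F : ℝ → ℝ} (hF : ∀ t, 1 ≤ t → F t = 0) {v : ℝ} (hv : 0 < v) :
    tsupport (fun z : Euc N => F (v ^ 2 * ‖z‖ ^ 2)) ⊆ closedBall 0 v⁻¹ := by
  apply closure_minimal _ isClosed_closedBall
  intro z hz
  by_contra h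
  apply hz
  apply hF
  simp only [mem_closedBall, dist_zero_right, not_le] at h
  have : 1 < v * ‖z‖ := by
    rwa [inv_lt_iff_one_lt_mul₀ hv, mul_comm] at h
  nlinarith

theorem mollC_pos (N : ℕ) : 0 < mollC N := by
  unfold mollC
  have hc : HasCompactSupport (fun z : Euc N => th0 (‖z‖ ^ 2)) := by
    have := compact_radial (N := N) (F := th0) (fun t => th0_zero) (v := 1) one_pos
    simp only [one_pow, one_mul, inv_one] at this
    exact (isCompact_closedBall _ _).of_isClosed_subset (isClosed_tsupport _) this
  have hcont : Continuous (fun z : Euc N => th0 (‖z‖ ^ 2)) := by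
    simpa using (th0_normsq_contDiff N 1).continuous
  apply hcont.integral_pos_of_hasCompactSupport_nonneg_nonzero hc (fun z => th0_nonneg _) (x := 0)
  exact (th0_pos (by simp)).ne'

theorem mker_contDiff (N : ℕ) (v : ℝ) : ContDiff ℝ (⊤ : ℕ∞) (mker N v) :=
  contDiff_const.mul (th0_normsq_contDiff N v)

theorem mker_nonneg {N : ℕ} {v : ℝ} (hv : 0 < v) (z : Euc N) : 0 ≤ mker N v z :=
  mul_nonneg (mul_nonneg (inv_nonneg.mpr (mollC_pos N).le) (by positivity)) (th0_nonneg _)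

theorem mker_zero {N : ℕ} {v : ℝ} (hv : 0 < v) {z : Euc N} (hz : v⁻¹ ≤ ‖z‖) : mker N v z = 0 := by
  unfold mker
  rw [th0_zero, mul_zero]
  have : 1 ≤ v * ‖z‖ := by rwa [inv_le_iff_one_le_mul₀ hv, mul_comm] at hz
  nlinarith

theorem mker_tsupport {N : ℕ} {v : ℝ} (hv : 0 < v) : tsupport (mker N v) ⊆ closedBall 0 v⁻¹ := by
  apply closure_minimal _ isClosed_closedBall
  intro z hz
  by_contra h
  simp only [mem_closedBall, dist_zero_right, not_le] at h
  exact hz (mker_zero hv h.le)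

theorem mker_hasCompactSupport {N : ℕ} {v : ℝ} (hv : 0 < v) : HasCompactSupport (mker N v) :=
  (isCompact_closedBall _ _).of_isClosed_subset (isClosed_tsupport _) (mker_tsupport hv)

theorem mker_neg {N : ℕ} (v : ℝ) (z : Euc N) : mker N v (-z) = mker N v z := by simp [mker]

theorem mker_integral {N : ℕ} {v : ℝ} (hv : 0 < v) : ∫ z, mker N v z = 1 := by
  have h := Measure.integral_comp_smul (volume : Measure (Euc N)) (fun z => th0 (‖z‖ ^ 2)) v
  have e : ∀ z : Euc N, mker N v z = ((mollC N)⁻¹ * v ^ N) * th0 (‖v • z‖ ^ 2) := by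
    intro z
    simp [mker, norm_smul, mul_pow]
  simp_rw [e]
  rw [integral_const_mul, h]
  have : |(v ^ N)⁻¹| = (v ^ N)⁻¹ := abs_of_pos (by positivity)
  simp only [finrank_euclideanSpace, Fintype.card_fin, this, smul_eq_mul]
  have h2 := (mollC_pos N).ne'
  change (mollC N)⁻¹ * v ^ N * ((v ^ N)⁻¹ * mollC N) = 1
  have : v ^ N ≠ 0 := by positivity
  field_simp

theorem mker_le {N : ℕ} {v : ℝ} (hv : 0 < v) (z : Euc N) : mker N v z ≤ (mollC N)⁻¹ * v ^ N * th0 0 := by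
  unfold mker
  apply mul_le_mul_of_nonneg_left (th0_anti (by positivity))
  have := (mollC_pos N).le
  positivity

theorem mker_lower {N : ℕ} {v : ℝ} (hv : 0 < v) : ∃ c > 0, ∀ z : Euc N, ‖z‖ ≤ (2 * v)⁻¹ → c ≤ mker N v z := by
  refine ⟨(mollC N)⁻¹ * v ^ N * th0 (1/4), ?_, ?_⟩
  · have := mollC_pos N
    have := th0_pos (t := 1/4) (by norm_num)
    positivity
  · intro z hz
    unfold mker
    apply mul_le_mul_of_nonneg_left (th0_anti _)
    · have := (mollC_pos N).le
      positivity
    · have : v * ‖z‖ ≤ 1/2 := by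
        calc v * ‖z‖ ≤ v * (2 * v)⁻¹ := by gcongr
          _ = 1/2 := by field_simp
      have h0 : 0 ≤ v * ‖z‖ := by positivity
      nlinarith

/-- The mollification of `u` at scale `v⁻¹`. -/
def moll {N : ℕ} (u : Euc N → ℝ) (v : ℝ) (x : Euc N) : ℝ := ∫ y, u y * mker N v (x - y)

theorem moll_ae_tendsto {N : ℕ} {u : Euc N → ℝ} (hu : LocallyIntegrable u) :
    ∀ᵐ x, Tendsto (fun v => moll u v x) atTop (𝓝 (u x)) := by
  filter_upwards [(Besicovitch.vitaliFamily volume).ae_tendsto_average_norm_sub hu] with x h₀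
  have hφ' : Tendsto (fun v : ℝ ↦ v⁻¹) atTop (𝓝[>] 0) := tendsto_inv_atTop_nhdsGT_zero
  have := (h₀.comp (Besicovitch.tendsto_filterAt volume x)).comp hφ'
  have h2 : ∀ v, moll u v x = ∫ y, mker N v (x - y) • u y := by
    intro v; unfold moll; simp [mul_comm]
  simp_rw [h2]
  apply tendsto_integral_smul_of_tendsto_average_norm_sub
    ((mollC N)⁻¹ * th0 0 * volume.real (ball (0 : Euc N) 1)) this
  · filter_upwards with i using
      hu.integrableOn_isCompact (isCompact_closedBall _ _)
  · apply tendsto_const_nhds.congr'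
    filter_upwards [eventually_gt_atTop 0] with v hv
    rw [integral_sub_left_eq_self (fun z => mker N v z) volume x, mker_integral hv]
  · filter_upwards [eventually_gt_atTop 0] with v hv
    intro y hy
    by_contra h
    apply hy
    simp only [Function.comp, mem_closedBall, not_le] at h
    apply mker_zero hv
    rw [← dist_eq_norm_sub, dist_comm]
    exact h.le
  · filter_upwards [eventually_gt_atTop 0] with v hv y
    rw [abs_of_nonneg (mker_nonneg hv _)]
    refine (mker_le hv _).trans (le_of_eq ?_)
    have : volume.real (closedBall x v⁻¹) = (v ^ N)⁻¹ * volume.real (ball (0 : Euc N) 1) := by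
      rw [Measure.real, Measure.addHaar_closedBall _ _ (by positivity), ENNReal.toReal_mul,
        ENNReal.toReal_ofReal (by positivity)]
      simp [Measure.real]
    rw [this]
    have hb : volume.real (ball (0 : Euc N) 1) ≠ 0 := by
      rw [Measure.real]
      exact (ENNReal.toReal_pos (measure_ball_pos _ _ one_pos).ne' measure_ball_lt_top.ne).ne'
    have : v ^ N ≠ 0 := by positivity
    field_simp

theorem moll_eq_conv {N : ℕ} (u : Euc N → ℝ) (v : ℝ) :
    moll u v = convolution u (mker N v) (ContinuousLinearMap.mul ℝ ℝ) volume := by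
  ext x
  simp [moll, convolution]

theorem moll_contDiff {N : ℕ} {u : Euc N → ℝ} (hu : LocallyIntegrable u) {v : ℝ} (hv : 0 < v) :
    ContDiff ℝ (⊤ : ℕ∞) (moll u v) := by
  rw [moll_eq_conv]
  exact (mker_hasCompactSupport hv).contDiff_convolution_right _ hu (mker_contDiff N v)

theorem conv_fderiv {N : ℕ} {u k : Euc N → ℝ} (hu : LocallyIntegrable u)
    (hk : ContDiff ℝ 1 k) (hc : HasCompactSupport k) (x v : Euc N) :
    fderiv ℝ (fun x => ∫ y, u y * k (x - y)) x v = ∫ y, u y * fderiv ℝ k (x - y) v := by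
  have h := hc.hasFDerivAt_convolution_right (ContinuousLinearMap.mul ℝ ℝ) hu hk x
  have e : (fun x => ∫ y, u y * k (x - y)) = convolution u k (ContinuousLinearMap.mul ℝ ℝ) volume := by
    ext x; simp [convolution]
  rw [e, h.fderiv, convolution]
  rw [ContinuousLinearMap.integral_apply]
  · simp
  · exact (hc.fderiv (𝕜 := ℝ)).convolutionExists_right _ hu (hk.continuous_fderiv (by norm_num)) x

theorem conv_lap {N : ℕ} {u k : Euc N → ℝ} (hu : LocallyIntegrable u)
    (hk : ContDiff ℝ 2 k) (hc : HasCompactSupport k) (x : Euc N) :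
    lap (fun x => ∫ y, u y * k (x - y)) x = ∫ y, u y * lap k (x - y) := by
  have e : (fun x => ∫ y, u y * k (x - y)) = convolution u k (ContinuousLinearMap.mul ℝ ℝ) volume := by
    ext x; simp [convolution]
  have h2 : ContDiff ℝ 2 (fun x => ∫ y, u y * k (x - y)) := by
    rw [e]
    exact hc.contDiff_convolution_right _ hu hk
  have hd1 : ∀ i : Fin N, ContDiff ℝ 1 (fun y => fderiv ℝ k y (EuclideanSpace.single i (1:ℝ))) :=
    fun i => (hk.fderiv_right (m := 1) (by norm_num)).clm_apply contDiff_const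
  rw [lap_eq h2]
  simp_rw [lap_eq hk, conv_fderiv hu (hk.of_le (by norm_num)) hc, Finset.mul_sum]
  rw [integral_finsetSum]
  · apply Finset.sum_congr rfl
    intro i _
    exact conv_fderiv hu (hd1 i) (hc.fderiv_apply ℝ _) x _
  · intro i _
    have := ((hc.fderiv_apply ℝ (EuclideanSpace.single i (1:ℝ))).fderiv_apply ℝ (EuclideanSpace.single i (1:ℝ))).convolutionExists_right
      (ContinuousLinearMap.mul ℝ ℝ) hu (((hd1 i).continuous_fderiv (by norm_num)).clm_apply continuous_const) x
    simpa [ConvolutionExistsAt] using this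
end

set_option linter.unusedSimpArgs false
noncomputable section

/-! ### Part 3 : superharmonic functions -/

/-- Nonnegative distributional superharmonic functions. -/
def SH {N : ℕ} (Ω : Set (Euc N)) (u : Euc N → ℝ) : Prop :=
  LocallyIntegrableOn u Ω ∧ (∀ᵐ x, x ∈ Ω → 0 ≤ u x) ∧
    ∀ φ : Euc N → ℝ, IsTestFun Ω φ → (∀ x, 0 ≤ φ x) → ∫ x, u x * lap φ x ≤ 0

theorem lap_comp_sub {N : ℕ} (f : Euc N → ℝ) (x y : Euc N) :
    lap (fun y => f (y - x)) y = lap f (y - x) := by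
  unfold lap
  rw [iteratedFDeriv_comp_sub]

theorem tsupport_comp_sub {N : ℕ} {f : Euc N → ℝ} {ρ : ℝ} (x : Euc N)
    (h : tsupport f ⊆ closedBall 0 ρ) : tsupport (fun y => f (y - x)) ⊆ closedBall x ρ := by
  apply closure_minimal _ isClosed_closedBall
  intro y hy
  have : y - x ∈ closedBall (0 : Euc N) ρ := h (subset_tsupport _ hy)
  simpa [dist_eq_norm] using this

theorem testFun_of_translate {N : ℕ} {Ω : Set (Euc N)} {f : Euc N → ℝ} {ρ : ℝ} {x : Euc N}
    (hf : ContDiff ℝ (⊤ : ℕ∞) f) (h : tsupport f ⊆ closedBall 0 ρ) (hΩ : closedBall x ρ ⊆ Ω) :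
    IsTestFun Ω (fun y => f (y - x)) := by
  have h1 := tsupport_comp_sub x h
  refine ⟨hf.comp (contDiff_id.sub contDiff_const), ?_, h1.trans hΩ⟩
  exact (isCompact_closedBall _ _).of_isClosed_subset (isClosed_tsupport _) h1

theorem moll_monotone {N : ℕ} (hN : 3 ≤ N) {Ω : Set (Euc N)} {u : Euc N → ℝ} (hu : SH Ω u)
    {x : Euc N} {ρ : ℝ} (hρ : 0 < ρ) (hΩ : closedBall x ρ ⊆ Ω) :
    MonotoneOn (fun v => moll u v x) (Set.Ioi ρ⁻¹) := by
  have hint : IntegrableOn u (closedBall x ρ) :=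
    hu.1.integrableOn_compact_subset hΩ (isCompact_closedBall _ _)
  set kd : ℝ → Euc N → ℝ := fun v z => (mollC N)⁻¹ * (N * v ^ (N-1) * th0 (v ^ 2 * ‖z‖ ^ 2)
    + v ^ N * ((2 * v * ‖z‖ ^ 2) * deriv th0 (v ^ 2 * ‖z‖ ^ 2))) with hkd
  have th1 : Differentiable ℝ th0 := (th0_contDiff (n := 1)).differentiable (by norm_num)
  have thc : Continuous (deriv th0) := (th0_contDiff (n := 1)).continuous_deriv (by norm_num)
  have th0c : Continuous th0 := (th0_contDiff (n := 0)).continuous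
  have hk : ∀ (z : Euc N) v, HasDerivAt (fun v => mker N v z) (kd v z) v := by
    intro z v
    unfold mker
    have h1 : HasDerivAt (fun v : ℝ => v ^ 2 * ‖z‖ ^ 2) (2 * v * ‖z‖ ^ 2) v := by
      simpa using (hasDerivAt_pow 2 v).mul_const (‖z‖ ^ 2)
    have h2 : HasDerivAt (fun v : ℝ => th0 (v ^ 2 * ‖z‖ ^ 2))
        (deriv th0 (v ^ 2 * ‖z‖ ^ 2) * (2 * v * ‖z‖ ^ 2)) v :=
      HasDerivAt.comp (h₂ := th0) v (th1 _).hasDerivAt h1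
    have h3 := ((hasDerivAt_pow N v).mul h2).const_mul (mollC N)⁻¹
    have h4 : (fun v => (mollC N)⁻¹ * v ^ N * th0 (v ^ 2 * ‖z‖ ^ 2)) = fun y =>
      (mollC N)⁻¹ * ((fun x : ℝ => x ^ N) * fun v => th0 (v ^ 2 * ‖z‖ ^ 2)) y := by
      ext w; simp; ring
    rw [h4]
    exact h3.congr_deriv (by simp only [hkd]; ring)
  have hkz : ∀ v z, ρ⁻¹ < v → ρ < ‖z‖ → kd v z = 0 := by
    intro v z hv hz
    have h1 : 1 < v * ‖z‖ := by
      have : ρ⁻¹ * ρ = 1 := inv_mul_cancel₀ hρ.ne'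
      have h0 : 0 < ρ⁻¹ := by positivity
      nlinarith
    have h2 : 1 < v ^ 2 * ‖z‖ ^ 2 := by nlinarith
    simp [hkd, th0_zero h2.le, th0_deriv_zero h2]
  have hkcont : Continuous (fun p : ℝ × Euc N => kd p.1 p.2) := by
    simp only [hkd]
    fun_prop
  have hD : ∀ v0 ∈ Set.Ioi ρ⁻¹, HasDerivAt (fun v => moll u v x) (∫ y, u y * kd v0 (x - y)) v0 := by
    intro v0 hv0
    have hv0' : ρ⁻¹ < v0 := hv0
    obtain ⟨C, hC⟩ := ((isCompact_Icc (a := ρ⁻¹) (b := v0 + 1)).prod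
      (isCompact_closedBall (0 : Euc N) ρ)).exists_bound_of_continuousOn hkcont.continuousOn
    have hs : Set.Ioo ρ⁻¹ (v0 + 1) ∈ 𝓝 v0 := Ioo_mem_nhds hv0 (by linarith)
    have hsupp : ∀ v, ρ⁻¹ < v → ∀ y, y ∉ closedBall x ρ → mker N v (x - y) = 0 := by
      intro v hv y hy
      have hv' : 0 < v := lt_trans (by positivity) hv
      apply mker_zero hv'
      simp only [mem_closedBall, not_le] at hy
      rw [← dist_eq_norm_sub, dist_comm]
      have : v⁻¹ < ρ := by
        rw [inv_lt_comm₀ hv' hρ]; exact hv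
      linarith
    have hmeas : ∀ k : Euc N → ℝ, Continuous k → (∀ y, y ∉ closedBall x ρ → k (x - y) = 0) →
        Integrable (fun y => u y * k (x - y)) := by
      intro k hk h0
      have : IntegrableOn (fun y => u y * k (x - y)) (closedBall x ρ) :=
        hint.mul_continuousOn (by fun_prop) (isCompact_closedBall _ _)
      rw [← integrableOn_univ]
      refine this.of_forall_sdiff_eq_zero MeasurableSet.univ ?_
      intro y hy
      simp [h0 y hy.2]
    have := hasDerivAt_integral_of_dominated_loc_of_deriv_le (μ := (volume : Measure (Euc N)))
      (F := fun v y => u y * mker N v (x - y)) (F' := fun v y => u y * kd v (x - y)) (x₀ := v0)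
      (bound := (closedBall x ρ).indicator (fun y => C * ‖u y‖)) hs ?_ ?_ ?_ ?_ ?_ ?_
    · exact this.2
    · filter_upwards [hs] with v hv
      exact (hmeas _ (mker_contDiff N v).continuous (hsupp v hv.1)).aestronglyMeasurable
    · exact hmeas _ (mker_contDiff N v0).continuous (hsupp v0 hv0)
    · refine (hmeas (kd v0) (by fun_prop) ?_).aestronglyMeasurable
      intro y hy
      apply hkz _ _ hv0
      simp only [mem_closedBall, not_le] at hy
      rwa [← dist_eq_norm_sub, dist_comm]
    · filter_upwards with y v hv
      by_cases hy : y ∈ closedBall x ρ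
      · rw [Set.indicator_of_mem hy, norm_mul, mul_comm]
        gcongr
        apply hC (v, x - y) ⟨⟨hv.1.le, hv.2.le⟩, ?_⟩
        simp only [mem_closedBall, dist_zero_right]
        rwa [mem_closedBall, dist_comm, dist_eq_norm_sub] at hy
      · rw [hkz _ _ hv.1]
        · simp [hy]
        · simp only [mem_closedBall, not_le] at hy
          rwa [← dist_eq_norm_sub, dist_comm]
    · rw [integrable_indicator_iff measurableSet_closedBall]
      exact hint.norm.const_mul C
    · filter_upwards with y v hv
      exact (hk (x - y) v).const_mul (u y)
  apply monotoneOn_of_deriv_nonneg (convex_Ioi _)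
  · exact fun v hv => (hD v hv).continuousAt.continuousWithinAt
  · rw [interior_Ioi]
    exact fun v hv => (hD v hv).differentiableAt.differentiableWithinAt
  · rw [interior_Ioi]
    intro v hv
    rw [(hD v hv).deriv]
    have hv' : 0 < v := lt_trans (by positivity : 0 < ρ⁻¹) hv
    have hvρ : v⁻¹ ≤ ρ := by
      rw [inv_le_comm₀ hv' hρ]; exact (le_of_lt hv)
    have hG : ContDiff ℝ (⊤ : ℕ∞) (fun t => Th (v ^ 2 * t)) :=
      Th_contDiff.comp (contDiff_const.mul contDiff_id)
    have hG' : deriv (fun t => Th (v ^ 2 * t)) = fun t => -(v ^ 2 * th0 (v ^ 2 * t)) := by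
      ext t
      have := HasDerivAt.comp t (Th_hasDerivAt (v ^ 2 * t)) ((hasDerivAt_id t).const_mul (v ^ 2))
      rw [HasDerivAt.deriv (f := fun t => Th (v ^ 2 * t)) this]
      ring
    have hG'' : ∀ t, deriv (fun t => -(v ^ 2 * th0 (v ^ 2 * t))) t
        = -(v ^ 4 * deriv th0 (v ^ 2 * t)) := by
      intro t
      have := ((HasDerivAt.comp t (th1 (v ^ 2 * t)).hasDerivAt
        ((hasDerivAt_id t).const_mul (v ^ 2))).const_mul (v ^ 2)).neg
      rw [HasDerivAt.deriv (f := fun t => -(v ^ 2 * th0 (v ^ 2 * t))) this]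
      ring
    set f : Euc N → ℝ := fun z => Th (v ^ 2 * ‖z‖ ^ 2) with hf
    have hfs : ContDiff ℝ (⊤ : ℕ∞) f := hG.comp (contDiff_norm_sq ℝ)
    have hts : tsupport f ⊆ closedBall 0 ρ :=
      (compact_radial (F := Th) (fun t => Th_zero) hv').trans (closedBall_subset_closedBall hvρ)
    have htest := hu.2.2 _ (testFun_of_translate hfs hts hΩ) (fun y => Th_nonneg _)
    have hlap : ∀ y, kd v (x - y)
        = -((mollC N)⁻¹ / 2 * v ^ (N - 3)) * lap (fun y => f (y - x)) y := by
      intro y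
      rw [lap_comp_sub, hf, lap_radial (G := fun t => Th (v ^ 2 * t)) (hG.of_le two_le_infty), hG', hG'']
      simp only [hkd]
      rw [norm_sub_rev x y]
      obtain ⟨n, rfl⟩ : ∃ n, N = n + 3 := ⟨N - 3, by omega⟩
      simp only [Nat.add_sub_cancel, show n + 3 - 1 = n + 2 by omega]
      push_cast
      ring
    have : ∫ y, u y * kd v (x - y)
        = -((mollC N)⁻¹ / 2 * v ^ (N - 3)) * ∫ y, u y * lap (fun y => f (y - x)) y := by
      rw [← integral_const_mul]
      congr 1; ext y; rw [hlap]; ring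
    rw [this]
    have := mollC_pos N
    apply mul_nonneg_of_nonpos_of_nonpos _ htest
    have : 0 ≤ (mollC N)⁻¹ / 2 * v ^ (N - 3) := by positivity
    linarith

theorem ae_of_local {N : ℕ} {Ω : Set (Euc N)} {P : Euc N → Prop}
    (h : ∀ x ∈ Ω, ∃ T ∈ 𝓝 x, ∀ᵐ y, y ∈ T → P y) : ∀ᵐ y, y ∈ Ω → P y := by
  have : volume {y | ¬ (y ∈ Ω → P y)} = 0 := by
    apply measure_null_of_locally_null
    intro x hx
    have hx' : x ∈ Ω ∧ ¬ P x := by simpa using hx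
    obtain ⟨T, hT, hTP⟩ := h x hx'.1
    refine ⟨T ∩ {y | ¬ (y ∈ Ω → P y)}, inter_mem (mem_nhdsWithin_of_mem_nhds hT) self_mem_nhdsWithin, ?_⟩
    refine measure_mono_null ?_ hTP
    rintro y ⟨hy1, hy2⟩
    simp only [Set.mem_ofPred_eq, Classical.not_imp] at hy2
    simp only [Set.mem_compl_iff, Set.mem_ofPred_eq, Classical.not_imp]
    exact ⟨hy1, hy2.2⟩
  exact this

theorem moll_congr {N : ℕ} {u w : Euc N → ℝ} {v ρ : ℝ} {x : Euc N} (hv : 0 < v) (hvρ : v⁻¹ ≤ ρ)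
    (h : ∀ y ∈ closedBall x ρ, u y = w y) : moll u v x = moll w v x := by
  unfold moll
  congr 1; ext y
  by_cases hy : y ∈ closedBall x ρ
  · rw [h y hy]
  · rw [mker_zero hv]
    · simp
    · simp only [mem_closedBall, not_le] at hy
      rw [← dist_eq_norm_sub, dist_comm]
      linarith

/-- a.e. convergence of mollifications for locally integrable functions on an open set. -/
theorem moll_ae_tendsto_local {N : ℕ} {Ω : Set (Euc N)} (hO : IsOpen Ω) {u : Euc N → ℝ}
    (hu : LocallyIntegrableOn u Ω) :
    ∀ᵐ x, x ∈ Ω → Tendsto (fun v => moll u v x) atTop (𝓝 (u x)) := by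
  apply ae_of_local
  intro x hx
  obtain ⟨R, hR, hRΩ⟩ := Metric.isOpen_iff.mp hO x hx
  have hint : IntegrableOn u (closedBall x (R/2)) :=
    hu.integrableOn_compact_subset ((closedBall_subset_ball (by linarith)).trans hRΩ)
      (isCompact_closedBall _ _)
  have hi2 : Integrable ((closedBall x (R/2)).indicator u) :=
    (integrable_indicator_iff measurableSet_closedBall).mpr hint
  refine ⟨ball x (R/4), ball_mem_nhds _ (by linarith), ?_⟩
  filter_upwards [moll_ae_tendsto hi2.locallyIntegrable] with y hy hyb
  have hyb' : dist y x < R/4 := hyb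
  have e1 : (closedBall x (R/2)).indicator u y = u y :=
    Set.indicator_of_mem (by rw [mem_closedBall]; linarith) _
  rw [e1] at hy
  apply hy.congr'
  have h4 : Tendsto (fun v : ℝ => v⁻¹) atTop (𝓝 0) := tendsto_inv_atTop_zero
  filter_upwards [eventually_gt_atTop 0, h4.eventually_le_const (show (0:ℝ) < R/4 by linarith)]
    with v hv hv2
  apply moll_congr hv hv2
  intro z hz
  apply Set.indicator_of_mem
  rw [mem_closedBall] at *
  linarith [dist_triangle z y x]

theorem moll_le_ae {N : ℕ} (hN : 3 ≤ N) {Ω : Set (Euc N)} (hO : IsOpen Ω) {u : Euc N → ℝ}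
    (hu : SH Ω u) :
    ∀ᵐ x, x ∈ Ω → ∀ v > 0, closedBall x (2 * v⁻¹) ⊆ Ω → moll u v x ≤ u x := by
  filter_upwards [moll_ae_tendsto_local hO hu.1] with x hx hxΩ v hv hb
  have hm := moll_monotone hN hu (show (0:ℝ) < 2 * v⁻¹ by positivity) hb
  have hv2 : v ∈ Set.Ioi (2 * v⁻¹)⁻¹ := by
    rw [Set.mem_Ioi, mul_inv, inv_inv]; linarith
  apply ge_of_tendsto (hx hxΩ)
  filter_upwards [eventually_ge_atTop v] with w hw
  exact hm hv2 (lt_of_lt_of_le hv2 hw) hw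
end

set_option linter.unusedSimpArgs false
noncomputable section

/-! ### Part 4 : weak Harnack inequality -/

theorem harnack_step {N : ℕ} (hN : 3 ≤ N) {Ω : Set (Euc N)} (hO : IsOpen Ω) {x : Euc N}
    (hx : x ∈ Ω) : ∃ ρ > 0, ball x ρ ⊆ Ω ∧ ∃ C : ℝ≥0∞, C ≠ ⊤ ∧ ∀ u : Euc N → ℝ, SH Ω u →
      ∀ᵐ y, y ∈ ball x ρ → ∫⁻ z in ball x ρ, ENNReal.ofReal (u z) ≤ C * ENNReal.ofReal (u y) := by
  obtain ⟨R, hR, hRΩ⟩ := Metric.isOpen_iff.mp hO x hx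
  -- scale s = R / 4 , ρ = s / 4
  set s := R / 4 with hs
  have hspos : 0 < s := by positivity
  obtain ⟨c, hc, hlow⟩ := mker_lower (N := N) (v := s⁻¹) (by positivity)
  have hρΩ : ball x (s/4) ⊆ Ω := (ball_subset_ball (by linarith)).trans hRΩ
  refine ⟨s / 4, by positivity, hρΩ, ENNReal.ofReal c⁻¹, ENNReal.ofReal_ne_top, ?_⟩
  intro u hu
  filter_upwards [moll_le_ae hN hO hu] with y hy hyb
  have hyb' : dist y x < s / 4 := hyb
  have hb : closedBall y (2 * (s⁻¹)⁻¹) ⊆ Ω := by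
    rw [inv_inv]
    intro z hz
    apply hRΩ
    rw [mem_closedBall] at hz
    rw [mem_ball]
    linarith [dist_triangle z y x]
  have h1 := hy (hρΩ hyb) s⁻¹ (by positivity) hb
  have hsub : ball x (s/4) ⊆ closedBall y (2 * (s⁻¹)⁻¹) := by
    intro z hz
    rw [mem_ball] at hz
    rw [mem_closedBall, inv_inv]
    linarith [dist_triangle z x y, dist_comm x y]
  have hint : IntegrableOn u (closedBall y (2 * (s⁻¹)⁻¹)) :=
    hu.1.integrableOn_compact_subset hb (isCompact_closedBall _ _)
  have hintb : IntegrableOn u (ball x (s/4)) := hint.mono_set hsub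
  have hz0 : ∀ z, z ∉ closedBall y (2 * (s⁻¹)⁻¹) → mker N s⁻¹ (y - z) = 0 := by
    intro z hz
    apply mker_zero (by positivity)
    simp only [mem_closedBall, not_le, inv_inv] at hz
    rw [← dist_eq_norm_sub, dist_comm, inv_inv]
    linarith
  have hintm : Integrable (fun z => u z * mker N s⁻¹ (y - z)) := by
    have : IntegrableOn (fun z => u z * mker N s⁻¹ (y - z)) (closedBall y (2 * (s⁻¹)⁻¹)) :=
      hint.mul_continuousOn (by have := (mker_contDiff N s⁻¹).continuous; fun_prop)
        (isCompact_closedBall _ _)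
    rw [← integrableOn_univ]
    refine this.of_forall_sdiff_eq_zero MeasurableSet.univ ?_
    intro z hz
    simp [hz0 z hz.2]
  have hnn : ∀ᵐ z, 0 ≤ u z * mker N s⁻¹ (y - z) := by
    filter_upwards [hu.2.1] with z hz
    by_cases hzm : z ∈ closedBall y (2 * (s⁻¹)⁻¹)
    · exact mul_nonneg (hz (hb hzm)) (mker_nonneg (by positivity) _)
    · simp [hz0 z hzm]
  have h2 : c * ∫ z in ball x (s/4), u z ≤ moll u s⁻¹ y := by
    rw [← integral_const_mul]
    calc ∫ z in ball x (s/4), c * u z ≤ ∫ z in ball x (s/4), u z * mker N s⁻¹ (y - z) := by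
          apply integral_mono_ae (hintb.const_mul c) hintm.integrableOn
          filter_upwards [ae_restrict_mem measurableSet_ball, ae_restrict_of_ae hu.2.1] with z hz hz2
          rw [mul_comm c]
          apply mul_le_mul_of_nonneg_left _ (hz2 (hρΩ hz))
          apply hlow
          rw [mem_ball] at hz
          have : (2 * s⁻¹)⁻¹ = s/2 := by field_simp
          rw [this, ← dist_eq_norm_sub]
          linarith [dist_triangle z x y, dist_comm x y, dist_comm y z]
      _ ≤ ∫ z, u z * mker N s⁻¹ (y - z) := setIntegral_le_integral hintm hnn
  have h3 : ∫⁻ z in ball x (s/4), ENNReal.ofReal (u z) = ENNReal.ofReal (∫ z in ball x (s/4), u z) := by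
    rw [ofReal_integral_eq_lintegral_ofReal hintb]
    filter_upwards [ae_restrict_mem measurableSet_ball, ae_restrict_of_ae hu.2.1] with z hz hz2
    exact hz2 (hρΩ hz)
  rw [h3, ← ENNReal.ofReal_mul (by positivity)]
  apply ENNReal.ofReal_le_ofReal
  rw [inv_mul_eq_div, le_div_iff₀ hc]
  linarith

theorem harnack_chain {N : ℕ} (hN : 3 ≤ N) {Ω : Set (Euc N)} (hO : IsOpen Ω)
    (hconn : IsPreconnected Ω) {a : Euc N} (ha : a ∈ Ω) :
    ∃ ρ > 0, ∀ x ∈ Ω, ∃ ρ' > 0, ∃ C : ℝ≥0∞, C ≠ ⊤ ∧ ∀ u : Euc N → ℝ, SH Ω u →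
      ∀ᵐ y, y ∈ ball x ρ' → ∫⁻ z in ball a ρ, ENNReal.ofReal (u z) ≤ C * ENNReal.ofReal (u y) := by
  obtain ⟨ρ, hρ, -, Ca, hCa, hstepa⟩ := harnack_step hN hO ha
  refine ⟨ρ, hρ, ?_⟩
  set G : Set (Euc N) := {x | ∃ ρ' > 0, ∃ C : ℝ≥0∞, C ≠ ⊤ ∧ ∀ u : Euc N → ℝ, SH Ω u →
      ∀ᵐ y, y ∈ ball x ρ' → ∫⁻ z in ball a ρ, ENNReal.ofReal (u z) ≤ C * ENNReal.ofReal (u y)} with hG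
  have hGo : IsOpen G := by
    rw [Metric.isOpen_iff]
    rintro x ⟨ρ', hρ', C, hC, h⟩
    refine ⟨ρ', hρ', ?_⟩
    intro x' hx'
    rw [mem_ball] at hx'
    refine ⟨ρ' - dist x' x, by linarith, C, hC, ?_⟩
    intro u hu
    filter_upwards [h u hu] with y hy hyb
    apply hy
    rw [mem_ball] at *
    linarith [dist_triangle y x' x]
  apply hconn.subset_of_closure_inter_subset hGo ⟨a, ha, ρ, hρ, Ca, hCa, hstepa⟩
  rintro x ⟨hxc, hxΩ⟩
  obtain ⟨ρ0, hρ0, hsub, C0, hC0, hstep⟩ := harnack_step hN hO hxΩ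
  obtain ⟨x', hx'G, hx'd⟩ := Metric.mem_closure_iff.mp hxc ρ0 hρ0
  obtain ⟨ρ', hρ', C', hC', h'⟩ := hx'G
  set P := ball x ρ0 ∩ ball x' ρ' with hP
  have hPo : IsOpen P := isOpen_ball.inter isOpen_ball
  have hPpos : 0 < volume P := hPo.measure_pos _ ⟨x', by rw [mem_ball, dist_comm]; exact hx'd, mem_ball_self hρ'⟩
  have hPfin : volume P ≠ ⊤ := (measure_mono_top Set.inter_subset_left).mt measure_ball_lt_top.ne
  refine ⟨ρ0, hρ0, (volume P)⁻¹ * (C' * C0), ?_, ?_⟩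
  · exact ENNReal.mul_ne_top (ENNReal.inv_ne_top.mpr hPpos.ne') (ENNReal.mul_ne_top hC' hC0)
  intro u hu
  filter_upwards [hstep u hu] with y hy hyb
  have h2 := hy hyb
  have h3 : (∫⁻ z in ball a ρ, ENNReal.ofReal (u z)) * volume P ≤ C' * ∫⁻ z in ball x ρ0, ENNReal.ofReal (u z) := by
    rw [← lintegral_const_mul' _ _ hC', ← setLIntegral_const]
    calc _ ≤ ∫⁻ z in P, C' * ENNReal.ofReal (u z) := by
          apply setLIntegral_mono_ae' hPo.measurableSet
          filter_upwards [h' u hu] with z hz hzP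
          exact hz hzP.2
      _ ≤ _ := lintegral_mono_set Set.inter_subset_left
  calc ∫⁻ z in ball a ρ, ENNReal.ofReal (u z)
      = (volume P)⁻¹ * ((∫⁻ z in ball a ρ, ENNReal.ofReal (u z)) * volume P) := by
        rw [mul_comm, mul_assoc, ENNReal.mul_inv_cancel hPpos.ne' hPfin, mul_one]
    _ ≤ (volume P)⁻¹ * (C' * ∫⁻ z in ball x ρ0, ENNReal.ofReal (u z)) := by gcongr
    _ ≤ (volume P)⁻¹ * (C' * (C0 * ENNReal.ofReal (u y))) := by gcongr
    _ = _ := by ring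

theorem harnack {N : ℕ} (hN : 3 ≤ N) {Ω : Set (Euc N)} (hO : IsOpen Ω)
    (hconn : IsPreconnected Ω) {K A : Set (Euc N)} (hK : IsCompact K) (hKΩ : K ⊆ Ω)
    (hA : IsCompact A) (hAΩ : A ⊆ Ω) :
    ∃ C : ℝ≥0∞, C ≠ ⊤ ∧ ∀ u : Euc N → ℝ, SH Ω u →
      ∀ᵐ y, y ∈ K → ∫⁻ z in A, ENNReal.ofReal (u z) ≤ C * ENNReal.ofReal (u y) := by
  refine hA.induction_on (p := fun A => ∃ C : ℝ≥0∞, C ≠ ⊤ ∧ ∀ u : Euc N → ℝ, SH Ω u →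
      ∀ᵐ y, y ∈ K → ∫⁻ z in A, ENNReal.ofReal (u z) ≤ C * ENNReal.ofReal (u y)) ?_ ?_ ?_ ?_
  · exact ⟨0, by simp, by simp⟩
  · rintro s t hst ⟨C, hC, h⟩
    refine ⟨C, hC, fun u hu => ?_⟩
    filter_upwards [h u hu] with y hy hyK
    exact (lintegral_mono_set hst).trans (hy hyK)
  · rintro s t ⟨C, hC, h⟩ ⟨C', hC', h'⟩
    refine ⟨C + C', by simp [hC, hC'], fun u hu => ?_⟩
    filter_upwards [h u hu, h' u hu] with y hy hy' hyK
    rw [add_mul]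
    exact (lintegral_union_le _ _ _).trans (add_le_add (hy hyK) (hy' hyK))
  · intro a ha
    obtain ⟨ρ, hρ, hch⟩ := harnack_chain hN hO hconn (hAΩ ha)
    refine ⟨ball a ρ, mem_nhdsWithin_of_mem_nhds (ball_mem_nhds _ hρ), ?_⟩
    refine hK.induction_on (p := fun K => ∃ C : ℝ≥0∞, C ≠ ⊤ ∧ ∀ u : Euc N → ℝ, SH Ω u →
      ∀ᵐ y, y ∈ K → ∫⁻ z in ball a ρ, ENNReal.ofReal (u z) ≤ C * ENNReal.ofReal (u y)) ?_ ?_ ?_ ?_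
    · exact ⟨0, by simp, by simp⟩
    · rintro s t hst ⟨C, hC, h⟩
      refine ⟨C, hC, fun u hu => ?_⟩
      filter_upwards [h u hu] with y hy hyK
      exact hy (hst hyK)
    · rintro s t ⟨C, hC, h⟩ ⟨C', hC', h'⟩
      refine ⟨C + C', by simp [hC, hC'], fun u hu => ?_⟩
      filter_upwards [h u hu, h' u hu] with y hy hy' hyK
      rw [add_mul]
      rcases hyK with hyK | hyK
      · exact (hy hyK).trans le_self_add
      · exact (hy' hyK).trans le_add_self
    · intro x hx
      obtain ⟨ρ', hρ', C, hC, h⟩ := hch x (hKΩ hx)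
      exact ⟨ball x ρ', mem_nhdsWithin_of_mem_nhds (ball_mem_nhds _ hρ'), C, hC, h⟩
end

set_option linter.unusedSimpArgs false
noncomputable section

/-! ### Part 5 : cones, scaling -/

theorem mem_sphCone_iff {N : ℕ} {S : Set (Euc N)} (hS : S ⊆ sphere (0 : Euc N) 1) {x : Euc N} :
    x ∈ sphCone S ↔ x ≠ 0 ∧ ‖x‖⁻¹ • x ∈ S := by
  constructor
  · rintro ⟨t, ht, σ, hσ, rfl⟩
    have h1 : ‖σ‖ = 1 := by simpa using hS hσ
    have h2 : σ ≠ 0 := by rintro rfl; simp at h1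
    refine ⟨smul_ne_zero ht.ne' h2, ?_⟩
    rw [norm_smul, h1, mul_one, Real.norm_of_nonneg ht.le, smul_smul, inv_mul_cancel₀ ht.ne', one_smul]
    exact hσ
  · rintro ⟨h0, h⟩
    have : 0 < ‖x‖ := norm_pos_iff.mpr h0
    exact ⟨‖x‖, this, _, h, by rw [smul_smul, mul_inv_cancel₀ this.ne', one_smul]⟩

theorem smul_mem_sphCone {N : ℕ} {S : Set (Euc N)} {x : Euc N} {t : ℝ} (ht : 0 < t)
    (hx : x ∈ sphCone S) : t • x ∈ sphCone S := by
  obtain ⟨q, hq, σ, hσ, rfl⟩ := hx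
  exact ⟨t * q, by positivity, σ, hσ, by rw [smul_smul]⟩

theorem smul_mem_sphCone_iff {N : ℕ} {S : Set (Euc N)} {x : Euc N} {t : ℝ} (ht : 0 < t) :
    t • x ∈ sphCone S ↔ x ∈ sphCone S := by
  refine ⟨fun h => ?_, smul_mem_sphCone ht⟩
  have := smul_mem_sphCone (inv_pos.mpr ht) h
  rwa [smul_smul, inv_mul_cancel₀ ht.ne', one_smul] at this

theorem isOpen_sphCone {N : ℕ} {S : Set (Euc N)} (hS : IsSphereDomain N S) :
    IsOpen (sphCone S) := by
  obtain ⟨-, hsub, ⟨U, hU, hSU⟩, -⟩ := hS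
  have h1 : sphCone S = {x | x ≠ 0} ∩ (fun x : Euc N => ‖x‖⁻¹ • x) ⁻¹' U := by
    ext x
    rw [mem_sphCone_iff hsub]
    constructor
    · rintro ⟨h0, h⟩
      rw [hSU] at h
      exact ⟨h0, h.1⟩
    · rintro ⟨h0, h⟩
      refine ⟨h0, ?_⟩
      rw [hSU]
      refine ⟨h, ?_⟩
      have : ‖x‖ ≠ 0 := norm_ne_zero_iff.mpr h0
      simp [norm_smul, this]
  rw [h1]
  have hc : ContinuousOn (fun x : Euc N => ‖x‖⁻¹ • x) {x | x ≠ 0} := by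
    refine ContinuousOn.fun_smul ?_ continuousOn_id
    exact continuous_norm.continuousOn.inv₀ (fun x hx => norm_ne_zero_iff.mpr hx)
  exact hc.isOpen_inter_preimage isOpen_ne hU

theorem isOpen_coneLike {N : ℕ} {S : Set (Euc N)} (hS : IsSphereDomain N S) (R : ℝ) :
    IsOpen (coneLike S R) := (isOpen_sphCone hS).inter isOpen_ball

/-- annular cones -/
def annC {N : ℕ} (S : Set (Euc N)) (a b : ℝ) : Set (Euc N) := {x | x ∈ sphCone S ∧ a < ‖x‖ ∧ ‖x‖ < b}

def annK {N : ℕ} (K : Set (Euc N)) (a b : ℝ) : Set (Euc N) := {x | x ∈ sphCone K ∧ a ≤ ‖x‖ ∧ ‖x‖ ≤ b}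

theorem isOpen_annC {N : ℕ} {S : Set (Euc N)} (hS : IsSphereDomain N S) (a b : ℝ) :
    IsOpen (annC S a b) :=
  (isOpen_sphCone hS).inter
    ((isOpen_lt continuous_const continuous_norm).inter (isOpen_lt continuous_norm continuous_const))

theorem annK_eq_image {N : ℕ} {K : Set (Euc N)} (hK : K ⊆ sphere (0 : Euc N) 1) {a b : ℝ}
    (ha : 0 < a) : annK K a b = (fun p : ℝ × Euc N => p.1 • p.2) '' (Set.Icc a b ×ˢ K) := by
  ext x
  constructor
  · rintro ⟨⟨t, ht, σ, hσ, rfl⟩, h1, h2⟩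
    have h3 : ‖σ‖ = 1 := by simpa using hK hσ
    rw [norm_smul, h3, mul_one, Real.norm_of_nonneg ht.le] at h1 h2
    exact ⟨(t, σ), ⟨⟨h1, h2⟩, hσ⟩, rfl⟩
  · rintro ⟨⟨t, σ⟩, ⟨⟨h1, h2⟩, hσ⟩, rfl⟩
    have h3 : ‖σ‖ = 1 := by simpa using hK hσ
    have ht : 0 < t := lt_of_lt_of_le ha h1
    refine ⟨⟨t, ht, σ, hσ, rfl⟩, ?_⟩
    simp only [norm_smul, h3, mul_one, Real.norm_of_nonneg ht.le]
    exact ⟨h1, h2⟩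

theorem isCompact_annK {N : ℕ} {K : Set (Euc N)} (hK : K ⊆ sphere (0 : Euc N) 1) (hKc : IsCompact K)
    {a b : ℝ} (ha : 0 < a) : IsCompact (annK K a b) := by
  rw [annK_eq_image hK ha]
  exact (isCompact_Icc.prod hKc).image (by fun_prop)

theorem annC_eq_image {N : ℕ} {S : Set (Euc N)} (hS : S ⊆ sphere (0 : Euc N) 1) {a b : ℝ}
    (ha : 0 ≤ a) : annC S a b = (fun p : ℝ × Euc N => p.1 • p.2) '' (Set.Ioo a b ×ˢ S) := by
  ext x
  constructor
  · rintro ⟨⟨t, ht, σ, hσ, rfl⟩, h1, h2⟩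
    have h3 : ‖σ‖ = 1 := by simpa using hS hσ
    rw [norm_smul, h3, mul_one, Real.norm_of_nonneg ht.le] at h1 h2
    exact ⟨(t, σ), ⟨⟨h1, h2⟩, hσ⟩, rfl⟩
  · rintro ⟨⟨t, σ⟩, ⟨⟨h1, h2⟩, hσ⟩, rfl⟩
    have h3 : ‖σ‖ = 1 := by simpa using hS hσ
    have ht : 0 < t := lt_of_le_of_lt ha h1
    refine ⟨⟨t, ht, σ, hσ, rfl⟩, ?_⟩
    simp only [norm_smul, h3, mul_one, Real.norm_of_nonneg ht.le]
    exact ⟨h1, h2⟩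

theorem isPreconnected_annC {N : ℕ} {S : Set (Euc N)} (hS : IsSphereDomain N S) {a b : ℝ}
    (ha : 0 ≤ a) : IsPreconnected (annC S a b) := by
  rw [annC_eq_image hS.2.1 ha]
  exact (isPreconnected_Ioo.prod hS.2.2.2.isPreconnected).image _ (by fun_prop)

theorem coneLike_eq_annC {N : ℕ} {S : Set (Euc N)} (hS : S ⊆ sphere (0 : Euc N) 1) (r : ℝ) :
    coneLike S r = annC S 0 r := by
  ext x
  constructor
  · rintro ⟨h1, h2⟩
    exact ⟨h1, norm_pos_iff.mpr ((mem_sphCone_iff hS).mp h1).1, by simpa using h2⟩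
  · rintro ⟨h1, h2, h3⟩
    exact ⟨h1, by simpa using h3⟩

theorem sphCone_mono {N : ℕ} {K S : Set (Euc N)} (h : K ⊆ S) : sphCone K ⊆ sphCone S := by
  rintro x ⟨t, ht, σ, hσ, rfl⟩
  exact ⟨t, ht, σ, h hσ, rfl⟩

theorem lap_comp_smul {N : ℕ} {f : Euc N → ℝ} (hf : ContDiff ℝ (⊤ : ℕ∞) f) (c : ℝ) (x : Euc N) :
    lap (fun y => f (c • y)) x = c ^ 2 * lap f (c • x) := by
  unfold lap
  rw [iteratedFDeriv_comp_const_smul c (hf.of_le two_le_infty)]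
  simp [Finset.mul_sum]

theorem ae_comp_smul {N : ℕ} {P : Euc N → Prop} (h : ∀ᵐ x, P x) {R : ℝ} (hR : R ≠ 0) :
    ∀ᵐ x : Euc N, P (R • x) := by
  have h0 : volume {x | ¬ P x} = 0 := h
  have := Measure.addHaar_preimage_smul (volume : Measure (Euc N)) hR {x | ¬ P x}
  rw [h0, mul_zero] at this
  exact this

theorem SH_mono {N : ℕ} {Ω Ω' : Set (Euc N)} (h : Ω' ⊆ Ω) {u : Euc N → ℝ} (hu : SH Ω u) : SH Ω' u := by
  refine ⟨hu.1.mono_set h, ?_, ?_⟩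
  · filter_upwards [hu.2.1] with x hx hx' using hx (h hx')
  · intro φ hφ
    exact hu.2.2 φ ⟨hφ.1, hφ.2.1, hφ.2.2.trans h⟩

theorem SH_scale {N : ℕ} {Ω Ω' : Set (Euc N)} (hO' : IsOpen Ω') {u : Euc N → ℝ} {R : ℝ} (hR : 0 < R)
    (hΩ : ∀ x ∈ Ω', R • x ∈ Ω) (hu : SH Ω u) : SH Ω' (fun x => u (R • x)) := by
  refine ⟨?_, ?_, ?_⟩
  · rw [locallyIntegrableOn_iff hO'.isLocallyClosed]
    intro K hK hKc
    have hc : IsCompact ((fun x : Euc N => R • x) '' K) := hKc.image (by fun_prop)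
    have h1 : IntegrableOn u ((fun x : Euc N => R • x) '' K) := by
      apply hu.1.integrableOn_compact_subset _ hc
      rintro _ ⟨x, hx, rfl⟩
      exact hΩ x (hK hx)
    rw [← integrable_indicator_iff hc.measurableSet] at h1
    rw [← integrable_indicator_iff hKc.measurableSet]
    have h2 := h1.comp_smul hR.ne'
    have h3 : K.indicator (fun x => u (R • x)) =
        fun x => ((fun x : Euc N => R • x) '' K).indicator u (R • x) := ?_
    · rw [h3]; exact h2
    ext x
    by_cases hx : x ∈ K
    · rw [Set.indicator_of_mem hx, Set.indicator_of_mem (Set.mem_image_of_mem (fun x : Euc N => R • x) hx)]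
    · rw [Set.indicator_of_notMem hx, Set.indicator_of_notMem]
      rintro ⟨y, hy, hyx⟩
      have : y = x := smul_right_injective _ hR.ne' hyx
      exact hx (this ▸ hy)
  · filter_upwards [ae_comp_smul hu.2.1 hR.ne'] with x hx hx'
    exact hx (hΩ x hx')
  · intro φ hφ hφ0
    have htest : IsTestFun Ω (fun x => φ (R⁻¹ • x)) := by
      refine ⟨hφ.1.comp (by fun_prop : ContDiff ℝ _ (fun x : Euc N => R⁻¹ • x)), hφ.2.1.comp_smul (inv_ne_zero hR.ne'), ?_⟩
      have : tsupport (fun x => φ (R⁻¹ • x)) ⊆ (fun x => R⁻¹ • x) ⁻¹' tsupport φ := by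
        apply closure_minimal _ ((isClosed_tsupport φ).preimage (by fun_prop))
        intro x hx
        exact subset_tsupport _ hx
      intro x hx
      have h2 := hΩ _ (hφ.2.2 (this hx))
      rwa [smul_smul, mul_inv_cancel₀ hR.ne', one_smul] at h2
    have h1 := hu.2.2 _ htest (fun x => hφ0 _)
    simp_rw [lap_comp_smul hφ.1] at h1
    have h2 := Measure.integral_comp_smul (volume : Measure (Euc N))
      (fun x => u x * (R⁻¹ ^ 2 * lap φ (R⁻¹ • x))) R
    have h3 : ∫ x, u (R • x) * lap φ x = R ^ 2 * ∫ x, u (R • x) * (R⁻¹ ^ 2 * lap φ (R⁻¹ • R • x)) := by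
      rw [← integral_const_mul]
      congr 1; ext x
      rw [smul_smul, inv_mul_cancel₀ hR.ne', one_smul]
      field_simp
    rw [h3, h2]
    apply mul_nonpos_of_nonneg_of_nonpos (by positivity)
    exact smul_nonpos_of_nonneg_of_nonpos (abs_nonneg _) h1

/-- scale invariant Harnack in a cone -/
theorem harnack_cone {N : ℕ} (hN : 3 ≤ N) {S : Set (Euc N)} (hS : IsSphereDomain N S)
    {K0 K1 : Set (Euc N)} (h0 : IsCompact K0) (h0S : K0 ⊆ S) (h1 : IsCompact K1) (h1S : K1 ⊆ S) :
    ∃ c > 0, ∀ R > 0, ∀ u : Euc N → ℝ, SH (coneLike S (2 * R)) u →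
      ∀ᵐ x, x ∈ annK K1 (R/2) R → c * (R ^ N)⁻¹ * ∫ z in annK K0 R (3/2*R), u z ≤ u x := by
  have hK1 : annK K1 (1/2) 1 ⊆ annC S (1/4) 2 := fun x hx =>
    ⟨sphCone_mono h1S hx.1, by linarith [hx.2.1], by linarith [hx.2.2]⟩
  have hK0 : annK K0 1 (3/2) ⊆ annC S (1/4) 2 := fun x hx =>
    ⟨sphCone_mono h0S hx.1, by linarith [hx.2.1], by linarith [hx.2.2]⟩
  have hKc0 := isCompact_annK (h0S.trans hS.2.1) h0 (a := 1) (b := 3/2) one_pos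
  obtain ⟨C, hC, hH⟩ := harnack hN (isOpen_annC hS (1/4) 2) (isPreconnected_annC hS (by norm_num))
    (isCompact_annK (h1S.trans hS.2.1) h1 (a := 1/2) (b := 1) (by norm_num)) hK1 hKc0 hK0
  have hCp : 0 < C.toReal + 1 := by positivity
  refine ⟨(C.toReal + 1)⁻¹, by positivity, ?_⟩
  intro R hR u hu
  have hΩ : ∀ x ∈ annC S (1/4) 2, R • x ∈ coneLike S (2 * R) := by
    intro x hx
    refine ⟨smul_mem_sphCone hR hx.1, ?_⟩
    simp only [mem_ball, dist_zero_right, norm_smul, Real.norm_of_nonneg hR.le]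
    nlinarith [hx.2.2]
  have hSH := SH_scale (isOpen_annC hS (1/4) 2) hR hΩ hu
  have h2 := ae_comp_smul (hH _ hSH) (inv_ne_zero hR.ne')
  filter_upwards [h2, hu.2.1] with x hx hxu hxK
  have hmem : R⁻¹ • x ∈ annK K1 (1/2) 1 := by
    refine ⟨smul_mem_sphCone (inv_pos.mpr hR) hxK.1, ?_⟩
    rw [norm_smul, norm_inv, Real.norm_of_nonneg hR.le, inv_mul_eq_div, le_div_iff₀ hR, div_le_iff₀ hR]
    constructor <;> linarith [hxK.2.1, hxK.2.2]
  have h3 := hx hmem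
  have hux : 0 ≤ u x := hxu ⟨sphCone_mono h1S hxK.1, by
    simp only [mem_ball, dist_zero_right]; linarith [hxK.2.2]⟩
  have hRx : R • R⁻¹ • x = x := by rw [smul_smul, mul_inv_cancel₀ hR.ne', one_smul]
  simp only [hRx] at h3
  have hint := hSH.1.integrableOn_compact_subset hK0 hKc0
  rw [← ofReal_integral_eq_lintegral_ofReal hint] at h3
  · have h4 : ∫ z in annK K0 1 (3/2), u (R • z) ≤ C.toReal * u x := by
      rw [← ENNReal.ofReal_toReal hC, ← ENNReal.ofReal_mul (by positivity)] at h3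
      exact (ENNReal.ofReal_le_ofReal_iff (by positivity)).mp h3
    have h5 : ∫ z in annK K0 1 (3/2), u (R • z) = (R ^ N)⁻¹ * ∫ z in annK K0 R (3/2*R), u z := by
      have hm1 : MeasurableSet (annK K0 1 (3/2)) := hKc0.measurableSet
      have hm2 : MeasurableSet (annK K0 R (3/2*R)) :=
        (isCompact_annK (h0S.trans hS.2.1) h0 hR).measurableSet
      rw [← integral_indicator hm1, ← integral_indicator hm2]
      have := Measure.integral_comp_smul (volume : Measure (Euc N)) ((annK K0 R (3/2*R)).indicator u) R
      simp only [finrank_euclideanSpace, Fintype.card_fin, smul_eq_mul,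
        abs_of_pos (inv_pos.mpr (pow_pos hR N))] at this
      rw [← this]
      congr 1; ext z
      have hiff : R • z ∈ annK K0 R (3/2*R) ↔ z ∈ annK K0 1 (3/2) := by
        simp only [annK, Set.mem_ofPred_eq, smul_mem_sphCone_iff hR, norm_smul,
          Real.norm_of_nonneg hR.le]
        rw [mul_comm (3/2) R, mul_le_mul_iff_right₀ hR]
        refine and_congr Iff.rfl (and_congr ?_ Iff.rfl)
        constructor <;> intro h <;> nlinarith
      by_cases hz : z ∈ annK K0 1 (3/2)
      · rw [Set.indicator_of_mem hz, Set.indicator_of_mem (hiff.mpr hz)]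
      · rw [Set.indicator_of_notMem hz, Set.indicator_of_notMem (fun h => hz (hiff.mp h))]
    rw [mul_assoc, ← h5, inv_mul_eq_div, div_le_iff₀ hCp]
    nlinarith
  · filter_upwards [ae_restrict_mem hKc0.measurableSet, ae_restrict_of_ae hSH.2.1] with z hz hz2
    exact hz2 (hK0 hz)
end

set_option linter.unusedSimpArgs false
noncomputable section

/-! ### Part 6 : polar coordinates, homogeneous functions -/

/-- the surface measure -/
def sph (N : ℕ) : Measure (sphere (0 : Euc N) 1) := (volume : Measure (Euc N)).toSphere

instance (N : ℕ) : IsFiniteMeasure (sph N) := by unfold sph; infer_instance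
instance (N : ℕ) : (sph N).IsOpenPosMeasure := by unfold sph; infer_instance

/-- radial measure -/
def radM (N : ℕ) : Measure (Set.Ioi (0:ℝ)) := Measure.volumeIoiPow (Module.finrank ℝ (Euc N) - 1)

instance (N : ℕ) : SigmaFinite (radM N) := by unfold radM; infer_instance

theorem polar {N : ℕ} (hN : 3 ≤ N) (F : Euc N → ℝ) :
    ∫ x, F x = ∫ p : sphere (0 : Euc N) 1 × Set.Ioi (0:ℝ), F ((p.2 : ℝ) • (p.1 : Euc N))
      ∂((sph N).prod (radM N)) := by
  have : Nonempty (Fin N) := ⟨⟨0, by omega⟩⟩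
  have h1 := (volume : Measure (Euc N)).measurePreserving_homeomorphUnitSphereProd
  have h2 := h1.integral_comp (Homeomorph.measurableEmbedding _)
    (fun p : sphere (0 : Euc N) 1 × Set.Ioi (0:ℝ) => F ((p.2 : ℝ) • (p.1 : Euc N)))
  unfold sph radM
  rw [← h2]
  have h3 : ∫ x, F x = ∫ x in ({0}ᶜ : Set (Euc N)), F x := by
    rw [restrict_compl_singleton]
  rw [h3, ← integral_subtype_comap (measurableSet_singleton _).compl]
  congr 1
  ext x
  congr 1
  have hx : ‖(x : Euc N)‖ ≠ 0 := norm_ne_zero_iff.mpr x.2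
  simp [smul_smul, mul_inv_cancel₀ hx]

/-- spherical mean -/
def sm {N : ℕ} (Z : Euc N → ℝ) : ℝ := ∫ σ, Z (σ : Euc N) ∂(sph N)

def Jr (N : ℕ) (c : ℝ → ℝ) : ℝ := ∫ s : Set.Ioi (0:ℝ), c ((s:ℝ) ^ 2) ∂(radM N)

theorem norm_sphere {N : ℕ} (σ : sphere (0 : Euc N) 1) : ‖(σ : Euc N)‖ = 1 := by
  simpa using σ.2

theorem hom_polar {N : ℕ} (hN : 3 ≤ N) (c : ℝ → ℝ) {Z : Euc N → ℝ}
    (hZ : ∀ s : ℝ, 0 < s → ∀ x, Z (s • x) = Z x) :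
    ∫ x, c (‖x‖ ^ 2) * Z x = Jr N c * sm Z := by
  rw [polar hN, mul_comm]
  unfold Jr sm
  rw [← integral_prod_mul]
  congr 1
  ext p
  have h : ‖(p.2 : ℝ) • (p.1 : Euc N)‖ = p.2 := by
    rw [norm_smul, norm_sphere, mul_one, Real.norm_of_nonneg p.2.2.le]
  rw [h, hZ _ p.2.2, mul_comm]

/-- slicing: nonnegative slices give a nonnegative integral -/
theorem polar_nonneg {N : ℕ} (hN : 3 ≤ N) (F : Euc N → ℝ)
    (h : ∀ s : ℝ, 0 < s → 0 ≤ sm (fun x => F (s • x))) : 0 ≤ ∫ x, F x := by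
  rw [polar hN]
  by_cases hi : Integrable (fun p : sphere (0 : Euc N) 1 × Set.Ioi (0:ℝ) =>
      F ((p.2 : ℝ) • (p.1 : Euc N))) ((sph N).prod (radM N))
  · rw [integral_prod_symm _ hi]
    exact integral_nonneg (fun s => h s s.2)
  · rw [integral_undef hi]

/-- 0-homogeneous test functions -/
def HomTest {N : ℕ} (S : Set (Euc N)) (Φ : Euc N → ℝ) : Prop :=
  (∀ s : ℝ, 0 < s → ∀ x, Φ (s • x) = Φ x) ∧ (∀ x, x ≠ 0 → ContDiffAt ℝ (⊤ : ℕ∞) Φ x) ∧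
    ∃ K, IsCompact K ∧ K ⊆ S ∧ ∀ x, Φ x ≠ 0 → x ∈ sphCone K

theorem HomTest.zero {N : ℕ} {S : Set (Euc N)} (hS : S ⊆ sphere (0 : Euc N) 1) {Φ : Euc N → ℝ}
    (h : HomTest S Φ) : Φ 0 = 0 := by
  obtain ⟨K, hK, hKS, h0⟩ := h.2.2
  by_contra hne
  exact ((mem_sphCone_iff (hKS.trans hS)).mp (h0 0 hne)).1 rfl

theorem HomTest.norm {N : ℕ} {S : Set (Euc N)} {Φ : Euc N → ℝ}
    (h : HomTest S Φ) {x : Euc N} (hx : x ≠ 0) : Φ x = Φ (‖x‖⁻¹ • x) :=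
  (h.1 _ (inv_pos.mpr (norm_pos_iff.mpr hx)) x).symm

theorem HomTest.grad_orth {N : ℕ} {S : Set (Euc N)} {Φ : Euc N → ℝ}
    (h : HomTest S Φ) {x : Euc N} (hx : x ≠ 0) : ⟪x, gradient Φ x⟫ = 0 := by
  have hd : DifferentiableAt ℝ Φ x := (h.2.1 x hx).differentiableAt infty_ne_zero
  have h1 : HasDerivAt (fun s : ℝ => s • x) x 1 := by
    simpa using (hasDerivAt_id (1:ℝ)).smul_const x
  have h2 : HasDerivAt (fun s : ℝ => Φ (s • x)) (fderiv ℝ Φ x x) 1 := by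
    have hd' : HasFDerivAt Φ (fderiv ℝ Φ x) ((1:ℝ) • x) := by rw [one_smul]; exact hd.hasFDerivAt
    exact hd'.comp_hasDerivAt (1:ℝ) h1
  have h3 : HasDerivAt (fun s : ℝ => Φ (s • x)) 0 1 := by
    refine (hasDerivAt_const (1:ℝ) (Φ x)).congr_of_eventuallyEq ?_
    filter_upwards [lt_mem_nhds (one_pos : (0:ℝ) < 1)] with s hs using h.1 s hs x
  rw [real_inner_comm, inner_gradient_left]
  exact h2.unique h3

theorem HomTest.grad_hom {N : ℕ} {S : Set (Euc N)} {Φ : Euc N → ℝ}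
    (h : HomTest S Φ) {x : Euc N} (hx : x ≠ 0) {s : ℝ} (hs : 0 < s) :
    gradient Φ (s • x) = s⁻¹ • gradient Φ x := by
  have hsx : s • x ≠ 0 := smul_ne_zero hs.ne' hx
  have hd : HasGradientAt Φ (gradient Φ (s • x)) (s • x) :=
    ((h.2.1 _ hsx).differentiableAt infty_ne_zero).hasGradientAt
  rw [hasGradientAt_iff_hasFDerivAt] at hd
  have h1 : HasFDerivAt (fun y : Euc N => s • y) (s • ContinuousLinearMap.id ℝ (Euc N)) x :=
    (hasFDerivAt_id x).const_smul s
  have h2 := hd.comp x h1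
  have h3 : HasGradientAt Φ (s • gradient Φ (s • x)) x := by
    rw [hasGradientAt_iff_hasFDerivAt]
    have h4 : (Φ ∘ fun y => s • y) = Φ := by ext y; exact h.1 s hs y
    rw [h4] at h2
    refine h2.congr_fderiv ?_
    ext v
    simp
  rw [h3.gradient, smul_smul, inv_mul_cancel₀ hs.ne', one_smul]

/-- squared angular gradient, 0-homogeneous -/
def qg {N : ℕ} (Φ : Euc N → ℝ) (x : Euc N) : ℝ := ‖x‖ ^ 2 * ‖gradient Φ x‖ ^ 2

theorem HomTest.qg_hom {N : ℕ} {S : Set (Euc N)} {Φ : Euc N → ℝ}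
    (h : HomTest S Φ) : ∀ s : ℝ, 0 < s → ∀ x, qg Φ (s • x) = qg Φ x := by
  intro s hs x
  by_cases hx : x = 0
  · simp [hx]
  · unfold qg
    rw [h.grad_hom hx hs, norm_smul, norm_smul, norm_inv, Real.norm_of_nonneg hs.le]
    field_simp

theorem HomTest.continuous_sphere {N : ℕ} {S : Set (Euc N)} {Φ : Euc N → ℝ}
    (h : HomTest S Φ) : Continuous (fun σ : sphere (0 : Euc N) 1 => Φ σ) := by
  rw [continuous_iff_continuousAt]
  intro σ
  have hσ : (σ : Euc N) ≠ 0 := by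
    intro h0; have := norm_sphere σ; rw [h0] at this; simp at this
  exact (h.2.1 _ hσ).continuousAt.comp continuous_subtype_val.continuousAt

theorem HomTest.continuousAt_grad {N : ℕ} {S : Set (Euc N)} {Φ : Euc N → ℝ}
    (h : HomTest S Φ) {x : Euc N} (hx : x ≠ 0) : ContinuousAt (gradient Φ) x := by
  unfold gradient
  have : ContinuousAt (fderiv ℝ Φ) x := (h.2.1 x hx).continuousAt_fderiv infty_ne_zero
  exact (LinearIsometryEquiv.continuous _).continuousAt.comp this

theorem HomTest.continuous_qg_sphere {N : ℕ} {S : Set (Euc N)} {Φ : Euc N → ℝ}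
    (h : HomTest S Φ) : Continuous (fun σ : sphere (0 : Euc N) 1 => qg Φ σ) := by
  rw [continuous_iff_continuousAt]
  intro σ
  have hσ : (σ : Euc N) ≠ 0 := by
    intro h0; have := norm_sphere σ; rw [h0] at this; simp at this
  have : ContinuousAt (qg Φ) (σ : Euc N) := by
    unfold qg
    exact ((continuous_norm.pow 2).continuousAt).mul ((h.continuousAt_grad hσ).norm.pow 2)
  exact this.comp continuous_subtype_val.continuousAt

theorem integrable_sphere {N : ℕ} {Z : sphere (0 : Euc N) 1 → ℝ} (hZ : Continuous Z) :
    Integrable Z (sph N) := by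
  have : CompactSpace (sphere (0 : Euc N) 1) := isCompact_iff_compactSpace.mp (isCompact_sphere _ _)
  exact hZ.integrable_of_hasCompactSupport (HasCompactSupport.of_compactSpace _)

/-- radial cutoff times homogeneous test function is a test function -/
theorem HomTest.cut {N : ℕ} {S : Set (Euc N)} (hS : S ⊆ sphere (0 : Euc N) 1) {Φ : Euc N → ℝ}
    (h : HomTest S Φ) {c : ℝ → ℝ} (hc : ContDiff ℝ (⊤ : ℕ∞) c) {a b : ℝ} (ha : 0 < a)
    (hca : ∀ t, c t ≠ 0 → a ^ 2 ≤ t ∧ t ≤ b ^ 2) (hb : 0 < b) {K : Set (Euc N)} (hK : IsCompact K)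
    (hKS : K ⊆ S) (hK0 : ∀ x, Φ x ≠ 0 → x ∈ sphCone K) :
    ContDiff ℝ (⊤ : ℕ∞) (fun x => c (‖x‖ ^ 2) * Φ x) ∧
      tsupport (fun x => c (‖x‖ ^ 2) * Φ x) ⊆ annK K a b := by
  constructor
  · rw [contDiff_iff_contDiffAt]
    intro x
    by_cases hx : x = 0
    · have : (fun x => c (‖x‖ ^ 2) * Φ x) =ᶠ[𝓝 x] fun _ => 0 := by
        rw [hx]
        filter_upwards [ball_mem_nhds (0 : Euc N) ha] with y hy
        rw [mem_ball_zero_iff] at hy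
        have : c (‖y‖ ^ 2) = 0 := by
          by_contra hne
          have := (hca _ hne).1
          have h2 : ‖y‖ ^ 2 < a ^ 2 := by gcongr
          linarith
        rw [this, zero_mul]
      exact contDiffAt_const.congr_of_eventuallyEq this
    · exact ((hc.comp (contDiff_norm_sq ℝ)).contDiffAt).mul (h.2.1 x hx)
  · apply closure_minimal _ (isCompact_annK (hKS.trans hS) hK ha).isClosed
    intro x hx
    have h1 : c (‖x‖ ^ 2) ≠ 0 := left_ne_zero_of_mul hx
    have h2 : Φ x ≠ 0 := right_ne_zero_of_mul hx
    refine ⟨hK0 x h2, ?_, ?_⟩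
    · exact (pow_le_pow_iff_left₀ ha.le (norm_nonneg _) two_ne_zero).mp (hca _ h1).1
    · exact (pow_le_pow_iff_left₀ (norm_nonneg _) hb.le two_ne_zero).mp (hca _ h1).2

theorem annK_subset_cone {N : ℕ} {S K : Set (Euc N)} (hKS : K ⊆ S) (a b : ℝ) : annK K a b ⊆ sphCone S :=
  fun _ hx => sphCone_mono hKS hx.1

end

set_option linter.unusedSimpArgs false
noncomputable section

/-! ### Part 7 : slices and the first eigenvalue -/

theorem hasFDerivAt_unit {N : ℕ} {x : Euc N} (hx : ‖x‖ = 1) :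
    HasFDerivAt (fun y : Euc N => ‖y‖⁻¹ • y)
      (ContinuousLinearMap.id ℝ (Euc N) - (innerSL ℝ x).smulRight x) x := by
  have h0 : x ≠ 0 := by rintro rfl; simp at hx
  have h1 : HasFDerivAt (fun y : Euc N => ‖y‖ ^ 2) (2 • (innerSL ℝ x)) x :=
    (hasStrictFDerivAt_norm_sq x).hasFDerivAt
  have h2 : HasDerivAt (fun t : ℝ => (√t)⁻¹) (-(1/2)) (‖x‖ ^ 2) := by
    have hs : HasDerivAt Real.sqrt (1 / (2 * √(‖x‖^2))) (‖x‖^2) :=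
      Real.hasDerivAt_sqrt (by rw [hx]; norm_num)
    have := hs.inv (by rw [hx]; norm_num)
    refine this.congr_deriv ?_
    rw [hx]; norm_num
  have h3 := h2.comp_hasFDerivAt x h1
  have h4 : ((fun t : ℝ => (√t)⁻¹) ∘ fun y : Euc N => ‖y‖ ^ 2) = fun y => ‖y‖⁻¹ := by
    ext y; simp [Real.sqrt_sq]
  rw [h4] at h3
  refine (h3.fun_smul (hasFDerivAt_id x)).congr_fderiv ?_
  ext1 v
  simp [hx, sub_eq_add_neg, smul_smul]

/-- unit projection is smooth off zero -/
theorem contDiffAt_unit {N : ℕ} {x : Euc N} (hx : x ≠ 0) :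
    ContDiffAt ℝ (⊤ : ℕ∞) (fun y : Euc N => ‖y‖⁻¹ • y) x := by
  have h1 : ContDiffAt ℝ (⊤ : ℕ∞) (fun y : Euc N => ‖y‖⁻¹) x :=
    (contDiffAt_norm ℝ hx).inv (norm_ne_zero_iff.mpr hx)
  exact h1.fun_smul contDiffAt_id

theorem unit_smul {N : ℕ} (x : Euc N) {s : ℝ} (hs : 0 < s) :
    ‖s • x‖⁻¹ • (s • x) = ‖x‖⁻¹ • x := by
  rw [norm_smul, Real.norm_of_nonneg hs.le, smul_smul, mul_inv, mul_assoc, mul_comm, mul_assoc,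
    mul_inv_cancel₀ hs.ne', mul_one]

def slice {N : ℕ} (ζ : Euc N → ℝ) (s : ℝ) (x : Euc N) : ℝ := ζ (s • (‖x‖⁻¹ • x))

theorem zero_notMem_cone {N : ℕ} {S : Set (Euc N)} (hS : S ⊆ sphere (0 : Euc N) 1) :
    (0 : Euc N) ∉ sphCone S := fun h => ((mem_sphCone_iff hS).mp h).1 rfl

theorem slice_homTest {N : ℕ} {S : Set (Euc N)} (hS : S ⊆ sphere (0 : Euc N) 1) {ζ : Euc N → ℝ}
    (hζ : IsTestFun (sphCone S) ζ) {s : ℝ} (hs : 0 < s) : HomTest S (slice ζ s) := by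
  refine ⟨?_, ?_, ?_⟩
  · intro q hq x
    unfold slice
    rw [unit_smul x hq]
  · intro x hx
    unfold slice
    exact hζ.1.contDiffAt.comp x ((contDiffAt_unit hx).const_smul s)
  · refine ⟨(fun x : Euc N => ‖x‖⁻¹ • x) '' tsupport ζ, ?_, ?_, ?_⟩
    · apply hζ.2.1.isCompact.image_of_continuousOn
      intro x hx
      have : x ≠ 0 := ((mem_sphCone_iff hS).mp (hζ.2.2 hx)).1
      exact (contDiffAt_unit this).continuousAt.continuousWithinAt
    · rintro _ ⟨x, hx, rfl⟩
      exact ((mem_sphCone_iff hS).mp (hζ.2.2 hx)).2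
    · intro x hx
      have hx1 : s • (‖x‖⁻¹ • x) ∈ tsupport ζ := subset_tsupport _ hx
      have hx0 : x ≠ 0 := by
        rintro rfl
        rw [smul_zero, smul_zero] at hx1
        exact zero_notMem_cone hS (hζ.2.2 hx1)
      have hn : 0 < ‖x‖ := norm_pos_iff.mpr hx0
      refine ⟨‖x‖, hn, ‖x‖⁻¹ • x, ⟨_, hx1, ?_⟩, ?_⟩
      · dsimp only
        rw [unit_smul _ hs, unit_smul _ (inv_pos.mpr hn)]
      · rw [smul_smul, mul_inv_cancel₀ hn.ne', one_smul]

theorem slice_grad {N : ℕ} {ζ : Euc N → ℝ} (hζ : Differentiable ℝ ζ) {s : ℝ} {σ : Euc N}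
    (hσ : ‖σ‖ = 1) :
    gradient (slice ζ s) σ =
      s • (gradient ζ (s • σ) - ⟪σ, gradient ζ (s • σ)⟫ • σ) := by
  apply HasGradientAt.gradient
  rw [hasGradientAt_iff_hasFDerivAt]
  have h1 : HasFDerivAt ζ (fderiv ℝ ζ (s • σ)) (s • (‖σ‖⁻¹ • σ)) := by
    rw [hσ, inv_one, one_smul]; exact (hζ _).hasFDerivAt
  have h2 := h1.comp σ ((hasFDerivAt_unit hσ).const_smul s)
  refine h2.congr_fderiv ?_
  ext v
  simp only [ContinuousLinearMap.comp_apply, smul_apply,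
    sub_apply, ContinuousLinearMap.smulRight_apply, innerSL_apply_apply,
    ContinuousLinearMap.id_apply, map_smul, map_sub, InnerProductSpace.toDual_apply_apply]
  rw [inner_gradient_left]
  have : ⟪σ, gradient ζ (s • σ)⟫ = fderiv ℝ ζ (s • σ) σ := by
    rw [real_inner_comm, inner_gradient_left]
  rw [this]
  simp only [smul_eq_mul]
  ring

/-- tangential part of the Dirichlet form -/
def TT {N : ℕ} (f k : Euc N → ℝ) (x : Euc N) : ℝ :=
  ⟪gradient f x, gradient k x⟫ - ⟪x, gradient f x⟫ * ⟪x, gradient k x⟫ / ‖x‖ ^ 2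

theorem slice_qg {N : ℕ} {ζ : Euc N → ℝ} (hζ : Differentiable ℝ ζ) {s : ℝ} (hs : 0 < s) {σ : Euc N}
    (hσ : ‖σ‖ = 1) : qg (slice ζ s) σ = s ^ 2 * TT ζ ζ (s • σ) := by
  unfold qg TT
  rw [slice_grad hζ hσ, hσ, norm_smul, mul_pow, norm_sub_sq_real, norm_smul, hσ]
  rw [norm_smul, hσ, real_inner_self_eq_norm_sq, real_inner_smul_left, real_inner_smul_right,
    real_inner_comm σ]
  simp only [Real.norm_eq_abs, sq_abs, mul_one, one_pow]
  field_simp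
  ring

/-- admissible potentials -/
def IsPot {N : ℕ} (V : Euc N → ℝ) (Vm : ℝ) : Prop :=
  (∀ s : ℝ, 0 < s → ∀ x, V (s • x) = V x) ∧ Measurable V ∧ ∀ x, 0 ≤ V x ∧ V x ≤ Vm

/-- spherical energy -/
def Es {N : ℕ} (V : Euc N → ℝ) (Φ : Euc N → ℝ) : ℝ := sm (qg Φ) - sm (fun x => V x * Φ x ^ 2)

def lam1 {N : ℕ} (S : Set (Euc N)) (V : Euc N → ℝ) : ℝ :=
  sInf {t | ∃ Φ, HomTest S Φ ∧ 0 < sm (fun x => Φ x ^ 2) ∧ t = Es V Φ / sm (fun x => Φ x ^ 2)}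

theorem integrable_VPhi {N : ℕ} {S : Set (Euc N)} {V : Euc N → ℝ} {Vm : ℝ} (hV : IsPot V Vm)
    {Φ : Euc N → ℝ} (hΦ : HomTest S Φ) :
    Integrable (fun σ : sphere (0 : Euc N) 1 => V σ * Φ σ ^ 2) (sph N) := by
  refine Integrable.bdd_mul (c := Vm) (integrable_sphere (hΦ.continuous_sphere.pow 2)) ?_ ?_
  · exact (hV.2.1.comp measurable_subtype_coe).aestronglyMeasurable
  · refine Eventually.of_forall fun σ => ?_
    rw [Real.norm_of_nonneg (hV.2.2 _).1]
    exact (hV.2.2 _).2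

theorem sm_VPhi_le {N : ℕ} {S : Set (Euc N)} {V : Euc N → ℝ} {Vm : ℝ} (hV : IsPot V Vm)
    {Φ : Euc N → ℝ} (hΦ : HomTest S Φ) :
    sm (fun x => V x * Φ x ^ 2) ≤ Vm * sm (fun x => Φ x ^ 2) := by
  unfold sm
  rw [← integral_const_mul]
  apply integral_mono (integrable_VPhi hV hΦ) ((integrable_sphere (hΦ.continuous_sphere.pow 2)).const_mul _)
  intro σ
  exact mul_le_mul_of_nonneg_right (hV.2.2 _).2 (sq_nonneg _)

theorem sm_qg_nonneg {N : ℕ} (Φ : Euc N → ℝ) : 0 ≤ sm (qg Φ) :=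
  integral_nonneg fun σ => by unfold qg; positivity

theorem sm_sq_nonneg {N : ℕ} (Φ : Euc N → ℝ) : 0 ≤ sm (fun x => Φ x ^ 2) :=
  integral_nonneg fun σ => by positivity

theorem lam1_bdd {N : ℕ} {S : Set (Euc N)} {V : Euc N → ℝ} {Vm : ℝ} (hV : IsPot V Vm) :
    BddBelow {t | ∃ Φ, HomTest S Φ ∧ 0 < sm (fun x => Φ x ^ 2) ∧
      t = Es V Φ / sm (fun x => Φ x ^ 2)} := by
  refine ⟨-Vm, ?_⟩
  rintro t ⟨Φ, hΦ, hpos, rfl⟩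
  rw [le_div_iff₀ hpos]
  have := sm_VPhi_le hV hΦ
  have := sm_qg_nonneg Φ
  unfold Es
  linarith

theorem lam1_le {N : ℕ} {S : Set (Euc N)} {V : Euc N → ℝ} {Vm : ℝ} (hV : IsPot V Vm)
    {Φ : Euc N → ℝ} (hΦ : HomTest S Φ) : lam1 S V * sm (fun x => Φ x ^ 2) ≤ Es V Φ := by
  rcases (sm_sq_nonneg Φ).eq_or_lt with h0 | hpos
  · rw [← h0, mul_zero]
    have h1 := sm_VPhi_le hV hΦ
    rw [← h0, mul_zero] at h1
    have := sm_qg_nonneg Φ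
    unfold Es
    linarith
  · rw [← le_div_iff₀ hpos]
    exact csInf_le (lam1_bdd hV) ⟨Φ, hΦ, hpos, rfl⟩

theorem exists_test {N : ℕ} {S : Set (Euc N)} (hS : IsSphereDomain N S) :
    ∃ ζ : Euc N → ℝ, IsTestFun (sphCone S) ζ ∧ ∃ σ ∈ S, ζ σ = 1 := by
  obtain ⟨σ, hσ⟩ := hS.1
  have h1 : σ ∈ sphCone S := ⟨1, one_pos, σ, hσ, by simp⟩
  obtain ⟨f, hf1, hf2, hf3, -, hf5⟩ :=
    exists_contDiff_tsupport_subset (n := (⊤ : ℕ∞)) ((isOpen_sphCone hS).mem_nhds h1)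
  exact ⟨f, ⟨hf3, hf2, hf1⟩, σ, hσ, hf5⟩

theorem lam1_nonempty {N : ℕ} {S : Set (Euc N)} (hS : IsSphereDomain N S) (V : Euc N → ℝ) :
    {t | ∃ Φ, HomTest S Φ ∧ 0 < sm (fun x => Φ x ^ 2) ∧
      t = Es V Φ / sm (fun x => Φ x ^ 2)}.Nonempty := by
  obtain ⟨ζ, hζ, σ, hσ, h1⟩ := exists_test hS
  have hΦ := slice_homTest hS.2.1 hζ one_pos
  refine ⟨_, slice ζ 1, hΦ, ?_, rfl⟩
  have hn : ‖σ‖ = 1 := by simpa using hS.2.1 hσ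
  unfold sm
  have hc : Continuous (fun σ : sphere (0 : Euc N) 1 => slice ζ 1 σ ^ 2) := hΦ.continuous_sphere.pow 2
  have hcs : CompactSpace (sphere (0 : Euc N) 1) := isCompact_iff_compactSpace.mp (isCompact_sphere _ _)
  refine hc.integral_pos_of_hasCompactSupport_nonneg_nonzero (x := ⟨σ, hS.2.1 hσ⟩)
    (HasCompactSupport.of_compactSpace _) (fun σ => sq_nonneg _) ?_
  simp [slice, hn, h1]

/-- the tangential quadratic form is nonnegative -/
theorem BB_nonneg {N : ℕ} (hN : 3 ≤ N) {S : Set (Euc N)} (hS : IsSphereDomain N S) {V : Euc N → ℝ}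
    {Vm : ℝ} (hV : IsPot V Vm) {ζ : Euc N → ℝ} (hζ : IsTestFun (sphCone S) ζ) :
    0 ≤ ∫ x, (TT ζ ζ x - (V x + lam1 S V) * (ζ x * ζ x) / ‖x‖ ^ 2) := by
  apply polar_nonneg hN
  intro s hs
  have hΦ := slice_homTest hS.2.1 hζ hs
  have hd : Differentiable ℝ ζ := hζ.1.differentiable infty_ne_zero
  have h1 := lam1_le hV hΦ
  have h2 : sm (fun x => TT ζ ζ (s • x) - (V (s • x) + lam1 S V) * (ζ (s • x) * ζ (s • x)) / ‖s • x‖ ^ 2)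
      = (s ^ 2)⁻¹ * (Es V (slice ζ s) - lam1 S V * sm (fun x => slice ζ s x ^ 2)) := by
    have i1 := integrable_sphere hΦ.continuous_qg_sphere
    have i2 := integrable_VPhi hV hΦ
    have i3 : Integrable (fun σ : sphere (0 : Euc N) 1 => lam1 S V * slice ζ s σ ^ 2) (sph N) :=
      (integrable_sphere (hΦ.continuous_sphere.pow 2)).const_mul (lam1 S V)
    unfold Es sm
    have i12 : Integrable (fun σ : sphere (0 : Euc N) 1 => qg (slice ζ s) σ - V σ * slice ζ s σ ^ 2)
      (sph N) := i1.sub i2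
    rw [← integral_const_mul (lam1 S V), ← integral_sub i1 i2, ← integral_sub i12 i3,
      ← integral_const_mul]
    congr 1
    ext σ
    have hn := norm_sphere σ
    dsimp only; rw [slice_qg hd hs hn, hV.1 s hs, norm_smul, hn, Real.norm_of_nonneg hs.le]
    simp only [slice, hn, inv_one, one_smul, mul_one]
    field_simp
    ring
  rw [h2]
  exact mul_nonneg (by positivity) (by linarith)

end

set_option linter.unusedSimpArgs false
noncomputable section

/-! ### Part 8 : bilinear form, Cauchy-Schwarz, Hardy constant -/

theorem integrable_off_zero {N : ℕ} {F : Euc N → ℝ} {K : Set (Euc N)} (hK : IsCompact K)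
    (h0 : (0 : Euc N) ∉ K) (hF : ContinuousOn F {0}ᶜ) (hs : ∀ x, x ∉ K → F x = 0) : Integrable F := by
  have h1 : ContinuousOn F K := hF.mono (fun x hx => by rintro rfl; exact h0 hx)
  have h2 : IntegrableOn F K volume := h1.integrableOn_compact hK
  rwa [integrableOn_iff_integrable_of_support_subset] at h2
  intro x hx
  by_contra hne
  exact hx (hs x hne)

theorem integrable_off_zero_mul {N : ℕ} {V : Euc N → ℝ} {Vm : ℝ} (hV : IsPot V Vm) {F : Euc N → ℝ}
    (hF : Integrable F) : Integrable (fun x => V x * F x) := by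
  refine hF.bdd_mul (c := Vm) hV.2.1.aestronglyMeasurable ?_
  refine Eventually.of_forall fun x => ?_
  rw [Real.norm_of_nonneg (hV.2.2 _).1]
  exact (hV.2.2 _).2

theorem IsTestFun.cd1 {N : ℕ} {Ω : Set (Euc N)} {f : Euc N → ℝ} (hf : IsTestFun Ω f) :
    ContDiff ℝ 1 f := hf.1.of_le one_le_infty

theorem IsTestFun.diff {N : ℕ} {Ω : Set (Euc N)} {f : Euc N → ℝ} (hf : IsTestFun Ω f) :
    Differentiable ℝ f := hf.1.differentiable infty_ne_zero

theorem continuousOn_inv_normsq {N : ℕ} : ContinuousOn (fun x : Euc N => (‖x‖ ^ 2)⁻¹) {0}ᶜ := by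
  apply ContinuousOn.inv₀ (continuous_norm.pow 2).continuousOn
  intro x hx
  exact pow_ne_zero 2 (norm_ne_zero_iff.mpr hx)

theorem integrable_TT {N : ℕ} {S : Set (Euc N)} (hS : S ⊆ sphere (0 : Euc N) 1) {f k : Euc N → ℝ}
    (hf : IsTestFun (sphCone S) f) (hk : IsTestFun (sphCone S) k) : Integrable (TT f k) := by
  have c1 := continuous_gradient hf.cd1
  have c2 := continuous_gradient hk.cd1
  refine integrable_off_zero hf.2.1.isCompact (fun h => zero_notMem_cone hS (hf.2.2 h)) ?_ ?_
  · unfold TT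
    have h1 : Continuous (fun x => ⟪gradient f x, gradient k x⟫) := c1.inner c2
    have h2 : Continuous (fun x => ⟪x, gradient f x⟫ * ⟪x, gradient k x⟫) :=
      (continuous_id.inner c1).mul (continuous_id.inner c2)
    exact h1.continuousOn.sub (h2.continuousOn.mul continuousOn_inv_normsq)
  · intro x hx
    simp [TT, grad_eq_zero_of_notMem_tsupport hx]

theorem integrable_Vfk {N : ℕ} {S : Set (Euc N)} (hS : S ⊆ sphere (0 : Euc N) 1) {f k : Euc N → ℝ}
    (hf : IsTestFun (sphCone S) f) (hk : IsTestFun (sphCone S) k) :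
    Integrable (fun x => f x * k x / ‖x‖ ^ 2) := by
  refine integrable_off_zero hf.2.1.isCompact (fun h => zero_notMem_cone hS (hf.2.2 h)) ?_ ?_
  · exact (hf.1.continuous.mul hk.1.continuous).continuousOn.mul continuousOn_inv_normsq
  · intro x hx
    simp [image_eq_zero_of_notMem_tsupport hx]

def BB {N : ℕ} (V : Euc N → ℝ) (l : ℝ) (f k : Euc N → ℝ) : ℝ :=
  ∫ x, (TT f k x - (V x + l) * (f x * k x) / ‖x‖ ^ 2)

theorem integrable_BB {N : ℕ} {S : Set (Euc N)} (hS : S ⊆ sphere (0 : Euc N) 1) {V : Euc N → ℝ} {Vm : ℝ}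
    (hV : IsPot V Vm) (l : ℝ) {f k : Euc N → ℝ}
    (hf : IsTestFun (sphCone S) f) (hk : IsTestFun (sphCone S) k) :
    Integrable (fun x => TT f k x - (V x + l) * (f x * k x) / ‖x‖ ^ 2) := by
  refine (integrable_TT hS hf hk).sub ?_
  have i := integrable_Vfk hS hf hk
  refine ((integrable_off_zero_mul hV i).add (i.const_mul l)).congr (Eventually.of_forall fun x => ?_)
  simp only [Pi.add_apply]
  ring

theorem IsTestFun.add_smul {N : ℕ} {Ω : Set (Euc N)} {f k : Euc N → ℝ} (hf : IsTestFun Ω f)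
    (hk : IsTestFun Ω k) (t : ℝ) : IsTestFun Ω (fun x => f x + t * k x) := by
  have hsub : tsupport (fun x => f x + t * k x) ⊆ tsupport f ∪ tsupport k := by
    apply closure_minimal _ ((isClosed_tsupport f).union (isClosed_tsupport k))
    intro x hx
    by_contra hne
    simp only [Set.mem_union, not_or] at hne
    apply hx
    simp [image_eq_zero_of_notMem_tsupport hne.1, image_eq_zero_of_notMem_tsupport hne.2]
  refine ⟨hf.1.add (contDiff_const.mul hk.1), ?_, hsub.trans (Set.union_subset hf.2.2 hk.2.2)⟩
  exact (hf.2.1.isCompact.union hk.2.1.isCompact).of_isClosed_subset (isClosed_tsupport _) hsub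

theorem BB_cs {N : ℕ} (hN : 3 ≤ N) {S : Set (Euc N)} (hS : IsSphereDomain N S) {V : Euc N → ℝ}
    {Vm : ℝ} (hV : IsPot V Vm) {f k : Euc N → ℝ} (hf : IsTestFun (sphCone S) f)
    (hk : IsTestFun (sphCone S) k) :
    BB V (lam1 S V) f k ^ 2 ≤ BB V (lam1 S V) f f * BB V (lam1 S V) k k := by
  have key : ∀ t : ℝ, 0 ≤ BB V (lam1 S V) k k * (t * t) + 2 * BB V (lam1 S V) f k * t + BB V (lam1 S V) f f := by
    intro t
    have h1 := BB_nonneg hN hS hV (hf.add_smul hk t)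
    refine h1.trans_eq ?_
    have i1 := integrable_BB hS.2.1 hV (lam1 S V) hk hk
    have i2 := integrable_BB hS.2.1 hV (lam1 S V) hf hk
    have i3 := integrable_BB hS.2.1 hV (lam1 S V) hf hf
    unfold BB
    rw [mul_comm _ (t * t), mul_right_comm 2, ← integral_const_mul (t * t), ← integral_const_mul (2 * t),
      ← integral_add (i1.const_mul _) (i2.const_mul _), ← integral_add _ i3]
    · congr 1
      ext x
      have hg : gradient (fun x => f x + t * k x) x = gradient f x + t • gradient k x :=
        (hg_add (hf.diff x).hasGradientAt (hg_const_mul t (hk.diff x).hasGradientAt)).gradient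
      unfold TT
      rw [hg]
      simp only [inner_add_left, inner_add_right, real_inner_smul_left, real_inner_smul_right]
      rw [real_inner_comm (gradient f x) (gradient k x)]
      ring
    · exact (i1.const_mul _).add (i2.const_mul _)
  have h := discrim_le_zero key
  unfold discrim at h
  nlinarith

theorem integral_norm_grad_split {N : ℕ} {S : Set (Euc N)} (hS : S ⊆ sphere (0 : Euc N) 1)
    {φ : Euc N → ℝ} (hφ : IsTestFun (sphCone S) φ) :
    Integrable (fun x => ⟪x, gradient φ x⟫ ^ 2 / ‖x‖ ^ 2) ∧
    ∫ x, ‖gradient φ x‖ ^ 2 = (∫ x, TT φ φ x) + ∫ x, ⟪x, gradient φ x⟫ ^ 2 / ‖x‖ ^ 2 := by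
  have c1 := continuous_gradient hφ.cd1
  have i1 : Integrable (fun x => ⟪x, gradient φ x⟫ ^ 2 / ‖x‖ ^ 2) := by
    refine integrable_off_zero hφ.2.1.isCompact (fun h => zero_notMem_cone hS (hφ.2.2 h)) ?_ ?_
    · exact ((continuous_id.inner c1).pow 2).continuousOn.mul continuousOn_inv_normsq
    · intro x hx
      simp [grad_eq_zero_of_notMem_tsupport hx]
  refine ⟨i1, ?_⟩
  rw [← integral_add (integrable_TT hS hφ hφ) i1]
  congr 1
  ext x
  unfold TT
  rw [real_inner_self_eq_norm_sq]
  ring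

theorem radial_hardy {N : ℕ} {S : Set (Euc N)} (hS : S ⊆ sphere (0 : Euc N) 1)
    {φ : Euc N → ℝ} (hφ : IsTestFun (sphCone S) φ) :
    ((N:ℝ) - 2) ^ 2 / 4 * ∫ x, φ x * φ x / ‖x‖ ^ 2 ≤ ∫ x, ⟪x, gradient φ x⟫ ^ 2 / ‖x‖ ^ 2 := by
  have c1 := continuous_gradient hφ.cd1
  obtain ⟨i1, -⟩ := integral_norm_grad_split hS hφ
  have i2 := integrable_Vfk hS hφ hφ
  have i3 : Integrable (fun x => φ x * ⟪x, gradient φ x⟫ / ‖x‖ ^ 2) := by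
    refine integrable_off_zero hφ.2.1.isCompact (fun h => zero_notMem_cone hS (hφ.2.2 h)) ?_ ?_
    · exact (hφ.1.continuous.mul (continuous_id.inner c1)).continuousOn.mul continuousOn_inv_normsq
    · intro x hx
      simp [grad_eq_zero_of_notMem_tsupport hx]
  have hz : (0 : Euc N) ∉ tsupport φ := fun h => zero_notMem_cone hS (hφ.2.2 h)
  have hk : ContDiff ℝ 1 (fun x => φ x * φ x * (‖x‖ ^ 2)⁻¹) := by
    rw [contDiff_iff_contDiffAt]
    intro x
    by_cases hx : x = 0
    · have : (fun x => φ x * φ x * (‖x‖ ^ 2)⁻¹) =ᶠ[𝓝 x] fun _ => 0 := by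
        rw [hx]
        filter_upwards [notMem_tsupport_iff_eventuallyEq.mp hz] with y hy
        simp [hy]
      exact contDiffAt_const.congr_of_eventuallyEq this
    · exact (hφ.cd1.contDiffAt.mul hφ.cd1.contDiffAt).mul
        ((contDiff_norm_sq ℝ).contDiffAt.inv (pow_ne_zero 2 (norm_ne_zero_iff.mpr hx)))
  have hkc : HasCompactSupport (fun x => φ x * φ x * (‖x‖ ^ 2)⁻¹) :=
    (hφ.2.1.mul_right (f' := φ)).mul_right (f' := fun x => (‖x‖ ^ 2)⁻¹)
  have hI := integral_inner_grad hk hkc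
  have hpt : ∀ x, ⟪x, gradient (fun x => φ x * φ x * (‖x‖ ^ 2)⁻¹) x⟫ =
      2 * (φ x * ⟪x, gradient φ x⟫ / ‖x‖ ^ 2) - 2 * (φ x * φ x / ‖x‖ ^ 2) := by
    intro x
    by_cases hx : x = 0
    · subst hx; simp
    · have hx2 : ‖x‖ ^ 2 ≠ 0 := pow_ne_zero 2 (norm_ne_zero_iff.mpr hx)
      have g1 := (hφ.diff x).hasGradientAt
      have g2 := hg_mul (hg_mul g1 g1) (hg_radial (hasDerivAt_inv hx2))
      rw [g2.gradient]
      simp only [inner_add_right, real_inner_smul_right, real_inner_self_eq_norm_sq]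
      field_simp
      ring
  simp_rw [hpt] at hI
  rw [integral_sub (i3.const_mul 2) (i2.const_mul 2), integral_const_mul, integral_const_mul] at hI
  have hI' : ∫ x, φ x * φ x * (‖x‖ ^ 2)⁻¹ = ∫ x, φ x * φ x / ‖x‖ ^ 2 := rfl
  rw [hI'] at hI
  have h0 : 0 ≤ ∫ x, (⟪x, gradient φ x⟫ + ((N:ℝ) - 2) / 2 * φ x) ^ 2 / ‖x‖ ^ 2 :=
    integral_nonneg fun x => by positivity
  have h1 : ∫ x, (⟪x, gradient φ x⟫ + ((N:ℝ) - 2) / 2 * φ x) ^ 2 / ‖x‖ ^ 2 =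
      (∫ x, ⟪x, gradient φ x⟫ ^ 2 / ‖x‖ ^ 2) + ((N:ℝ) - 2) * (∫ x, φ x * ⟪x, gradient φ x⟫ / ‖x‖ ^ 2)
        + ((N:ℝ) - 2) ^ 2 / 4 * ∫ x, φ x * φ x / ‖x‖ ^ 2 := by
    rw [← integral_const_mul, ← integral_const_mul, ← integral_add i1 (i3.const_mul _), ← integral_add _ (i2.const_mul _)]
    · congr 1; ext x; ring
    · exact i1.add (i3.const_mul _)
  rw [h1] at h0
  have h2 : ∫ x, φ x * ⟪x, gradient φ x⟫ / ‖x‖ ^ 2 = (2 - (N:ℝ)) / 2 * ∫ x, φ x * φ x / ‖x‖ ^ 2 := by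
    linarith
  rw [h2] at h0
  linarith

theorem mu1_le_hardyConstV {N : ℕ} (hN : 3 ≤ N) {S : Set (Euc N)} (hS : IsSphereDomain N S)
    {V V0 : Euc N → ℝ} {Vm : ℝ} (hV : IsPot V Vm) (hV0 : ∀ x ∈ sphCone S, V0 (‖x‖⁻¹ • x) = V x) :
    lam1 S V + ((N:ℝ) - 2) ^ 2 / 4 ≤ hardyConstV S V0 := by
  unfold hardyConstV
  have hrp : ∀ x : Euc N, ‖x‖ ^ (-2 : ℝ) = (‖x‖ ^ 2)⁻¹ := by
    intro x
    rw [Real.rpow_neg (norm_nonneg _)]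
    norm_cast
  apply le_csInf
  · obtain ⟨ζ, hζ, σ, hσ, h1⟩ := exists_test hS
    exact ⟨_, ζ, hζ, by rintro rfl; simp at h1, rfl⟩
  · rintro t ⟨φ, hφ, hne, rfl⟩
    have hout : ∀ x, x ∉ sphCone S → x ∉ tsupport φ := fun x hx h => hx (hφ.2.2 h)
    have e1 : ∫ x in sphCone S, ‖gradient φ x‖ ^ 2 = ∫ x, ‖gradient φ x‖ ^ 2 := by
      apply setIntegral_eq_integral_of_forall_compl_eq_zero
      intro x hx
      simp [grad_eq_zero_of_notMem_tsupport (hout x hx)]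
    have e2 : ∫ x in sphCone S, V0 (‖x‖⁻¹ • x) * ‖x‖ ^ (-2 : ℝ) * φ x ^ 2 =
        ∫ x, V x * (φ x * φ x / ‖x‖ ^ 2) := by
      rw [← setIntegral_eq_integral_of_forall_compl_eq_zero (s := sphCone S) (f := fun x => V x * (φ x * φ x / ‖x‖ ^ 2))]
      · apply setIntegral_congr_fun (isOpen_sphCone hS).measurableSet
        intro x hx
        dsimp only
        rw [hV0 x hx, hrp]
        ring
      · intro x hx
        simp [image_eq_zero_of_notMem_tsupport (hout x hx)]
    have e3 : ∫ x in sphCone S, ‖x‖ ^ (-2 : ℝ) * φ x ^ 2 = ∫ x, φ x * φ x / ‖x‖ ^ 2 := by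
      rw [← setIntegral_eq_integral_of_forall_compl_eq_zero (s := sphCone S) (f := fun x => φ x * φ x / ‖x‖ ^ 2)]
      · apply setIntegral_congr_fun (isOpen_sphCone hS).measurableSet
        intro x hx
        dsimp only
        rw [hrp]
        ring
      · intro x hx
        simp [image_eq_zero_of_notMem_tsupport (hout x hx)]
    rw [e1, e2, e3]
    have i2 := integrable_Vfk hS.2.1 hφ hφ
    have hpos : 0 < ∫ x, φ x * φ x / ‖x‖ ^ 2 := by
      rw [integral_pos_iff_support_of_nonneg _ i2]
      · have : Function.support (fun x => φ x * φ x / ‖x‖ ^ 2) = Function.support φ := by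
          ext x
          simp only [Function.mem_support]
          constructor
          · intro h h'; apply h; simp [h']
          · intro h
            have hx : x ≠ 0 := by
              rintro rfl
              exact zero_notMem_cone hS.2.1 (hφ.2.2 (subset_tsupport _ h))
            have := norm_ne_zero_iff.mpr hx
            positivity
        rw [this]
        exact hφ.1.continuous.isOpen_support.measure_pos volume (Function.support_nonempty_iff.mpr hne)
      · intro x
        have := mul_self_nonneg (φ x)
        dsimp only [Pi.zero_apply]
        positivity
    rw [le_div_iff₀ hpos]
    have h1 := radial_hardy hS.2.1 hφ
    have h2 := BB_nonneg hN hS hV hφ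
    obtain ⟨-, h3⟩ := integral_norm_grad_split hS.2.1 hφ
    have iV := integrable_off_zero_mul hV i2
    have h4 : ∫ x, (TT φ φ x - (V x + lam1 S V) * (φ x * φ x) / ‖x‖ ^ 2) =
        (∫ x, TT φ φ x) - (∫ x, V x * (φ x * φ x / ‖x‖ ^ 2)) - lam1 S V * ∫ x, φ x * φ x / ‖x‖ ^ 2 := by
      rw [← integral_const_mul, ← integral_sub (integrable_TT hS.2.1 hφ hφ) iV,
        ← integral_sub _ (i2.const_mul _)]
      · congr 1; ext x; ring
      · exact (integrable_TT hS.2.1 hφ hφ).sub iV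
    rw [h4] at h2
    rw [h3]
    linarith

end

set_option linter.unusedSimpArgs false
noncomputable section

/-! ### Part 9 : nonnegative almost minimisers and tightness -/

theorem exists_cutoff {a b : ℝ} (ha : 0 < a) (hab : a < b) :
    ∃ c : ℝ → ℝ, ContDiff ℝ (⊤ : ℕ∞) c ∧ (∀ t, 0 ≤ c t ∧ c t ≤ 1) ∧ (∀ t, a ≤ t → t ≤ b → c t = 1) ∧
      ∀ t, c t ≠ 0 → a / 2 ≤ t ∧ t ≤ b + a / 2 := by
  let B : ContDiffBump ((a + b) / 2) := ⟨(b - a) / 2, b / 2, by linarith, by linarith⟩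
  refine ⟨B, B.contDiff, fun t => ⟨B.nonneg, B.le_one⟩, ?_, ?_⟩
  · intro t h1 h2
    apply B.one_of_mem_closedBall
    rw [mem_closedBall, Real.dist_eq, abs_le]
    constructor <;> simp only [B] <;> linarith
  · intro t ht
    have : t ∈ Function.support B := ht
    rw [B.support_eq, mem_ball, Real.dist_eq, abs_lt] at this
    simp only [B] at this
    constructor <;> linarith [this.1, this.2]

theorem HomTest.comp {N : ℕ} {S : Set (Euc N)} {Φ : Euc N → ℝ} (h : HomTest S Φ) {F : ℝ → ℝ}
    (hF : ContDiff ℝ (⊤ : ℕ∞) F) (h0 : F 0 = 0) : HomTest S (fun x => F (Φ x)) := by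
  refine ⟨fun s hs x => by dsimp only; rw [h.1 s hs], fun x hx => hF.contDiffAt.comp x (h.2.1 x hx), ?_⟩
  obtain ⟨K, hK, hKS, hK0⟩ := h.2.2
  refine ⟨K, hK, hKS, fun x hx => hK0 x ?_⟩
  intro h1
  exact hx (by dsimp only; rw [h1, h0])

theorem HomTest.qg_comp {N : ℕ} {S : Set (Euc N)} {Φ : Euc N → ℝ} (h : HomTest S Φ) {F : ℝ → ℝ}
    {F' : ℝ} {x : Euc N} (hx : x ≠ 0) (hF : HasDerivAt F F' (Φ x)) :
    qg (fun x => F (Φ x)) x = F' ^ 2 * qg Φ x := by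
  unfold qg
  rw [(hg_comp hF ((h.2.1 x hx).differentiableAt infty_ne_zero).hasGradientAt).gradient, norm_smul,
    mul_pow, Real.norm_eq_abs, sq_abs]
  ring

theorem sphere_ne_zero {N : ℕ} (σ : sphere (0 : Euc N) 1) : (σ : Euc N) ≠ 0 := by
  intro h0; have := norm_sphere σ; rw [h0] at this; simp at this

theorem HomTest.scale {N : ℕ} {S : Set (Euc N)} {Φ : Euc N → ℝ} (h : HomTest S Φ) (c : ℝ)
    (V : Euc N → ℝ) :
    HomTest S (fun x => c * Φ x) ∧ sm (fun x => (c * Φ x) ^ 2) = c ^ 2 * sm (fun x => Φ x ^ 2) ∧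
      sm (qg (fun x => c * Φ x)) = c ^ 2 * sm (qg Φ) ∧
      Es V (fun x => c * Φ x) = c ^ 2 * Es V Φ := by
  have e1 : sm (qg (fun x => c * Φ x)) = c ^ 2 * sm (qg Φ) := by
    unfold sm
    rw [← integral_const_mul]
    congr 1; ext σ
    exact h.qg_comp (F := fun t => c * t) (sphere_ne_zero σ)
      (by simpa using (hasDerivAt_id (Φ σ)).const_mul c)
  refine ⟨h.comp (F := fun t => c * t) (by fun_prop) (by simp), ?_, e1, ?_⟩
  · unfold sm
    rw [← integral_const_mul]
    congr 1; ext σ; ring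
  · unfold Es
    rw [e1, mul_sub]
    congr 1
    unfold sm
    rw [← integral_const_mul]
    congr 1; ext σ; ring

theorem almost_min {N : ℕ} {S : Set (Euc N)} (hS : IsSphereDomain N S) {V : Euc N → ℝ} {Vm : ℝ}
    (hV : IsPot V Vm) {ε : ℝ} (hε : 0 < ε) :
    ∃ Φ, HomTest S Φ ∧ (∀ x, 0 ≤ Φ x) ∧ sm (fun x => Φ x ^ 2) = 1 ∧ Es V Φ ≤ lam1 S V + ε := by
  obtain ⟨_, ⟨Φ, hΦ, hD, rfl⟩, hlt⟩ := exists_lt_of_csInf_lt (lam1_nonempty hS V)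
    (show lam1 S V < lam1 S V + ε / 2 by linarith)
  rw [div_lt_iff₀ hD] at hlt
  set D := sm (fun x => Φ x ^ 2) with hDdef
  set k := sm (fun x => |Φ x|) with hk
  have hk0 : 0 ≤ k := integral_nonneg fun σ => abs_nonneg _
  have hVm : 0 ≤ Vm := (hV.2.2 0).1.trans (hV.2.2 0).2
  set L := |lam1 S V| with hL
  have hL0 : 0 ≤ L := abs_nonneg _
  set η := ε * D / (4 * (k + 1) * (Vm + L + ε + 1)) with hη
  have hη0 : 0 < η := by positivity
  have hηk : 2 * η * k * (Vm + L + ε + 1) ≤ ε * D / 2 := by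
    rw [hη]
    have h1 : 2 * (ε * D / (4 * (k + 1) * (Vm + L + ε + 1))) * k * (Vm + L + ε + 1) =
        ε * D / 2 * (k / (k + 1)) := by
      field_simp; ring
    rw [h1]
    have : k / (k + 1) ≤ 1 := by rw [div_le_one (by positivity)]; linarith
    exact mul_le_of_le_one_right (by positivity) this
  -- regularised absolute value
  let F : ℝ → ℝ := fun t => √(t ^ 2 + η ^ 2) - η
  have hF : ContDiff ℝ (⊤ : ℕ∞) F := by
    refine ContDiff.sub (ContDiff.sqrt (by fun_prop) ?_) contDiff_const
    intro t
    positivity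
  have hF0 : F 0 = 0 := by simp [F, Real.sqrt_sq hη0.le]
  have hFn : ∀ t, 0 ≤ F t := by
    intro t
    have : η ≤ √(t ^ 2 + η ^ 2) := Real.le_sqrt_of_sq_le (by nlinarith)
    simp only [F]; linarith
  have hFle : ∀ t, F t ≤ |t| := by
    intro t
    simp only [F]
    rw [sub_le_iff_le_add, Real.sqrt_le_left (by positivity)]
    nlinarith [sq_abs t, abs_nonneg t]
  have hFge : ∀ t, |t| - η ≤ F t := by
    intro t
    simp only [F]
    have : |t| ≤ √(t ^ 2 + η ^ 2) := Real.le_sqrt_of_sq_le (by nlinarith [sq_abs t])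
    linarith
  have hFsq : ∀ t, F t ^ 2 ≤ t ^ 2 := by
    intro t
    rw [← sq_abs t]
    exact pow_le_pow_left₀ (hFn t) (hFle t) 2
  have hFsq' : ∀ t, t ^ 2 - F t ^ 2 ≤ 2 * η * |t| := by
    intro t
    rw [← sq_abs t]
    nlinarith [hFn t, hFle t, hFge t, abs_nonneg t]
  have hFd : ∀ t, ∃ F', HasDerivAt F F' t ∧ F' ^ 2 ≤ 1 := by
    intro t
    have h1 : HasDerivAt (fun t : ℝ => t ^ 2 + η ^ 2) (2 * t) t := by
      simpa using (hasDerivAt_pow 2 t).add_const (η ^ 2)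
    have hpos : 0 < t ^ 2 + η ^ 2 := by positivity
    refine ⟨_, (h1.sqrt hpos.ne').sub_const η, ?_⟩
    rw [div_pow, mul_pow, mul_pow, Real.sq_sqrt hpos.le, div_le_one (by positivity)]
    nlinarith
  set Ψ := fun x => F (Φ x) with hΨ
  have hΨt : HomTest S Ψ := hΦ.comp hF hF0
  have i1 := integrable_sphere hΦ.continuous_qg_sphere
  have i2 := integrable_sphere hΨt.continuous_qg_sphere
  have i3 : Integrable (fun σ : sphere (0 : Euc N) 1 => Φ σ ^ 2) (sph N) :=
    integrable_sphere (hΦ.continuous_sphere.pow 2)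
  have i4 : Integrable (fun σ : sphere (0 : Euc N) 1 => Ψ σ ^ 2) (sph N) :=
    integrable_sphere (hΨt.continuous_sphere.pow 2)
  have i5 : Integrable (fun σ : sphere (0 : Euc N) 1 => |Φ σ|) (sph N) :=
    integrable_sphere hΦ.continuous_sphere.abs
  have i6 := integrable_VPhi hV hΦ
  have i7 := integrable_VPhi hV hΨt
  have q1 : sm (qg Ψ) ≤ sm (qg Φ) := by
    apply integral_mono i2 i1
    intro σ
    obtain ⟨F', h1, h2⟩ := hFd (Φ σ)
    dsimp only
    rw [hΦ.qg_comp (sphere_ne_zero σ) h1]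
    have : 0 ≤ qg Φ σ := by unfold qg; positivity
    exact mul_le_of_le_one_left this h2
  have q2 : D - sm (fun x => Ψ x ^ 2) ≤ 2 * η * k := by
    rw [hDdef, hk]
    unfold sm
    rw [← integral_sub i3 i4, ← integral_const_mul]
    exact integral_mono (i3.sub i4) (i5.const_mul _) fun σ => hFsq' (Φ σ)
  have q2' : sm (fun x => Ψ x ^ 2) ≤ D := integral_mono i4 i3 fun σ => hFsq (Φ σ)
  have q3 : sm (fun x => V x * Φ x ^ 2) - sm (fun x => V x * Ψ x ^ 2) ≤ Vm * (2 * η * k) := by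
    have : sm (fun x => V x * Φ x ^ 2) - sm (fun x => V x * Ψ x ^ 2) ≤
        Vm * (D - sm (fun x => Ψ x ^ 2)) := by
      rw [hDdef]
      unfold sm
      rw [← integral_sub i6 i7, ← integral_sub i3 i4, ← integral_const_mul]
      refine integral_mono (i6.sub i7) ((i3.sub i4).const_mul _) fun σ => ?_
      have h1 := (hV.2.2 σ).2
      have h2 := hFsq (Φ σ)
      simp only [hΨ]
      nlinarith
    exact this.trans (mul_le_mul_of_nonneg_left q2 hVm)
  set D' := sm (fun x => Ψ x ^ 2) with hD'
  have hlD : lam1 S V * (D - D') ≤ L * (2 * η * k) := by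
    calc lam1 S V * (D - D') ≤ L * (D - D') := mul_le_mul_of_nonneg_right (le_abs_self _) (by linarith)
      _ ≤ _ := mul_le_mul_of_nonneg_left q2 hL0
  have hEs : Es V Ψ ≤ (lam1 S V + ε) * D' := by
    unfold Es at hlt ⊢
    nlinarith
  have hηk0 : 0 ≤ η * k := by positivity
  have hD'pos : 0 < D' := by
    have h3 : 2 * η * k * ε ≤ ε * D / 2 := by
      have h4 : 2 * η * k * ε ≤ 2 * η * k * (Vm + L + ε + 1) := by
        apply mul_le_mul_of_nonneg_left _ (by positivity); linarith
      linarith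
    have h5 : 2 * η * k ≤ D / 2 := by
      by_contra hcon
      push Not at hcon
      nlinarith
    linarith
  obtain ⟨s1, s2, -, s4⟩ := hΨt.scale (√D')⁻¹ V
  have hs : ((√D')⁻¹) ^ 2 = D'⁻¹ := by rw [inv_pow, Real.sq_sqrt hD'pos.le]
  refine ⟨_, s1, fun x => mul_nonneg (by positivity) (hFn _), ?_, ?_⟩
  · rw [s2, hs, ← hD', inv_mul_cancel₀ hD'pos.ne']
  · rw [s4, hs, inv_mul_le_iff₀ hD'pos, mul_comm D']
    exact hEs

end

set_option linter.unusedSimpArgs false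
noncomputable section

/-! ### Part 10 : Sobolev and tightness -/

theorem isCompact_ann {N : ℕ} (a b : ℝ) : IsCompact {x : Euc N | a ≤ ‖x‖ ∧ ‖x‖ ≤ b} := by
  apply (isCompact_closedBall (0 : Euc N) b).of_isClosed_subset
  · exact (isClosed_le continuous_const continuous_norm).inter (isClosed_le continuous_norm continuous_const)
  · intro x hx
    simpa using hx.2

theorem integrable_radial_hom {N : ℕ} {c : ℝ → ℝ} (hc : ContinuousOn c (Set.Ioi 0)) {a b : ℝ} (ha : 0 < a) (hb : 0 < b)
    (hca : ∀ t, c t ≠ 0 → a ^ 2 ≤ t ∧ t ≤ b ^ 2) {Z : Euc N → ℝ} (hZ : ContinuousOn Z {0}ᶜ) :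
    Integrable (fun x => c (‖x‖ ^ 2) * Z x) := by
  refine integrable_off_zero (isCompact_ann a b) ?_ ?_ ?_
  · simp [ha]
  · refine ContinuousOn.mul (hc.comp (continuous_norm.pow 2).continuousOn ?_) hZ
    intro x hx
    have := norm_pos_iff.mpr hx
    simp only [Set.mem_Ioi, Pi.pow_apply]
    positivity
  · intro x hx
    by_contra hne
    have h1 := hca _ (left_ne_zero_of_mul hne)
    exact hx ⟨(pow_le_pow_iff_left₀ ha.le (norm_nonneg _) two_ne_zero).mp h1.1,
      (pow_le_pow_iff_left₀ (norm_nonneg _) hb.le two_ne_zero).mp h1.2⟩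

theorem HomTest.continuousOn {N : ℕ} {S : Set (Euc N)} {Φ : Euc N → ℝ} (h : HomTest S Φ) :
    ContinuousOn Φ {0}ᶜ := fun x hx => (h.2.1 x hx).continuousAt.continuousWithinAt

theorem HomTest.continuousOn_qg {N : ℕ} {S : Set (Euc N)} {Φ : Euc N → ℝ} (h : HomTest S Φ) :
    ContinuousOn (qg Φ) {0}ᶜ := by
  intro x hx
  unfold qg
  exact (((continuous_norm.pow 2).continuousAt).mul ((h.continuousAt_grad hx).norm.pow 2)).continuousWithinAt

theorem HomTest.diffAt {N : ℕ} {S : Set (Euc N)} {Φ : Euc N → ℝ} (h : HomTest S Φ) {x : Euc N}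
    (hx : x ≠ 0) : DifferentiableAt ℝ Φ x := (h.2.1 x hx).differentiableAt infty_ne_zero

theorem HomTest.cut_grad {N : ℕ} {S : Set (Euc N)} {Φ : Euc N → ℝ} (h : HomTest S Φ) {c : ℝ → ℝ}
    (hc : Differentiable ℝ c) {x : Euc N} (hx : x ≠ 0) :
    gradient (fun y => c (‖y‖ ^ 2) * Φ y) x =
      c (‖x‖ ^ 2) • gradient Φ x + Φ x • ((2 * deriv c (‖x‖ ^ 2)) • x) :=
  (hg_mul (hg_radial (hc _).hasDerivAt) (h.diffAt hx).hasGradientAt).gradient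

theorem HomTest.cut_grad_norm {N : ℕ} {S : Set (Euc N)} {Φ : Euc N → ℝ} (h : HomTest S Φ) {c : ℝ → ℝ}
    (hc : Differentiable ℝ c) (hc0 : ∀ᶠ t in 𝓝 0, c t = 0) (x : Euc N) :
    ‖gradient (fun y => c (‖y‖ ^ 2) * Φ y) x‖ ^ 2 =
      c (‖x‖ ^ 2) ^ 2 / ‖x‖ ^ 2 * qg Φ x + 4 * deriv c (‖x‖ ^ 2) ^ 2 * ‖x‖ ^ 2 * Φ x ^ 2 := by
  by_cases hx : x = 0
  · have h1 : (fun y => c (‖y‖ ^ 2) * Φ y) =ᶠ[𝓝 x] fun _ => 0 := by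
      rw [hx]
      have h2 : Tendsto (fun y : Euc N => ‖y‖ ^ 2) (𝓝 0) (𝓝 0) := by
        have : Continuous (fun y : Euc N => ‖y‖ ^ 2) := by fun_prop
        simpa using this.tendsto 0
      filter_upwards [h2.eventually hc0] with y hy
      rw [hy, zero_mul]
    rw [h1.gradient_eq, gradient_fun_const]
    simp [hx]
  · rw [h.cut_grad hc hx, norm_add_sq_real]
    have hn : ‖x‖ ≠ 0 := norm_ne_zero_iff.mpr hx
    simp only [real_inner_smul_left, real_inner_smul_right]
    rw [real_inner_comm, h.grad_orth hx]
    simp only [norm_smul, mul_pow, Real.norm_eq_abs, sq_abs]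
    unfold qg
    field_simp
    ring

theorem Jr_nonneg {N : ℕ} {c : ℝ → ℝ} (hc : ∀ t, 0 < t → 0 ≤ c t) : 0 ≤ Jr N c :=
  integral_nonneg fun s => hc _ (pow_pos s.2 2)

theorem Jr_mul_sm_one {N : ℕ} (hN : 3 ≤ N) (c : ℝ → ℝ) :
    ∫ x : Euc N, c (‖x‖ ^ 2) = Jr N c * sm (fun _ : Euc N => 1) := by
  rw [← hom_polar hN c (Z := fun _ => 1) (fun _ _ _ => rfl)]
  simp

theorem sobolev_bound {N : ℕ} (hN : 3 ≤ N) {S : Set (Euc N)} (hS : IsSphereDomain N S) (M : ℝ) :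
    ∃ q : ℝ, 2 < q ∧ ∃ B : ℝ, 0 ≤ B ∧ ∀ Φ, HomTest S Φ → (∀ x, 0 ≤ Φ x) → sm (fun x => Φ x ^ 2) = 1 →
      sm (qg Φ) ≤ M → sm (fun x => Φ x ^ q) ≤ B := by
  have hN' : (3:ℝ) ≤ N := by exact_mod_cast hN
  set q : ℝ := 2 * N / (N - 2) with hq
  have hq2 : 2 < q := by rw [hq, lt_div_iff₀ (by linarith)]; linarith
  have hq0 : 0 < q := by linarith
  refine ⟨q, hq2, ?_⟩
  obtain ⟨c, hcs, hc01, hc1, hc0⟩ := exists_cutoff (a := 1) (b := 4) one_pos (by norm_num)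
  have hcd : Differentiable ℝ c := hcs.differentiable infty_ne_zero
  have hc0e : ∀ᶠ t in 𝓝 0, c t = 0 := by
    filter_upwards [gt_mem_nhds (show (0:ℝ) < 1/2 by norm_num)] with t ht
    by_contra hne
    linarith [(hc0 t hne).1]
  have hca : ∀ t, c t ≠ 0 → ((1:ℝ)/2) ^ 2 ≤ t ∧ t ≤ (3:ℝ) ^ 2 := fun t ht => by
    have := hc0 t ht
    constructor <;> nlinarith
  have hdc : ∀ t, deriv c t ≠ 0 → ((1:ℝ)/2) ^ 2 ≤ t ∧ t ≤ (3:ℝ) ^ 2 := fun t ht => by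
    have h1 : t ∈ tsupport c := by
      by_contra hne
      exact ht (deriv_of_notMem_tsupport hne)
    have h2 : tsupport c ⊆ Set.Icc (((1:ℝ)/2) ^ 2) ((3:ℝ) ^ 2) :=
      closure_minimal (fun t ht => hca t ht) isClosed_Icc
    exact h2 h1
  set Jq := Jr N (fun t => c t ^ q) with hJq
  have hcq : Continuous (fun t => c t ^ q) := hcs.continuous.rpow_const (fun t => Or.inr hq0.le)
  have hJqpos : 0 < Jq := by
    have h1 : 0 < ∫ x : Euc N, c (‖x‖ ^ 2) ^ q := by
      have hcont : Continuous (fun x : Euc N => c (‖x‖ ^ 2) ^ q) := hcq.comp (continuous_norm.pow 2)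
      have : Nonempty (Fin N) := ⟨⟨0, by omega⟩⟩
      obtain ⟨y, hy⟩ := NormedSpace.exists_lt_norm ℝ (Euc N) 1
      obtain ⟨z, hz⟩ : ∃ z : Euc N, ‖z‖ = 1 := by
        obtain ⟨σ, hσ⟩ := hS.1
        exact ⟨σ, by simpa using hS.2.1 hσ⟩
      refine hcont.integral_pos_of_hasCompactSupport_nonneg_nonzero (x := z) ?_ ?_ ?_
      · refine HasCompactSupport.of_support_subset_isCompact (isCompact_ann (1/2) 3) ?_
        intro x hx
        have h2 : c (‖x‖ ^ 2) ≠ 0 := by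
          intro h; apply hx; simp [h, hq0.ne']
        have h3 := hca _ h2
        exact ⟨(pow_le_pow_iff_left₀ (by norm_num) (norm_nonneg _) two_ne_zero).mp h3.1,
          (pow_le_pow_iff_left₀ (norm_nonneg _) (by norm_num) two_ne_zero).mp h3.2⟩
      · intro x
        exact Real.rpow_nonneg (hc01 _).1 _
      · rw [hz, hc1 _ (by norm_num) (by norm_num)]; simp
    rw [Jr_mul_sm_one hN (fun t => c t ^ q)] at h1
    have h2 : 0 ≤ Jr N (fun t => c t ^ q) := Jr_nonneg fun t _ => Real.rpow_nonneg (hc01 t).1 _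
    rcases h2.eq_or_lt with h3 | h3
    · rw [← h3, zero_mul] at h1; exact absurd h1 (lt_irrefl _)
    · exact h3
  set J1 := Jr N (fun t => c t ^ 2 / t) with hJ1
  have hJ1n : 0 ≤ J1 := Jr_nonneg fun t ht => by positivity
  set J2 := Jr N (fun t => 4 * deriv c t ^ 2 * t) with hJ2
  have hJ2n : 0 ≤ J2 := Jr_nonneg fun t ht => by positivity
  set Cs : ℝ := (SNormLESNormFDerivOfEqConst ℝ (volume : Measure (Euc N)) (2:ℝ≥0) : ℝ) with hCs
  have hCs0 : 0 ≤ Cs := NNReal.coe_nonneg _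
  refine ⟨(Cs * (J1 * |M| + J2) ^ (2:ℝ)⁻¹) ^ q / Jq, by positivity, ?_⟩
  intro Φ hΦ hΦ0 hΦ1 hΦM
  obtain ⟨K, hK, hKS, hK0⟩ := hΦ.2.2
  have hcut := hΦ.cut hS.2.1 hcs (a := 1/2) (b := 3) (by norm_num) hca (by norm_num) hK hKS hK0
  set f := fun x => c (‖x‖ ^ 2) * Φ x with hf
  have hfc : HasCompactSupport f :=
    (isCompact_annK (hKS.trans hS.2.1) hK (by norm_num : (0:ℝ) < 1/2)).of_isClosed_subset
      (isClosed_tsupport _) hcut.2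
  have hf1 : ContDiff ℝ 1 f := hcut.1.of_le one_le_infty
  have hfin : Module.finrank ℝ (Euc N) = N := by simp
  obtain ⟨qn, hqn⟩ : ∃ qn : ℝ≥0, (qn : ℝ) = q := ⟨⟨q, hq0.le⟩, rfl⟩
  have hsob := eLpNorm_le_eLpNorm_fderiv_of_eq (volume : Measure (Euc N)) hf1 hfc
    (p := 2) (p' := qn) (by norm_num) (by rw [hfin]; omega) (by
      rw [hfin]
      rw [hqn, hq, inv_div]
      push_cast
      field_simp)
  have m1 : MemLp f (qn : ℝ≥0∞) := hf1.continuous.memLp_of_hasCompactSupport hfc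
  have m2 : MemLp (fderiv ℝ f) ((2:ℝ≥0) : ℝ≥0∞) :=
    (hf1.continuous_fderiv (by norm_num)).memLp_of_hasCompactSupport (hfc.fderiv ℝ)
  rw [m1.eLpNorm_eq_integral_rpow_norm (by
      simp only [ne_eq, ENNReal.coe_eq_zero]; intro h; rw [h] at hqn; exact hq0.ne hqn) ENNReal.coe_ne_top,
    m2.eLpNorm_eq_integral_rpow_norm (by norm_num) ENNReal.coe_ne_top] at hsob
  simp only [ENNReal.coe_toReal] at hsob
  have e1 : ∫ x, ‖f x‖ ^ q = Jq * sm (fun x => Φ x ^ q) := by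
    rw [hJq, ← hom_polar hN _ (Z := fun x => Φ x ^ q) (fun s hs x => by rw [hΦ.1 s hs])]
    congr 1; ext x
    rw [Real.norm_of_nonneg (mul_nonneg (hc01 _).1 (hΦ0 _)), Real.mul_rpow (hc01 _).1 (hΦ0 _)]
  have e2 : ∫ x, ‖fderiv ℝ f x‖ ^ ((2:ℝ≥0):ℝ) = J1 * sm (qg Φ) + J2 := by
    have h1 : ∀ x, ‖fderiv ℝ f x‖ ^ ((2:ℝ≥0):ℝ) = c (‖x‖ ^ 2) ^ 2 / ‖x‖ ^ 2 * qg Φ x +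
        4 * deriv c (‖x‖ ^ 2) ^ 2 * ‖x‖ ^ 2 * Φ x ^ 2 := by
      intro x
      rw [← hΦ.cut_grad_norm hcd hc0e x, norm_grad_eq]
      simp only [NNReal.coe_ofNat, Real.rpow_ofNat]
      rfl
    simp_rw [h1]
    have i1 := integrable_radial_hom (N := N) (c := fun t => c t ^ 2 / t) (a := 1/2) (b := 3) (by
        exact (hcs.continuous.pow 2).continuousOn.div continuousOn_id (fun t ht => ht.ne')) (by norm_num)
        (by norm_num) (fun t ht => hca t (by rintro h; apply ht; simp [h])) hΦ.continuousOn_qg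
    have i2 := integrable_radial_hom (N := N) (c := fun t => 4 * deriv c t ^ 2 * t) (a := 1/2) (b := 3) (by
        have : Continuous (deriv c) := hcs.continuous_deriv one_le_infty
        fun_prop) (by norm_num)
        (by norm_num) (fun t ht => hdc t (by rintro h; apply ht; simp [h])) (Z := fun x => Φ x ^ 2) (hΦ.continuousOn.pow 2)
    have hh := integral_add i1 i2
    rw [hom_polar hN (fun t => c t ^ 2 / t) hΦ.qg_hom,
      hom_polar hN (fun t => 4 * deriv c t ^ 2 * t) (Z := fun x => Φ x ^ 2)
        (fun s hs x => by rw [hΦ.1 s hs]), hΦ1, mul_one] at hh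
    exact hh
  rw [hqn, e1, e2] at hsob
  have hsmq : 0 ≤ sm (fun x => Φ x ^ q) := integral_nonneg fun σ => Real.rpow_nonneg (hΦ0 _) _
  have hqg := sm_qg_nonneg Φ
  rw [← ENNReal.ofReal_coe_nnreal, ← ENNReal.ofReal_mul (NNReal.coe_nonneg _),
    ENNReal.ofReal_le_ofReal_iff (by positivity)] at hsob
  rw [le_div_iff₀ hJqpos, mul_comm]
  have h3 : (Jq * sm (fun x => Φ x ^ q)) ^ q⁻¹ ≤ Cs * (J1 * |M| + J2) ^ (2:ℝ)⁻¹ := by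
    refine hsob.trans ?_
    rw [hCs]
    refine mul_le_mul_of_nonneg_left ?_ (NNReal.coe_nonneg _)
    have : J1 * sm (qg Φ) + J2 ≤ J1 * |M| + J2 := by
      have := mul_le_mul_of_nonneg_left (hΦM.trans (le_abs_self M)) hJ1n
      linarith
    exact Real.rpow_le_rpow (by positivity) this (by norm_num)
  have h4 := Real.rpow_le_rpow (by positivity) h3 hq0.le
  rwa [← Real.rpow_mul (by positivity), inv_mul_cancel₀ hq0.ne', Real.rpow_one] at h4

theorem tight {N : ℕ} (hN : 3 ≤ N) {S : Set (Euc N)} (hS : IsSphereDomain N S) (M : ℝ) {η : ℝ}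
    (hη : 0 < η) :
    ∃ K0, IsCompact K0 ∧ K0 ⊆ S ∧ ∃ Λ : ℝ, 0 < Λ ∧ ∀ Φ, HomTest S Φ → (∀ x, 0 ≤ Φ x) →
      sm (fun x => Φ x ^ 2) = 1 → sm (qg Φ) ≤ M →
      sm ({x | x ∈ sphCone K0 ∧ Φ x ≤ Λ}ᶜ.indicator (fun x => Φ x ^ 2)) ≤ η := by
  obtain ⟨q, hq, B, hB, hbd⟩ := sobolev_bound hN hS M
  have hlim : Tendsto (fun L : ℝ => L ^ (-(q - 2)) * B) atTop (𝓝 0) := by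
    simpa using (tendsto_rpow_neg_atTop (show 0 < q - 2 by linarith)).mul_const B
  obtain ⟨Λ, hΛ1, hΛ⟩ := ((hlim.eventually (gt_mem_nhds (half_pos hη))).and (eventually_gt_atTop 0)).exists
  -- choice of K0
  set S0 : Set (sphere (0 : Euc N) 1) := {σ | (σ : Euc N) ∈ S} with hS0
  have hS0o : IsOpen S0 := by
    obtain ⟨U, hU, hSU⟩ := hS.2.2.1
    have : S0 = Subtype.val ⁻¹' U := by
      ext σ
      simp only [hS0, Set.mem_ofPred_eq, Set.mem_preimage]
      rw [hSU]
      exact ⟨fun h => h.1, fun h => ⟨h, σ.2⟩⟩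
    rw [this]
    exact hU.preimage continuous_subtype_val
  have hε : ENNReal.ofReal (η / 2 / Λ ^ 2) ≠ 0 := by
    rw [ne_eq, ENNReal.ofReal_eq_zero, not_le]; positivity
  obtain ⟨K, hKS, hK, hKm⟩ := hS0o.measurableSet.exists_isCompact_sdiff_lt
    (measure_ne_top (sph N) S0) hε
  refine ⟨Subtype.val '' K, hK.image continuous_subtype_val, ?_, Λ, hΛ, ?_⟩
  · rintro _ ⟨σ, hσ, rfl⟩
    exact hKS hσ
  intro Φ hΦ hΦ0 hΦ1 hΦM
  have hb := hbd Φ hΦ hΦ0 hΦ1 hΦM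
  have hsub : Subtype.val '' K ⊆ sphere (0 : Euc N) 1 := by
    rintro _ ⟨σ, -, rfl⟩; exact σ.2
  have hΦout : ∀ σ : sphere (0 : Euc N) 1, Φ σ ≠ 0 → σ ∈ S0 := by
    intro σ hσ
    obtain ⟨K', -, hK'S, hK'⟩ := hΦ.2.2
    have h1 := sphCone_mono hK'S (hK' _ hσ)
    have h2 := ((mem_sphCone_iff hS.2.1).mp h1).2
    rw [norm_sphere, inv_one, one_smul] at h2
    exact h2
  have i1 : Integrable (fun σ : sphere (0 : Euc N) 1 => Λ ^ (-(q-2)) * Φ σ ^ q) (sph N) :=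
    (integrable_sphere (hΦ.continuous_sphere.rpow_const (fun _ => Or.inr (by linarith)))).const_mul _
  have i2 : Integrable ((S0 \ K).indicator (fun _ => Λ ^ 2)) (sph N) :=
    (integrable_const _).indicator (hS0o.measurableSet.diff hK.measurableSet)
  have hpt : ∀ σ : sphere (0 : Euc N) 1,
      {x | x ∈ sphCone (Subtype.val '' K) ∧ Φ x ≤ Λ}ᶜ.indicator (fun x => Φ x ^ 2) (σ : Euc N) ≤
      Λ ^ (-(q-2)) * Φ σ ^ q + (S0 \ K).indicator (fun _ => Λ ^ 2) σ := by
    intro σ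
    have hn : 0 ≤ (S0 \ K).indicator (fun _ => Λ ^ 2) σ :=
      Set.indicator_nonneg (fun _ _ => by positivity) _
    have hn2 : 0 ≤ Λ ^ (-(q-2)) * Φ σ ^ q :=
      mul_nonneg (Real.rpow_nonneg hΛ.le _) (Real.rpow_nonneg (hΦ0 _) _)
    by_cases h1 : (σ : Euc N) ∈ {x | x ∈ sphCone (Subtype.val '' K) ∧ Φ x ≤ Λ}
    · rw [Set.indicator_of_notMem (by simpa using h1)]
      linarith
    · rw [Set.indicator_of_mem h1]
      by_cases h2 : Φ σ ≤ Λ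
      · by_cases h3 : Φ σ = 0
        · rw [h3] at hn2 ⊢; simp only [ne_eq, OfNat.ofNat_ne_zero, not_false_eq_true, zero_pow]; linarith
        · have h4 : σ ∈ S0 \ K := by
            refine ⟨hΦout σ h3, fun h5 => h1 ⟨?_, h2⟩⟩
            exact ⟨1, one_pos, σ, ⟨σ, h5, rfl⟩, by simp⟩
          rw [Set.indicator_of_mem h4]
          have : Φ σ ^ 2 ≤ Λ ^ 2 := pow_le_pow_left₀ (hΦ0 _) h2 2
          linarith
      · push Not at h2
        have hp : 0 < Φ σ := hΛ.trans h2
        have h5 : Φ σ ^ q = Φ σ ^ (q - 2) * Φ σ ^ 2 := by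
          rw [← Real.rpow_natCast, ← Real.rpow_add hp]; norm_num
        have h6 : Λ ^ (q-2) ≤ Φ σ ^ (q-2) := Real.rpow_le_rpow hΛ.le h2.le (by linarith)
        have h7 : 1 ≤ Λ ^ (-(q-2)) * Φ σ ^ (q-2) := by
          rw [Real.rpow_neg hΛ.le, ← div_eq_inv_mul, one_le_div (Real.rpow_pos_of_pos hΛ _)]
          exact h6
        rw [h5, ← mul_assoc]
        nlinarith [sq_nonneg (Φ σ)]
  have h8 : sm ({x | x ∈ sphCone (Subtype.val '' K) ∧ Φ x ≤ Λ}ᶜ.indicator (fun x => Φ x ^ 2)) ≤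
      ∫ σ : sphere (0 : Euc N) 1, (Λ ^ (-(q-2)) * Φ σ ^ q + (S0 \ K).indicator (fun _ => Λ ^ 2) σ) ∂(sph N) := by
    refine integral_mono_of_nonneg ?_ (i1.add i2) (Eventually.of_forall hpt)
    exact Eventually.of_forall fun σ => Set.indicator_nonneg (fun _ _ => sq_nonneg _) _
  refine h8.trans ?_
  rw [integral_add i1 i2, integral_const_mul, integral_indicator_const _ (hS0o.measurableSet.diff hK.measurableSet)]
  have h9 : (sph N).real (S0 \ K) ≤ η / 2 / Λ ^ 2 :=
    ENNReal.toReal_le_of_le_ofReal (by positivity) hKm.le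
  have h10 : (sph N).real (S0 \ K) • Λ ^ 2 ≤ η / 2 := by
    rw [smul_eq_mul, ← le_div_iff₀ (by positivity)]; exact h9
  have h11 : Λ ^ (-(q-2)) * ∫ σ : sphere (0 : Euc N) 1, Φ σ ^ q ∂(sph N) ≤ Λ ^ (-(q-2)) * B :=
    mul_le_mul_of_nonneg_left hb (Real.rpow_nonneg hΛ.le _)
  linarith

end

set_option linter.unusedSimpArgs false
noncomputable section

def kh {N : ℕ} (p : ℝ → ℝ) (Φ : Euc N → ℝ) (x : Euc N) : ℝ := p (‖x‖ ^ 2) * Φ x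
def ki {N : ℕ} (U : Euc N → ℝ) (p : ℝ → ℝ) (Φ : Euc N → ℝ) (x : Euc N) : ℝ := (U x + kh p Φ x)⁻¹
def kw {N : ℕ} (U : Euc N → ℝ) (p : ℝ → ℝ) (Φ : Euc N → ℝ) (x : Euc N) : ℝ :=
  U x * (kh p Φ x * ki U p Φ x)
def kxi {N : ℕ} (U : Euc N → ℝ) (G p : ℝ → ℝ) (Φ : Euc N → ℝ) (x : Euc N) : ℝ :=
  (kh p Φ x * ki U p Φ x) * (kh p Φ x * ki U p Φ x) * (G (‖x‖ ^ 2) * Φ x)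
def kzt {N : ℕ} (U : Euc N → ℝ) (G p : ℝ → ℝ) (Φ : Euc N → ℝ) (x : Euc N) : ℝ :=
  (G (‖x‖ ^ 2) * U x) * ((kh p Φ x * ki U p Φ x) * (kh p Φ x * ki U p Φ x))
def kk1 {N : ℕ} (U : Euc N → ℝ) (G p : ℝ → ℝ) (Φ : Euc N → ℝ) (x : Euc N) : ℝ :=
  (2 * deriv G (‖x‖ ^ 2) * Φ x) * kw U p Φ x
def kk2 {N : ℕ} (U : Euc N → ℝ) (G p : ℝ → ℝ) (Φ : Euc N → ℝ) (x : Euc N) : ℝ :=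
  (2 * deriv p (‖x‖ ^ 2) * Φ x) *
    ((U x * ki U p Φ x) * (U x * ki U p Φ x) * (G (‖x‖ ^ 2) * Φ x))

structure KCtx {N : ℕ} (S K : Set (Euc N)) (Φ U : Euc N → ℝ) (G p : ℝ → ℝ) (a b A B : ℝ) : Prop where
  hS : IsSphereDomain N S
  hΦ : HomTest S Φ
  Φ0 : ∀ x, 0 ≤ Φ x
  hU : ContDiff ℝ (⊤ : ℕ∞) U
  U0 : ∀ x, 0 < U x
  Gs : ContDiff ℝ (⊤ : ℕ∞) G
  G0 : ∀ t, 0 ≤ G t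
  Ga : ∀ t, G t ≠ 0 → a ^ 2 ≤ t ∧ t ≤ b ^ 2
  a0 : 0 < a
  b0 : 0 < b
  ps : ContDiff ℝ (⊤ : ℕ∞) p
  p0 : ∀ t, 0 ≤ p t
  pA : ∀ t, p t ≠ 0 → A ^ 2 ≤ t ∧ t ≤ B ^ 2
  A0 : 0 < A
  B0 : 0 < B
  hK : IsCompact K
  hKS : K ⊆ S
  hK0 : ∀ x, Φ x ≠ 0 → x ∈ sphCone K

theorem deriv_supp {G : ℝ → ℝ} {a b : ℝ} (h : ∀ t, G t ≠ 0 → a ≤ t ∧ t ≤ b) :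
    ∀ t, deriv G t ≠ 0 → a ≤ t ∧ t ≤ b := by
  intro t ht
  have h1 : t ∈ tsupport G := support_deriv_subset ht
  exact closure_minimal (t := Set.Icc a b) (fun s hs => h s hs) isClosed_Icc h1

theorem smooth_deriv {G : ℝ → ℝ} (h : ContDiff ℝ (⊤ : ℕ∞) G) : ContDiff ℝ (⊤ : ℕ∞) (deriv G) :=
  ((contDiff_infty_iff_deriv (𝕜 := ℝ)).mp h).2

namespace KCtx
variable {N : ℕ} {S K : Set (Euc N)} {Φ U : Euc N → ℝ} {G p : ℝ → ℝ} {a b A B : ℝ}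

theorem h0 (c : KCtx S K Φ U G p a b A B) (x : Euc N) : 0 ≤ kh p Φ x := mul_nonneg (c.p0 _) (c.Φ0 _)

theorem s0 (c : KCtx S K Φ U G p a b A B) (x : Euc N) : 0 < U x + kh p Φ x :=
  add_pos_of_pos_of_nonneg (c.U0 x) (c.h0 x)

theorem i0 (c : KCtx S K Φ U G p a b A B) (x : Euc N) : 0 < ki U p Φ x := inv_pos.mpr (c.s0 x)

theorem h_smooth (c : KCtx S K Φ U G p a b A B) : ContDiff ℝ (⊤ : ℕ∞) (kh p Φ) :=
  (c.hΦ.cut c.hS.2.1 c.ps c.A0 c.pA c.B0 c.hK c.hKS c.hK0).1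

theorem i_smooth (c : KCtx S K Φ U G p a b A B) : ContDiff ℝ (⊤ : ℕ∞) (ki U p Φ) :=
  (c.hU.add c.h_smooth).inv (fun x => (c.s0 x).ne')

theorem w_smooth (c : KCtx S K Φ U G p a b A B) : ContDiff ℝ (⊤ : ℕ∞) (kw U p Φ) :=
  c.hU.mul (c.h_smooth.mul c.i_smooth)

theorem gΦ (c : KCtx S K Φ U G p a b A B) : ContDiff ℝ (⊤ : ℕ∞) (fun x => G (‖x‖ ^ 2) * Φ x) ∧
    tsupport (fun x => G (‖x‖ ^ 2) * Φ x) ⊆ annK K a b :=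
  c.hΦ.cut c.hS.2.1 c.Gs c.a0 c.Ga c.b0 c.hK c.hKS c.hK0

theorem cK (c : KCtx S K Φ U G p a b A B) (ha : 0 < a) : IsCompact (annK K a b) :=
  isCompact_annK (c.hKS.trans c.hS.2.1) c.hK ha

theorem xi_smooth (c : KCtx S K Φ U G p a b A B) : ContDiff ℝ (⊤ : ℕ∞) (kxi U G p Φ) :=
  ((c.h_smooth.mul c.i_smooth).mul (c.h_smooth.mul c.i_smooth)).mul c.gΦ.1

theorem xi_supp (c : KCtx S K Φ U G p a b A B) : tsupport (kxi U G p Φ) ⊆ annK K a b :=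
  (closure_mono (fun _ hx => right_ne_zero_of_mul hx)).trans c.gΦ.2

theorem zt_eq (x : Euc N) : kzt U G p Φ x =
    (G (‖x‖ ^ 2) * Φ x) * (U x * (p (‖x‖ ^ 2) * ki U p Φ x * (kh p Φ x * ki U p Φ x))) := by
  unfold kzt kh; ring

theorem r_smooth (c : ContDiff ℝ (⊤ : ℕ∞) G) : ContDiff ℝ (⊤ : ℕ∞) (fun x : Euc N => G (‖x‖ ^ 2)) :=
  c.comp (contDiff_norm_sq ℝ)

theorem zt_smooth (c : KCtx S K Φ U G p a b A B) : ContDiff ℝ (⊤ : ℕ∞) (kzt U G p Φ) :=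
  ((r_smooth c.Gs).mul c.hU).mul ((c.h_smooth.mul c.i_smooth).mul (c.h_smooth.mul c.i_smooth))

theorem zt_supp (c : KCtx S K Φ U G p a b A B) : tsupport (kzt U G p Φ) ⊆ annK K a b := by
  refine (closure_mono (fun x hx => ?_)).trans c.gΦ.2
  rw [Function.mem_support, zt_eq] at hx
  exact left_ne_zero_of_mul hx

theorem dG (c : KCtx S K Φ U G p a b A B) : ∀ t, 2 * deriv G t ≠ 0 → a ^ 2 ≤ t ∧ t ≤ b ^ 2 :=
  fun t ht => deriv_supp c.Ga t (right_ne_zero_of_mul ht)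

theorem dp (c : KCtx S K Φ U G p a b A B) : ∀ t, 2 * deriv p t ≠ 0 → A ^ 2 ≤ t ∧ t ≤ B ^ 2 :=
  fun t ht => deriv_supp c.pA t (right_ne_zero_of_mul ht)

theorem dgΦ (c : KCtx S K Φ U G p a b A B) :
    ContDiff ℝ (⊤ : ℕ∞) (fun x => 2 * deriv G (‖x‖ ^ 2) * Φ x) ∧
    tsupport (fun x => 2 * deriv G (‖x‖ ^ 2) * Φ x) ⊆ annK K a b :=
  c.hΦ.cut c.hS.2.1 (c := fun t => 2 * deriv G t) (contDiff_const.mul (smooth_deriv c.Gs)) c.a0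
    c.dG c.b0 c.hK c.hKS c.hK0

theorem dpΦ (c : KCtx S K Φ U G p a b A B) :
    ContDiff ℝ (⊤ : ℕ∞) (fun x => 2 * deriv p (‖x‖ ^ 2) * Φ x) :=
  (c.hΦ.cut c.hS.2.1 (c := fun t => 2 * deriv p t) (contDiff_const.mul (smooth_deriv c.ps)) c.A0
    c.dp c.B0 c.hK c.hKS c.hK0).1

theorem k1_smooth (c : KCtx S K Φ U G p a b A B) : ContDiff ℝ (⊤ : ℕ∞) (kk1 U G p Φ) :=
  c.dgΦ.1.mul c.w_smooth

theorem k1_supp (c : KCtx S K Φ U G p a b A B) : tsupport (kk1 U G p Φ) ⊆ annK K a b :=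
  (closure_mono (fun _ hx => left_ne_zero_of_mul hx)).trans c.dgΦ.2

theorem k2_smooth (c : KCtx S K Φ U G p a b A B) : ContDiff ℝ (⊤ : ℕ∞) (kk2 U G p Φ) :=
  c.dpΦ.mul (((c.hU.mul c.i_smooth).mul (c.hU.mul c.i_smooth)).mul c.gΦ.1)

theorem k2_supp (c : KCtx S K Φ U G p a b A B) : tsupport (kk2 U G p Φ) ⊆ annK K a b :=
  (closure_mono (fun _ hx => right_ne_zero_of_mul (right_ne_zero_of_mul hx))).trans c.gΦ.2

theorem hc (c : KCtx S K Φ U G p a b A B) {f : Euc N → ℝ} (hf : tsupport f ⊆ annK K a b) :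
    HasCompactSupport f := (c.cK c.a0).of_isClosed_subset (isClosed_tsupport _) hf

theorem zt_test (c : KCtx S K Φ U G p a b A B) : IsTestFun (sphCone S) (kzt U G p Φ) :=
  ⟨c.zt_smooth, c.hc c.zt_supp, c.zt_supp.trans (annK_subset_cone c.hKS a b)⟩

theorem xi_test (c : KCtx S K Φ U G p a b A B) : IsTestFun (sphCone S) (kxi U G p Φ) :=
  ⟨c.xi_smooth, c.hc c.xi_supp, c.xi_supp.trans (annK_subset_cone c.hKS a b)⟩

end KCtx

theorem key_alg {E : Type*} [NormedAddCommGroup E] [InnerProductSpace ℝ E] {gU gΦ x : E}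
    {U i φ g g' g'' p p' p'' t : ℝ} (hU : 0 < U) (hφ : 0 ≤ φ) (hg : 0 ≤ g) (hp : 0 ≤ p)
    (hi : i = (U + p * φ)⁻¹) (hx : ⟪x, gΦ⟫ = 0) (ht : ⟪x, x⟫ = t)
    {H I w xi zt k1 k2 : E}
    (hH : H = p • gΦ + φ • ((2 * p') • x))
    (hI : I = (-(i ^ 2)) • (gU + H))
    (hw : w = U • ((p * φ) • I + i • H) + (p * φ * i) • gU)
    (hxi : xi = ((p * φ * i) * (p * φ * i)) • (g • gΦ + φ • ((2 * g') • x)) +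
      (g * φ) • ((p * φ * i) • ((p * φ) • I + i • H) + (p * φ * i) • ((p * φ) • I + i • H)))
    (hzt : zt = (g * U) • ((p * φ * i) • ((p * φ) • I + i • H) + (p * φ * i) • ((p * φ) • I + i • H))
      + ((p * φ * i) * (p * φ * i)) • (g • gU + U • ((2 * g') • x)))
    (hk1 : k1 = (2 * g' * φ) • w + (U * (p * φ * i)) • ((2 * g') • gΦ + φ • ((2 * (2 * g'')) • x)))
    (hk2 : k2 = (2 * p' * φ) • (((U * i) * (U * i)) • (g • gΦ + φ • ((2 * g') • x)) +
      (g * φ) • ((U * i) • (U • I + i • gU) + (U * i) • (U • I + i • gU))) +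
      ((U * i) * (U * i) * (g * φ)) • ((2 * p') • gΦ + φ • ((2 * (2 * p'')) • x))) :
    0 ≤ ⟪gΦ, zt⟫ - ⟪gU, xi⟫ + (⟪x, k1⟫ - 4 * t * g'' * φ * (U * (p * φ * i)))
      - (⟪x, k2⟫ - 4 * t * p'' * φ * ((U * i) * (U * i) * (g * φ))) := by
  have hs : 0 < U + p * φ := by positivity
  have hsq : 0 ≤ 2 * (g * φ) * i ^ 3 * ‖(p * φ) • gU - U • H‖ ^ 2 := by
    have : 0 < i := by rw [hi]; positivity
    positivity
  rw [← real_inner_self_eq_norm_sq] at hsq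
  have hx' : ⟪gΦ, x⟫ = 0 := by rw [real_inner_comm]; exact hx
  have hc1 : ⟪gΦ, gU⟫ = ⟪gU, gΦ⟫ := real_inner_comm _ _
  have hc2 : ⟪x, gU⟫ = ⟪gU, x⟫ := real_inner_comm _ _
  refine hsq.trans_eq ?_
  rw [hk1, hk2, hzt, hxi, hw, hI, hH]
  simp only [inner_add_left, inner_add_right, inner_smul_left, inner_smul_right, inner_sub_left,
    inner_sub_right, hx, hx', hc1, hc2, ht, RCLike.conj_to_real, conj_trivial]
  rw [hi]
  field_simp
  ring

end

set_option linter.unusedSimpArgs false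
noncomputable section

namespace KCtx
variable {N : ℕ} {S K : Set (Euc N)} {Φ U : Euc N → ℝ} {G p : ℝ → ℝ} {a b A B : ℝ}

theorem hgi (c : KCtx S K Φ U G p a b A B) {x : Euc N} (hx : x ≠ 0) :
    HasGradientAt (ki U p Φ) ((-(ki U p Φ x ^ 2)) • (gradient U x + gradient (kh p Φ) x)) x := by
  have h1 : HasGradientAt (fun y => U y + kh p Φ y) (gradient U x + gradient (kh p Φ) x) x :=
    hg_add (c.hU.differentiable infty_ne_zero x).hasGradientAt
      (c.h_smooth.differentiable infty_ne_zero x).hasGradientAt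
  have h2 := hg_comp (hasDerivAt_inv (c.s0 x).ne') h1
  have e : -(ki U p Φ x ^ 2) = -((U x + kh p Φ x) ^ 2)⁻¹ := by
    unfold ki; rw [inv_pow]
  rw [e]
  exact h2

theorem pointwise (c : KCtx S K Φ U G p a b A B) {x : Euc N} (hx : x ≠ 0) :
    0 ≤ ⟪gradient Φ x, gradient (kzt U G p Φ) x⟫ - ⟪gradient U x, gradient (kxi U G p Φ) x⟫
      + (⟪x, gradient (kk1 U G p Φ) x⟫ - 4 * ‖x‖ ^ 2 * deriv (deriv G) (‖x‖ ^ 2) * Φ x * kw U p Φ x)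
      - (⟪x, gradient (kk2 U G p Φ) x⟫ - 4 * ‖x‖ ^ 2 * deriv (deriv p) (‖x‖ ^ 2) * Φ x *
        ((U x * ki U p Φ x) * (U x * ki U p Φ x) * (G (‖x‖ ^ 2) * Φ x))) := by
  have hgU : HasGradientAt U (gradient U x) x := (c.hU.differentiable infty_ne_zero x).hasGradientAt
  have hgΦ : HasGradientAt Φ (gradient Φ x) x := (c.hΦ.diffAt hx).hasGradientAt
  have dd : ∀ {F : ℝ → ℝ}, ContDiff ℝ (⊤ : ℕ∞) F → ∀ t, HasDerivAt F (deriv F t) t :=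
    fun hF t => (hF.differentiable infty_ne_zero t).hasDerivAt
  have hgG := hg_radial (N := N) (x := x) (dd c.Gs (‖x‖ ^ 2))
  have hgp := hg_radial (N := N) (x := x) (dd c.ps (‖x‖ ^ 2))
  have hgG' := hg_const_mul 2 (hg_radial (N := N) (x := x) (dd (smooth_deriv c.Gs) (‖x‖ ^ 2)))
  have hgp' := hg_const_mul 2 (hg_radial (N := N) (x := x) (dd (smooth_deriv c.ps) (‖x‖ ^ 2)))
  rw [smul_smul] at hgG' hgp'
  have hh0 : HasGradientAt (kh p Φ) _ x := hg_mul hgp hgΦ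
  have hh : HasGradientAt (kh p Φ) (gradient (kh p Φ) x) x :=
    (c.h_smooth.differentiable infty_ne_zero x).hasGradientAt
  have hi := c.hgi hx
  have hhi := hg_mul hh hi
  have hw : HasGradientAt (kw U p Φ) _ x := hg_mul hgU hhi
  have hgphi := hg_mul hgG hgΦ
  have hxi : HasGradientAt (kxi U G p Φ) _ x := hg_mul (hg_mul hhi hhi) hgphi
  have hzt : HasGradientAt (kzt U G p Φ) _ x := hg_mul (hg_mul hgG hgU) (hg_mul hhi hhi)
  have hk1 : HasGradientAt (kk1 U G p Φ) _ x := hg_mul (hg_mul hgG' hgΦ) hw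
  have hUi := hg_mul hgU hi
  have hk2 : HasGradientAt (kk2 U G p Φ) _ x := hg_mul (hg_mul hgp' hgΦ) (hg_mul (hg_mul hUi hUi) hgphi)
  exact key_alg (c.U0 x) (c.Φ0 x) (c.G0 _) (c.p0 _) (i := ki U p Φ x) rfl (c.hΦ.grad_orth hx)
    (real_inner_self_eq_norm_sq x) hh0.gradient rfl rfl
    hxi.gradient hzt.gradient hk1.gradient hk2.gradient

def NN (N : ℕ) (G : ℝ → ℝ) (l t : ℝ) : ℝ := -(2 * N * deriv G t + 4 * t * deriv (deriv G) t) + l * G t / t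

theorem NN_supp {l : ℝ} (hG : ∀ t, G t ≠ 0 → a ^ 2 ≤ t ∧ t ≤ b ^ 2) :
    ∀ t, NN N G l t ≠ 0 → a ^ 2 ≤ t ∧ t ≤ b ^ 2 := by
  intro t ht
  by_contra h
  apply ht
  have h1 : G t = 0 := by by_contra h'; exact h (hG t h')
  have h2 : deriv G t = 0 := by by_contra h'; exact h (deriv_supp hG t h')
  have h3 : deriv (deriv G) t = 0 := by by_contra h'; exact h (deriv_supp (deriv_supp hG) t h')
  simp [NN, h1, h2, h3]

theorem continuousOn_NN {l : ℝ} (hG : ContDiff ℝ (⊤ : ℕ∞) G) : ContinuousOn (NN N G l) (Set.Ioi 0) := by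
  have h1 := hG.continuous
  have h2 := (smooth_deriv hG).continuous
  have h3 := (smooth_deriv (smooth_deriv hG)).continuous
  unfold NN
  refine ContinuousOn.add (by fun_prop) ?_
  exact (continuous_const.mul h1).continuousOn.div continuousOn_id (fun t ht => ht.ne')

theorem zt_formula (c : KCtx S K Φ U G p a b A B) (x : Euc N) :
    kzt U G p Φ x = G (‖x‖ ^ 2) * kw U p Φ x -
      (U x * ki U p Φ x) * (U x * ki U p Φ x) * (G (‖x‖ ^ 2) * kh p Φ x) := by
  have hs := c.s0 x
  unfold kzt kw ki
  field_simp
  ring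

theorem ztΦ (x : Euc N) : Φ x * kzt U G p Φ x = U x * kxi U G p Φ x := by
  unfold kzt kxi; ring

theorem xi0 (c : KCtx S K Φ U G p a b A B) (x : Euc N) : 0 ≤ kxi U G p Φ x :=
  mul_nonneg (mul_self_nonneg _) (mul_nonneg (c.G0 _) (c.Φ0 _))

theorem psi_test (c : KCtx S K Φ U G p a b A B) {χ : ℝ → ℝ} (hχ : ContDiff ℝ (⊤ : ℕ∞) χ) {a' b' : ℝ}
    (ha' : 0 < a') (hb' : 0 < b') (hχa : ∀ t, χ t ≠ 0 → a' ^ 2 ≤ t ∧ t ≤ b' ^ 2) :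
    IsTestFun (sphCone S) (fun x => χ (‖x‖ ^ 2) * Φ x) := by
  have h := c.hΦ.cut c.hS.2.1 hχ ha' hχa hb' c.hK c.hKS c.hK0
  exact ⟨h.1, (isCompact_annK (c.hKS.trans c.hS.2.1) c.hK ha').of_isClosed_subset (isClosed_tsupport _) h.2,
    h.2.trans (annK_subset_cone c.hKS _ _)⟩

theorem mem_annK_norm {x : Euc N} (hKS : K ⊆ S) (hS : S ⊆ sphere (0 : Euc N) 1) (a0 : 0 ≤ a) (hx : x ∈ annK K a b) :
    a ^ 2 ≤ ‖x‖ ^ 2 ∧ ‖x‖ ^ 2 ≤ b ^ 2 :=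
  ⟨pow_le_pow_left₀ a0 hx.2.1 2, pow_le_pow_left₀ (norm_nonneg _) hx.2.2 2⟩

/-- key integral inequality, smooth case -/
theorem key_smooth (c : KCtx S K Φ U G p a b A B) {V : Euc N → ℝ} {Vm l lm : ℝ} (hV : IsPot V Vm)
    (hl : l ≤ lm)
    (hode : ∀ t, a ^ 2 ≤ t → t ≤ b ^ 2 → 2 * N * deriv p t + 4 * t * deriv (deriv p) t = lm * p t / t)
    {χ : ℝ → ℝ} (hχ : ContDiff ℝ (⊤ : ℕ∞) χ) {a' b' : ℝ}
    (ha' : 0 < a') (hb' : 0 < b') (hχa : ∀ t, χ t ≠ 0 → a' ^ 2 ≤ t ∧ t ≤ b' ^ 2)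
    (hχ1 : ∀ t, a ^ 2 ≤ t → t ≤ b ^ 2 → χ t = 1) :
    Integrable (fun x => Φ x * kw U p Φ x * NN N G lm (‖x‖ ^ 2)) ∧
    0 ≤ BB V l (fun x => χ (‖x‖ ^ 2) * Φ x) (kzt U G p Φ) +
      (∫ x, (lap U x + V x * U x / ‖x‖ ^ 2) * kxi U G p Φ x) +
      ∫ x, Φ x * kw U p Φ x * NN N G lm (‖x‖ ^ 2) := by
  set Ψ := fun x => χ (‖x‖ ^ 2) * Φ x with hΨ
  have hΨt := c.psi_test hχ ha' hb' hχa
  have i1 := integrable_BB c.hS.2.1 hV l hΨt c.zt_test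
  have icomp : ∀ {f : Euc N → ℝ}, Continuous f → (∀ x, x ∉ annK K a b → f x = 0) → Integrable f := by
    intro f hf h0
    exact hf.integrable_of_hasCompactSupport
      (HasCompactSupport.intro (c.cK c.a0) h0)
  have offk : ∀ {f : Euc N → ℝ} , tsupport f ⊆ annK K a b → ∀ x, x ∉ annK K a b → f x = 0 ∧ gradient f x = 0 := by
    intro f hf x hx
    exact ⟨image_eq_zero_of_notMem_tsupport (fun h => hx (hf h)),
      grad_eq_zero_of_notMem_tsupport (fun h => hx (hf h))⟩
  have cU2 : ContDiff ℝ 2 U := c.hU.of_le two_le_infty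
  have i2 : Integrable (fun x => ⟪gradient U x, gradient (kxi U G p Φ) x⟫) := by
    refine icomp ((continuous_gradient (c.hU.of_le one_le_infty)).inner
      (continuous_gradient (c.xi_smooth.of_le one_le_infty))) fun x hx => ?_
    rw [(offk c.xi_supp x hx).2, inner_zero_right]
  have e2 := integral_grad_grad cU2 (c.xi_smooth.of_le one_le_infty) (c.hc c.xi_supp)
  have i3 : Integrable (fun x => lap U x * kxi U G p Φ x) := by
    refine icomp ((continuous_lap cU2).mul c.xi_smooth.continuous) fun x hx => ?_
    rw [(offk c.xi_supp x hx).1, mul_zero]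
  have h0K : (0 : Euc N) ∉ annK K a b := by
    intro h
    have := h.2.1
    rw [norm_zero] at this
    linarith [c.a0]
  have i4 : Integrable (fun x => V x * (U x * kxi U G p Φ x * (‖x‖ ^ 2)⁻¹)) := by
    refine integrable_off_zero_mul hV (integrable_off_zero (c.cK c.a0) h0K ?_ ?_)
    · exact ((c.hU.continuous.mul c.xi_smooth.continuous).continuousOn).mul continuousOn_inv_normsq
    · intro x hx
      rw [(offk c.xi_supp x hx).1, mul_zero, zero_mul]
  have i5 : Integrable (fun x => Φ x * kw U p Φ x * NN N G lm (‖x‖ ^ 2)) := by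
    have := integrable_radial_hom (N := N) (c := NN N G lm) (continuousOn_NN c.Gs) c.a0 c.b0
      (NN_supp c.Ga) (Z := fun x => Φ x * kw U p Φ x)
      (c.hΦ.continuousOn.mul c.w_smooth.continuous.continuousOn)
    refine this.congr (Eventually.of_forall fun x => ?_)
    simp only; ring
  have hik : ∀ {k : Euc N → ℝ}, ContDiff ℝ (⊤ : ℕ∞) k → tsupport k ⊆ annK K a b →
      Integrable (fun x => ⟪x, gradient k x⟫ + N * k x) ∧ ∫ x, (⟪x, gradient k x⟫ + N * k x) = 0 := by
    intro k hk hks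
    have j1 : Integrable (fun x => ⟪x, gradient k x⟫) := by
      refine icomp (continuous_id.inner (continuous_gradient (hk.of_le one_le_infty))) fun x hx => ?_
      rw [(offk hks x hx).2, inner_zero_right]
    have j2 : Integrable (fun x => (N:ℝ) * k x) :=
      (icomp hk.continuous fun x hx => (offk hks x hx).1).const_mul _
    refine ⟨j1.add j2, ?_⟩
    rw [integral_add j1 j2, integral_inner_grad (hk.of_le one_le_infty) (c.hc hks), integral_const_mul]
    ring
  obtain ⟨i6, e6⟩ := hik c.k1_smooth c.k1_supp
  obtain ⟨i7, e7⟩ := hik c.k2_smooth c.k2_supp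
  refine ⟨i5, ?_⟩
  have hae : ∀ᵐ x : Euc N, 0 ≤ (TT Ψ (kzt U G p Φ) x - (V x + l) * (Ψ x * kzt U G p Φ x) / ‖x‖ ^ 2)
      + V x * (U x * kxi U G p Φ x * (‖x‖ ^ 2)⁻¹) - ⟪gradient U x, gradient (kxi U G p Φ) x⟫
      + (⟪x, gradient (kk1 U G p Φ) x⟫ + N * kk1 U G p Φ x)
      - (⟪x, gradient (kk2 U G p Φ) x⟫ + N * kk2 U G p Φ x)
      + Φ x * kw U p Φ x * NN N G lm (‖x‖ ^ 2) := by
    have hne : ∀ᵐ x : Euc N, x ≠ 0 := by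
      have : NeZero N := ⟨by
        rintro rfl
        obtain ⟨x, hx⟩ := c.hS.1
        have := c.hS.2.1 hx
        rw [mem_sphere_zero_iff_norm, Subsingleton.elim x 0, norm_zero] at this
        norm_num at this⟩
      simp [ae_iff, measure_singleton]
    filter_upwards [hne] with x hx
    have hn : 0 < ‖x‖ ^ 2 := by positivity
    have hpt := c.pointwise hx
    have hTT : TT Ψ (kzt U G p Φ) x = ⟪gradient Φ x, gradient (kzt U G p Φ) x⟫ ∧
        Ψ x * kzt U G p Φ x = Φ x * kzt U G p Φ x := by
      by_cases hxK : x ∈ annK K a b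
      · have h1 := mem_annK_norm c.hKS c.hS.2.1 c.a0.le hxK
        have h2 := hχ1 _ h1.1 h1.2
        have h3 := c.hΦ.cut_grad (hχ.differentiable infty_ne_zero) hx
        constructor
        · unfold TT
          rw [hΨ, h3, h2]
          simp only [inner_add_left, inner_add_right, inner_smul_left, inner_smul_right,
            c.hΦ.grad_orth hx, conj_trivial, real_inner_self_eq_norm_sq]
          field_simp
          ring
        · rw [hΨ]; simp only [h2, one_mul]
      · have h1 := offk c.zt_supp x hxK
        constructor
        · unfold TT
          rw [h1.2]; simp
        · rw [h1.1]; simp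
    have hξ := c.xi0 x
    have hli : l * (Φ x * kzt U G p Φ x) / ‖x‖ ^ 2 ≤ lm * (Φ x * kzt U G p Φ x) / ‖x‖ ^ 2 := by
      rw [ztΦ]
      have := mul_nonneg (c.U0 x).le hξ
      gcongr
    have hP : (2 * N * deriv p (‖x‖ ^ 2) + 4 * ‖x‖ ^ 2 * deriv (deriv p) (‖x‖ ^ 2) - lm * p (‖x‖ ^ 2) / ‖x‖ ^ 2)
        * (Φ x * ((U x * ki U p Φ x) * (U x * ki U p Φ x) * (G (‖x‖ ^ 2) * Φ x))) = 0 := by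
      by_cases hG : G (‖x‖ ^ 2) = 0
      · rw [hG]; ring
      · rw [hode _ (c.Ga _ hG).1 (c.Ga _ hG).2]; ring
    have hz := c.zt_formula x
    have hz2 : lm * (Φ x * kzt U G p Φ x) / ‖x‖ ^ 2 = Φ x * kw U p Φ x * (lm * G (‖x‖ ^ 2) / ‖x‖ ^ 2) -
        lm * p (‖x‖ ^ 2) / ‖x‖ ^ 2 * (Φ x * ((U x * ki U p Φ x) * (U x * ki U p Φ x) * (G (‖x‖ ^ 2) * Φ x))) := by
      rw [hz]; unfold kh; ring
    have hV2 : V x * (U x * kxi U G p Φ x * (‖x‖ ^ 2)⁻¹) = V x * (Φ x * kzt U G p Φ x) / ‖x‖ ^ 2 := by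
      rw [ztΦ]; ring
    rw [hTT.1, hTT.2, hV2]
    unfold NN
    have e1 : kk1 U G p Φ x = 2 * deriv G (‖x‖ ^ 2) * Φ x * kw U p Φ x := rfl
    have e2 : kk2 U G p Φ x = (2 * deriv p (‖x‖ ^ 2) * Φ x) *
      ((U x * ki U p Φ x) * (U x * ki U p Φ x) * (G (‖x‖ ^ 2) * Φ x)) := rfl
    rw [e1, e2]
    have e3 : (V x + l) * (Φ x * kzt U G p Φ x) / ‖x‖ ^ 2 =
      V x * (Φ x * kzt U G p Φ x) / ‖x‖ ^ 2 + l * (Φ x * kzt U G p Φ x) / ‖x‖ ^ 2 := by ring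
    rw [e3]
    set Q := ((U x * ki U p Φ x) * (U x * ki U p Φ x) * (G (‖x‖ ^ 2) * Φ x))
    linarith
  have hint := integral_nonneg_of_ae hae
  have j1 := i1.add i4
  have j2 := j1.sub i2
  have j3 := j2.add i6
  have j4 := j3.sub i7
  have s5 := integral_add j4 i5
  have s4 := integral_sub j3 i7
  have s3 := integral_add j2 i6
  have s2 := integral_sub j1 i2
  have s1 := integral_add i1 i4
  simp only [Pi.add_apply, Pi.sub_apply] at s5 s4 s3 s2 s1
  rw [s5, s4, s3, s2, s1, e6, e7, e2] at hint
  have e8 : ∫ x, (lap U x + V x * U x / ‖x‖ ^ 2) * kxi U G p Φ x =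
      (∫ x, lap U x * kxi U G p Φ x) + ∫ x, V x * (U x * kxi U G p Φ x * (‖x‖ ^ 2)⁻¹) := by
    rw [← integral_add i3 i4]
    congr 1; ext x; ring
  rw [e8]
  unfold BB
  linarith

end KCtx
end

set_option linter.unusedSimpArgs false
noncomputable section

theorem zt_alg {E : Type*} [NormedAddCommGroup E] [InnerProductSpace ℝ E] {gU H X I Z Q Y : E}
    {U i h g : ℝ} (hU : 0 < U) (hh : 0 ≤ h) (hg : 0 ≤ g)
    (hi : i = (U + h)⁻¹)
    (hI : I = (-(i ^ 2)) • (gU + H))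
    (hZ : Z = (g * U) • ((h * i) • (h • I + i • H) + (h * i) • (h • I + i • H))
      + ((h * i) * (h * i)) • (g • gU + U • X))
    (hQ : Q = g • H + h • X)
    (hY : Y = ((g * h) * (g * h)) • ((-(U ^ 2)⁻¹) • gU) + U⁻¹ • ((g * h) • Q + (g * h) • Q)) :
    ‖Z‖ ^ 2 ≤ -6 * ⟪gU, Y⟫ + 27 * (h ^ 2 * ‖X‖ ^ 2) + 36 * (g ^ 2 * ‖H‖ ^ 2) := by
  have hs : 0 < U + h := by positivity
  have hi0 : 0 < i := by rw [hi]; positivity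
  have hUi : U * i ≤ 1 := by rw [hi, ← div_eq_mul_inv, div_le_one hs]; linarith
  have hhi : h * i ≤ 1 := by rw [hi, ← div_eq_mul_inv, div_le_one hs]; linarith
  have hUi0 : 0 ≤ U * i := by positivity
  have hhi0 : 0 ≤ h * i := by positivity
  have hsum : U * i + h * i = 1 := by rw [hi]; field_simp
  have iU : i ≤ U⁻¹ := by rw [← one_div, le_div_iff₀ hU]; linarith
  have eZ : Z = (U * (h * i) ^ 2) • X + (g * (h * i) ^ 2 * (1 - 2 * (U * i))) • gU
      + (2 * g * (h * i) * (U * i) * (1 - h * i)) • H := by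
    rw [hZ, hI]
    module
  have n1 : |U * (h * i) ^ 2| ≤ h := by
    rw [abs_of_nonneg (by positivity)]
    have : U * (h * i) ^ 2 = h * ((U * i) * (h * i)) := by ring
    rw [this]
    exact mul_le_of_le_one_right hh (mul_le_one₀ hUi hhi0 hhi)
  have n2 : |g * (h * i) ^ 2 * (1 - 2 * (U * i))| ≤ g * (h * U⁻¹) := by
    rw [abs_mul, abs_of_nonneg (by positivity : 0 ≤ g * (h * i) ^ 2), mul_assoc]
    refine mul_le_mul_of_nonneg_left ?_ hg
    have h1 : |1 - 2 * (U * i)| ≤ 1 := by rw [abs_le]; constructor <;> linarith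
    have h2 : (h * i) ^ 2 ≤ h * U⁻¹ := by
      rw [sq]
      calc h * i * (h * i) ≤ h * i * 1 := mul_le_mul_of_nonneg_left hhi hhi0
        _ ≤ h * U⁻¹ := by rw [mul_one]; exact mul_le_mul_of_nonneg_left iU hh
    calc (h * i) ^ 2 * |1 - 2 * (U * i)| ≤ (h * i) ^ 2 * 1 := mul_le_mul_of_nonneg_left h1 (sq_nonneg _)
      _ ≤ _ := by rw [mul_one]; exact h2
  have n3 : |2 * g * (h * i) * (U * i) * (1 - h * i)| ≤ 2 * g := by
    have h0 : 0 ≤ 1 - h * i := by linarith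
    rw [abs_of_nonneg (by positivity)]
    have h1 : (h * i) * (U * i) * (1 - h * i) ≤ 1 :=
      mul_le_one₀ (mul_le_one₀ hhi hUi0 hUi) h0 (by linarith)
    nlinarith
  have nZ : ‖Z‖ ≤ h * ‖X‖ + g * (h * U⁻¹) * ‖gU‖ + 2 * g * ‖H‖ := by
    rw [eZ]
    refine (norm_add₃_le).trans ?_
    simp only [norm_smul, Real.norm_eq_abs]
    gcongr
  have nZ2 : ‖Z‖ ^ 2 ≤ 3 * ((h * ‖X‖) ^ 2 + (g * (h * U⁻¹) * ‖gU‖) ^ 2 + (2 * g * ‖H‖) ^ 2) := by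
    have := pow_le_pow_left₀ (norm_nonneg Z) nZ 2
    nlinarith [sq_nonneg (h * ‖X‖ - g * (h * U⁻¹) * ‖gU‖), sq_nonneg (h * ‖X‖ - 2 * g * ‖H‖),
      sq_nonneg (g * (h * U⁻¹) * ‖gU‖ - 2 * g * ‖H‖)]
  have nQ : ‖Q‖ ≤ g * ‖H‖ + h * ‖X‖ := by
    rw [hQ]
    refine (norm_add_le _ _).trans ?_
    simp only [norm_smul, Real.norm_eq_abs, abs_of_nonneg hg, abs_of_nonneg hh]
    rfl
  have nQ2 : ‖Q‖ ^ 2 ≤ 2 * (g * ‖H‖) ^ 2 + 2 * (h * ‖X‖) ^ 2 := by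
    have := pow_le_pow_left₀ (norm_nonneg Q) nQ 2
    nlinarith [sq_nonneg (g * ‖H‖ - h * ‖X‖)]
  have hin : ⟪gU, Y⟫ ≤ -(1/2) * (g * (h * U⁻¹) * ‖gU‖) ^ 2 + 2 * ‖Q‖ ^ 2 := by
    rw [hY]
    simp only [inner_add_right, inner_smul_right, real_inner_self_eq_norm_sq]
    have h1 := real_inner_le_norm gU Q
    have h2 : 0 ≤ g * (h * U⁻¹) := by positivity
    have h3 := mul_le_mul_of_nonneg_left h1 h2
    have e1 : g * h * (g * h) * (-(U ^ 2)⁻¹ * ‖gU‖ ^ 2) = - (g * (h * U⁻¹) * ‖gU‖) ^ 2 := by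
      rw [← inv_pow]; ring
    rw [e1]
    nlinarith [sq_nonneg (g * (h * U⁻¹) * ‖gU‖ - 2 * ‖Q‖)]
  nlinarith

namespace KCtx
variable {N : ℕ} {S K : Set (Euc N)} {Φ U : Euc N → ℝ} {G p : ℝ → ℝ} {a b A B : ℝ}

theorem ae_ne_zero (hS : IsSphereDomain N S) : ∀ᵐ x : Euc N, x ≠ 0 := by
  have : NeZero N := ⟨by
    rintro rfl
    obtain ⟨x, hx⟩ := hS.1
    have := hS.2.1 hx
    rw [mem_sphere_zero_iff_norm, Subsingleton.elim x 0, norm_zero] at this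
    norm_num at this⟩
  simp [ae_iff, measure_singleton]

theorem BB_psi (hN : 3 ≤ N) (c : KCtx S K Φ U G p a b A B) {V : Euc N → ℝ} {Vm l : ℝ} (hV : IsPot V Vm)
    {χ : ℝ → ℝ} (hχ : ContDiff ℝ (⊤ : ℕ∞) χ) :
    BB V l (fun x => χ (‖x‖ ^ 2) * Φ x) (fun x => χ (‖x‖ ^ 2) * Φ x) =
      Jr N (fun t => χ t ^ 2 / t) * (Es V Φ - l * sm (fun x => Φ x ^ 2)) := by
  have e1 : BB V l (fun x => χ (‖x‖ ^ 2) * Φ x) (fun x => χ (‖x‖ ^ 2) * Φ x) =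
      ∫ x, (χ (‖x‖ ^ 2) ^ 2 / ‖x‖ ^ 2) * (qg Φ x - V x * Φ x ^ 2 - l * Φ x ^ 2) := by
    unfold BB
    refine integral_congr_ae ?_
    filter_upwards [ae_ne_zero c.hS] with x hx
    have hn : 0 < ‖x‖ ^ 2 := by positivity
    have h3 := c.hΦ.cut_grad (hχ.differentiable infty_ne_zero) hx
    have ho := c.hΦ.grad_orth hx
    have ho' : ⟪gradient Φ x, x⟫ = 0 := by rw [real_inner_comm]; exact ho
    unfold TT qg
    rw [h3]
    simp only [inner_add_left, inner_add_right, inner_smul_left, inner_smul_right,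
            ho, ho', conj_trivial, real_inner_self_eq_norm_sq]
    field_simp
    ring
  rw [e1, hom_polar hN (fun t => χ t ^ 2 / t) (Z := fun x => qg Φ x - V x * Φ x ^ 2 - l * Φ x ^ 2)
    (fun s hs x => by rw [c.hΦ.qg_hom s hs, c.hΦ.1 s hs, hV.1 s hs])]
  congr 1
  unfold Es sm
  have j1 : Integrable (fun σ : sphere (0 : Euc N) 1 => qg Φ σ) (sph N) :=
    integrable_sphere c.hΦ.continuous_qg_sphere
  have j2 := integrable_VPhi hV c.hΦ
  have j3 : Integrable (fun σ : sphere (0 : Euc N) 1 => l * Φ σ ^ 2) (sph N) :=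
    integrable_sphere (continuous_const.mul (c.hΦ.continuous_sphere.pow 2))
  have j12 : Integrable (fun σ : sphere (0 : Euc N) 1 => qg Φ σ - V σ * Φ σ ^ 2) (sph N) := j1.sub j2
  rw [integral_sub j12 j3, integral_sub j1 j2, integral_const_mul]

def cc1 (G p : ℝ → ℝ) (l t : ℝ) : ℝ :=
  108 * (deriv G t ^ 2 * t * p t ^ 2) + 144 * (G t ^ 2 * deriv p t ^ 2 * t) + |l| * (G t ^ 2 * p t ^ 2 / t)
def cc2 (G p : ℝ → ℝ) (t : ℝ) : ℝ := 36 * (G t ^ 2 * p t ^ 2 / t)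

theorem BB_zeta (hN : 3 ≤ N) (c : KCtx S K Φ U G p a b A B) {V : Euc N → ℝ} {Vm l : ℝ} (hV : IsPot V Vm)
    (hlap : ∀ x ∈ annK K a b, lap U x ≤ 0) :
    BB V l (kzt U G p Φ) (kzt U G p Φ) ≤
      Jr N (cc1 G p l) * sm (fun x => Φ x ^ 2) + Jr N (cc2 G p) * sm (qg Φ) := by
  set η : Euc N → ℝ := fun x => (G (‖x‖ ^ 2) * kh p Φ x) * (G (‖x‖ ^ 2) * kh p Φ x) * (U x)⁻¹ with hη
  have ηs : ContDiff ℝ (⊤ : ℕ∞) η :=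
    (((r_smooth c.Gs).mul c.h_smooth).mul ((r_smooth c.Gs).mul c.h_smooth)).mul
      (c.hU.inv fun x => (c.U0 x).ne')
  have ηsupp : tsupport η ⊆ annK K a b := by
    refine (closure_mono fun x hx => ?_).trans c.gΦ.2
    intro (h : G (‖x‖ ^ 2) * Φ x = 0)
    apply hx
    have : G (‖x‖ ^ 2) * kh p Φ x = 0 := by
      unfold kh
      rw [mul_left_comm, h, mul_zero]
    simp only [hη, this, zero_mul]
  have η0 : ∀ x, 0 ≤ η x := fun x => mul_nonneg (mul_self_nonneg _) (inv_nonneg.mpr (c.U0 x).le)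
  have e1 := integral_grad_grad (c.hU.of_le two_le_infty) (ηs.of_le one_le_infty) (c.hc ηsupp)
  have e1' : 0 ≤ ∫ x, ⟪gradient U x, gradient η x⟫ := by
    rw [e1, neg_nonneg]
    refine integral_nonpos fun x => ?_
    by_cases hx : x ∈ annK K a b
    · exact mul_nonpos_of_nonpos_of_nonneg (hlap x hx) (η0 x)
    · rw [image_eq_zero_of_notMem_tsupport (fun h => hx (ηsupp h)), mul_zero]; exact le_rfl
  have i1 : Integrable (fun x => ⟪gradient U x, gradient η x⟫) := by
    refine Continuous.integrable_of_hasCompactSupport ((continuous_gradient (c.hU.of_le one_le_infty)).inner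
      (continuous_gradient (ηs.of_le one_le_infty))) (HasCompactSupport.intro (c.cK c.a0) fun x hx => ?_)
    rw [grad_eq_zero_of_notMem_tsupport (fun h => hx (ηsupp h)), inner_zero_right]
  have hcG := c.Gs.continuous
  have hcG' := (smooth_deriv c.Gs).continuous
  have hcp := c.ps.continuous
  have hcp' := (smooth_deriv c.ps).continuous
  have i2 : Integrable (fun x => cc1 G p l (‖x‖ ^ 2) * Φ x ^ 2) := by
    refine integrable_radial_hom (c := cc1 G p l) ?_ c.a0 c.b0 ?_ (Z := fun x => Φ x ^ 2) (c.hΦ.continuousOn.pow 2)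
    · unfold cc1
      refine ContinuousOn.add (by fun_prop) ?_
      refine continuousOn_const.mul (ContinuousOn.div (by fun_prop) continuousOn_id fun t ht => ht.ne')
    · intro t ht
      by_contra h
      apply ht
      have h1 : G t = 0 := by by_contra h'; exact h (c.Ga t h')
      have h2 : deriv G t = 0 := by by_contra h'; exact h (deriv_supp c.Ga t h')
      simp [cc1, h1, h2]
  have i3 : Integrable (fun x => cc2 G p (‖x‖ ^ 2) * qg Φ x) := by
    refine integrable_radial_hom (c := cc2 G p) ?_ c.a0 c.b0 ?_ c.hΦ.continuousOn_qg
    · unfold cc2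
      refine continuousOn_const.mul (ContinuousOn.div (by fun_prop) continuousOn_id fun t ht => ht.ne')
    · intro t ht
      by_contra h
      apply ht
      have h1 : G t = 0 := by by_contra h'; exact h (c.Ga t h')
      simp [cc2, h1]
  have hp0 : ∀ᶠ t in 𝓝 (0:ℝ), p t = 0 := by
    filter_upwards [gt_mem_nhds (pow_pos c.A0 2)] with t ht
    by_contra h
    linarith [(c.pA t h).1]
  have hae : ∀ᵐ x : Euc N, TT (kzt U G p Φ) (kzt U G p Φ) x -
      (V x + l) * (kzt U G p Φ x * kzt U G p Φ x) / ‖x‖ ^ 2 ≤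
      -6 * ⟪gradient U x, gradient η x⟫ + cc1 G p l (‖x‖ ^ 2) * Φ x ^ 2 + cc2 G p (‖x‖ ^ 2) * qg Φ x := by
    filter_upwards [ae_ne_zero c.hS] with x hx
    have hn : 0 < ‖x‖ ^ 2 := by positivity
    have hgU : HasGradientAt U (gradient U x) x := (c.hU.differentiable infty_ne_zero x).hasGradientAt
    have hgG := hg_radial (N := N) (x := x) (c.Gs.differentiable infty_ne_zero (‖x‖ ^ 2)).hasDerivAt
    have hh : HasGradientAt (kh p Φ) (gradient (kh p Φ) x) x :=
      (c.h_smooth.differentiable infty_ne_zero x).hasGradientAt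
    have hi := c.hgi hx
    have hhi := hg_mul hh hi
    have hzt : HasGradientAt (kzt U G p Φ) _ x := hg_mul (hg_mul hgG hgU) (hg_mul hhi hhi)
    have hq := hg_mul hgG hh
    have hηg : HasGradientAt η _ x :=
      hg_mul (hg_mul hq hq) (hg_comp (F := fun s : ℝ => s⁻¹) (hasDerivAt_inv (c.U0 x).ne') hgU)
    have key := zt_alg (c.U0 x) (c.h0 x) (c.G0 (‖x‖ ^ 2)) (i := ki U p Φ x) rfl rfl hzt.gradient rfl hηg.gradient
    rw [show gradient (kh p Φ) x = gradient (fun y => p (‖y‖ ^ 2) * Φ y) x from rfl,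
      c.hΦ.cut_grad_norm (c.ps.differentiable infty_ne_zero) hp0 x, norm_smul, mul_pow, Real.norm_eq_abs,
      sq_abs] at key
    have hz1 : kzt U G p Φ x ^ 2 ≤ (G (‖x‖ ^ 2) * kh p Φ x) ^ 2 := by
      have hs := c.s0 x
      have hh0 := c.h0 x
      have hU0 := c.U0 x
      have hi0 := c.i0 x
      have hUi : U x * ki U p Φ x ≤ 1 := by
        unfold ki; rw [← div_eq_mul_inv, div_le_one hs]; linarith
      have hhi : kh p Φ x * ki U p Φ x ≤ 1 := by
        unfold ki; rw [← div_eq_mul_inv, div_le_one hs]; linarith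
      have e : kzt U G p Φ x = G (‖x‖ ^ 2) * kh p Φ x * ((U x * ki U p Φ x) * (kh p Φ x * ki U p Φ x)) := by
        unfold kzt; ring
      have hg0 := c.G0 (‖x‖ ^ 2)
      refine pow_le_pow_left₀ ?_ ?_ 2
      · rw [e]; positivity
      · rw [e]
        exact mul_le_of_le_one_right (by positivity) (mul_le_one₀ hUi (by positivity) hhi)
    have hTT : TT (kzt U G p Φ) (kzt U G p Φ) x ≤ ‖gradient (kzt U G p Φ) x‖ ^ 2 := by
      unfold TT
      rw [real_inner_self_eq_norm_sq]
      have : 0 ≤ ⟪x, gradient (kzt U G p Φ) x⟫ * ⟪x, gradient (kzt U G p Φ) x⟫ / ‖x‖ ^ 2 :=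
        div_nonneg (mul_self_nonneg _) hn.le
      linarith
    have hVl : -((V x + l) * (kzt U G p Φ x * kzt U G p Φ x) / ‖x‖ ^ 2) ≤
        |l| * (G (‖x‖ ^ 2) * kh p Φ x) ^ 2 / ‖x‖ ^ 2 := by
      rw [← neg_div]
      refine div_le_div_of_nonneg_right ?_ hn.le
      have h1 : -(V x + l) ≤ |l| := by linarith [(hV.2.2 x).1, neg_le_abs l]
      calc -((V x + l) * (kzt U G p Φ x * kzt U G p Φ x)) = -(V x + l) * kzt U G p Φ x ^ 2 := by ring
        _ ≤ |l| * kzt U G p Φ x ^ 2 := mul_le_mul_of_nonneg_right h1 (sq_nonneg _)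
        _ ≤ _ := mul_le_mul_of_nonneg_left hz1 (abs_nonneg _)
    have hfin : cc1 G p l (‖x‖ ^ 2) * Φ x ^ 2 + cc2 G p (‖x‖ ^ 2) * qg Φ x =
        27 * (kh p Φ x ^ 2 * ((2 * deriv G (‖x‖ ^ 2)) ^ 2 * ‖x‖ ^ 2)) +
        36 * (G (‖x‖ ^ 2) ^ 2 * (p (‖x‖ ^ 2) ^ 2 / ‖x‖ ^ 2 * qg Φ x +
          4 * deriv p (‖x‖ ^ 2) ^ 2 * ‖x‖ ^ 2 * Φ x ^ 2)) +
        |l| * (G (‖x‖ ^ 2) * kh p Φ x) ^ 2 / ‖x‖ ^ 2 := by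
      unfold cc1 cc2 kh
      ring
    linarith
  have i4 : Integrable (fun x => -6 * ⟪gradient U x, gradient η x⟫ + cc1 G p l (‖x‖ ^ 2) * Φ x ^ 2) :=
    (i1.const_mul _).add i2
  have hmono := integral_mono_ae (integrable_BB c.hS.2.1 hV l c.zt_test c.zt_test) (i4.add i3) hae
  have s1 := integral_add i4 i3
  have s2 := integral_add (i1.const_mul (-6)) i2
  simp only [Pi.add_apply] at hmono
  rw [s1, s2, integral_const_mul, hom_polar hN (cc1 G p l) (Z := fun x => Φ x ^ 2)
    (fun s hs x => by rw [c.hΦ.1 s hs]), hom_polar hN (cc2 G p) c.hΦ.qg_hom] at hmono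
  unfold BB
  linarith

end KCtx
end

set_option linter.unusedSimpArgs false
noncomputable section

theorem lap_add_const {N : ℕ} {f : Euc N → ℝ} (hf : ContDiff ℝ 2 f) (c : ℝ) (x : Euc N) :
    lap (fun y => f y + c) x = lap f x := by
  rw [lap_eq (hf.add contDiff_const), lap_eq hf]
  simp only [fderiv_add_const]

theorem lap_mker_neg {N : ℕ} (v : ℝ) (z : Euc N) : lap (mker N v) (-z) = lap (mker N v) z := by
  have h := lap_comp_smul (mker_contDiff N v) (-1) z
  simp only [neg_smul, one_smul, mker_neg] at h
  rw [h]; ring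

theorem reg_lap {N : ℕ} {Ω K2 : Set (Euc N)} {u W : Euc N → ℝ}
    (hsup : ∀ φ : Euc N → ℝ, IsTestFun Ω φ → (∀ x, 0 ≤ φ x) →
      ∫ x, u x * lap φ x ≤ -∫ x, W x * u x * φ x)
    (hi : LocallyIntegrable (K2.indicator u)) {v ρ : ℝ} (hv : 0 < v) (hvρ : v⁻¹ ≤ ρ)
    {x : Euc N} (hK2 : closedBall x ρ ⊆ K2) (hΩ : K2 ⊆ Ω) (c : ℝ) :
    lap (fun y => moll (K2.indicator u) v y + c) x ≤
      -moll (fun y => K2.indicator W y * K2.indicator u y) v x := by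
  rw [lap_add_const ((moll_contDiff hi hv).of_le two_le_infty)]
  have h1 := conv_lap hi ((mker_contDiff N v).of_le two_le_infty) (mker_hasCompactSupport hv) x
  have e0 : lap (moll (K2.indicator u) v) x = lap (fun x => ∫ y, K2.indicator u y * mker N v (x - y)) x := rfl
  rw [e0, h1]
  have ht := testFun_of_translate (Ω := Ω) (mker_contDiff N v)
    ((mker_tsupport hv).trans (closedBall_subset_closedBall hvρ)) (hK2.trans hΩ)
  have h2 := hsup _ ht (fun y => mker_nonneg hv _)
  have e1 : (∫ y, K2.indicator u y * lap (mker N v) (x - y)) =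
      ∫ y, u y * lap (fun y => mker N v (y - x)) y := by
    congr 1; ext y
    rw [lap_comp_sub, ← neg_sub x y, lap_mker_neg]
    by_cases hy : y ∈ K2
    · rw [Set.indicator_of_mem hy]
    · have : lap (mker N v) (x - y) = 0 := by
        apply lap_eq_zero_of_notMem_tsupport
        intro h
        have h' := mker_tsupport hv h
        apply hy; apply hK2
        rw [mem_closedBall, dist_comm, dist_eq_norm]
        simpa using (mem_closedBall_zero_iff.mp h').trans hvρ
      rw [this]; simp
  rw [e1]
  refine h2.trans (le_of_eq ?_)
  congr 1
  unfold moll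
  congr 1; ext y
  have e2 : mker N v (y - x) = mker N v (x - y) := by rw [← neg_sub x y, mker_neg]
  rw [e2]
  dsimp only
  by_cases hy : y ∈ K2
  · rw [Set.indicator_of_mem hy, Set.indicator_of_mem hy]
  · have : mker N v (x - y) = 0 := by
      apply mker_zero hv
      by_contra hcon
      apply hy; apply hK2
      rw [mem_closedBall, dist_comm, dist_eq_norm]
      linarith
    rw [this]; simp

theorem moll_nonneg {N : ℕ} {u : Euc N → ℝ} (hu : ∀ᵐ x, 0 ≤ u x) {v : ℝ} (hv : 0 < v) (x : Euc N) :
    0 ≤ moll u v x :=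
  integral_nonneg_of_ae (by filter_upwards [hu] with y hy; exact mul_nonneg hy (mker_nonneg hv _))

theorem moll_mul_le {N : ℕ} {u W : Euc N → ℝ} (hu : ∀ᵐ x, 0 ≤ u x) (hi : Integrable u) {M : ℝ}
    (hWM : ∀ x, W x ≤ M) (hwi : Integrable (fun y => W y * u y)) {v : ℝ} (hv : 0 < v) (x : Euc N) :
    moll (fun y => W y * u y) v x ≤ M * moll u v x := by
  unfold moll
  rw [← integral_const_mul]
  have key : ∀ {f : Euc N → ℝ}, Integrable f → Integrable (fun y => f y * mker N v (x - y)) := by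
    intro f hf
    refine hf.mul_bdd (c := (mollC N)⁻¹ * v ^ N * th0 0) ?_ ?_
    · exact ((mker_contDiff N v).continuous.comp (continuous_const.sub continuous_id)).aestronglyMeasurable
    · refine Eventually.of_forall fun y => ?_
      rw [Real.norm_eq_abs, abs_of_nonneg (mker_nonneg hv _)]
      exact mker_le hv _
  refine integral_mono_ae (key hwi) ((key hi).const_mul M) ?_
  filter_upwards [hu] with y hy
  have := mker_nonneg hv (x - y)
  have h2 := mul_nonneg hy this
  have := mul_le_mul_of_nonneg_right (hWM y) h2
  linarith

theorem kw_le {U h : ℝ} (hU : 0 ≤ U) (hh : 0 ≤ h) : 0 ≤ U * (h * (U + h)⁻¹) ∧ U * (h * (U + h)⁻¹) ≤ h ∧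
    U * (h * (U + h)⁻¹) ≤ U ∧ 0 ≤ h * (U + h)⁻¹ ∧ h * (U + h)⁻¹ ≤ 1 := by
  have h1 : 0 ≤ h * (U + h)⁻¹ := by positivity
  have h2 : h * (U + h)⁻¹ ≤ 1 := by
    rw [← div_eq_mul_inv]; exact div_le_one_of_le₀ (by linarith) (by linarith)
  have h3 : U * (U + h)⁻¹ ≤ 1 := by
    rw [← div_eq_mul_inv]; exact div_le_one_of_le₀ (by linarith) (by linarith)
  refine ⟨by positivity, ?_, ?_, h1, h2⟩
  · calc U * (h * (U + h)⁻¹) = h * (U * (U + h)⁻¹) := by ring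
      _ ≤ h * 1 := by gcongr
      _ = h := by ring
  · calc U * (h * (U + h)⁻¹) ≤ U * 1 := by gcongr
      _ = U := by ring

theorem kw_tendsto {U : ℝ → ℝ} {u h : ℝ} (hu : 0 ≤ u) (hh : 0 ≤ h) (hU : Tendsto U atTop (𝓝 u)) :
    Tendsto (fun v => U v * (h * (U v + h)⁻¹)) atTop (𝓝 (u * (h * (u + h)⁻¹))) := by
  rcases hh.eq_or_lt with rfl | hh
  · simp
  · exact hU.mul (((hU.add_const h).inv₀ (by linarith)).const_mul h)

theorem key_limit {N : ℕ} (hN : 3 ≤ N) {S K : Set (Euc N)} (hS : IsSphereDomain N S) {r : ℝ}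
    {u V : Euc N → ℝ} (hu : SH (coneLike S r) u) {Vm : ℝ} (hV : IsPot V Vm)
    (hsup : ∀ φ : Euc N → ℝ, IsTestFun (coneLike S r) φ → (∀ x, 0 ≤ φ x) →
      ∫ x, u x * lap φ x ≤ -∫ x, V x / ‖x‖ ^ 2 * u x * φ x)
    {Φ : Euc N → ℝ} {G p : ℝ → ℝ} {a b A B : ℝ} (hbr : b < r)
    (hc : ∀ U : Euc N → ℝ, ContDiff ℝ (⊤ : ℕ∞) U → (∀ x, 0 < U x) → KCtx S K Φ U G p a b A B)
    {lm : ℝ} (hl : lam1 S V ≤ lm)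
    (hode : ∀ t, a ^ 2 ≤ t → t ≤ b ^ 2 → 2 * N * deriv p t + 4 * t * deriv (deriv p) t = lm * p t / t)
    {χ : ℝ → ℝ} (hχ : ContDiff ℝ (⊤ : ℕ∞) χ) {a' b' : ℝ}
    (ha' : 0 < a') (hb' : 0 < b') (hχa : ∀ t, χ t ≠ 0 → a' ^ 2 ≤ t ∧ t ≤ b' ^ 2)
    (hχ1 : ∀ t, a ^ 2 ≤ t → t ≤ b ^ 2 → χ t = 1) :
    Integrable (fun x => Φ x * kw u p Φ x * KCtx.NN N G lm (‖x‖ ^ 2)) ∧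
    -Real.sqrt ((Jr N (fun t => χ t ^ 2 / t) * (Es V Φ - lam1 S V * sm (fun x => Φ x ^ 2))) *
      (Jr N (KCtx.cc1 G p (lam1 S V)) * sm (fun x => Φ x ^ 2) + Jr N (KCtx.cc2 G p) * sm (qg Φ))) ≤
      ∫ x, Φ x * kw u p Φ x * KCtx.NN N G lm (‖x‖ ^ 2) := by
  have c1 := hc (fun _ => 1) contDiff_const (fun _ => one_pos)
  have a0 := c1.a0
  have hO : IsOpen (coneLike S r) := isOpen_coneLike hS r
  have hK1c : IsCompact (annK K a b) := c1.cK a0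
  have hK1Ω : annK K a b ⊆ coneLike S r := fun x hx =>
    ⟨sphCone_mono c1.hKS hx.1, by rw [mem_ball_zero_iff]; exact hx.2.2.trans_lt hbr⟩
  obtain ⟨ρ, hρ, hρΩ⟩ := hK1c.exists_cthickening_subset_open hO hK1Ω
  set K2 := cthickening ρ (annK K a b) with hK2
  have hK2c : IsCompact K2 := hK1c.cthickening
  have hball : ∀ x ∈ annK K a b, closedBall x ρ ⊆ K2 := fun x hx =>
    closedBall_subset_cthickening hx ρ
  set ut := K2.indicator u with hut
  have iut : Integrable ut := by
    rw [hut, integrable_indicator_iff hK2c.measurableSet]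
    exact hu.1.integrableOn_compact_subset hρΩ hK2c
  have ut0 : ∀ᵐ x, 0 ≤ ut x := by
    filter_upwards [hu.2.1] with x hx
    by_cases h : x ∈ K2
    · rw [hut, Set.indicator_of_mem h]; exact hx (hρΩ h)
    · rw [hut, Set.indicator_of_notMem h]
  have zero_notin : (0 : Euc N) ∉ coneLike S r := by
    rintro ⟨⟨s, hs, σ, hσ, h⟩, _⟩
    have hn : ‖σ‖ = 1 := by simpa using hS.2.1 hσ
    have h2 := congrArg norm h
    rw [norm_smul, hn, norm_zero, mul_one] at h2
    exact hs.ne' (by simpa using h2.symm)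
  set W : Euc N → ℝ := fun x => V x / ‖x‖ ^ 2 with hW
  have Wm : Measurable W := hV.2.1.div (by fun_prop)
  have W0 : ∀ x, 0 ≤ W x := fun x => div_nonneg (hV.2.2 x).1 (by positivity)
  have Vm0 : 0 ≤ Vm := (hV.2.2 0).1.trans (hV.2.2 0).2
  obtain ⟨Wb, hWb0, hWb⟩ : ∃ Wb, 0 ≤ Wb ∧ ∀ x ∈ K2, W x ≤ Wb := by
    have hcont : ContinuousOn (fun x : Euc N => (‖x‖ ^ 2)⁻¹) K2 := by
      refine ContinuousOn.inv₀ (by fun_prop) fun x hx => ?_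
      have : x ≠ 0 := fun h => zero_notin (h ▸ hρΩ hx)
      positivity
    obtain ⟨C, hC⟩ := hK2c.exists_bound_of_continuousOn hcont
    refine ⟨Vm * |C|, by positivity, fun x hx => ?_⟩
    rw [hW]; simp only
    rw [div_eq_mul_inv]
    have h1 := (le_abs_self _).trans (hC x hx)
    have h2 := h1.trans (le_abs_self C)
    exact mul_le_mul (hV.2.2 x).2 h2 (by positivity) Vm0
  set W2 := K2.indicator W with hW2
  have W2b : ∀ x, 0 ≤ W2 x ∧ W2 x ≤ Wb := by
    intro x
    by_cases h : x ∈ K2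
    · rw [hW2, Set.indicator_of_mem h]; exact ⟨W0 x, hWb x h⟩
    · rw [hW2, Set.indicator_of_notMem h]; exact ⟨le_rfl, hWb0⟩
  have W2m : Measurable W2 := Wm.indicator hK2c.measurableSet
  have iW : Integrable (fun y => W2 y * ut y) := by
    refine iut.bdd_mul (c := Wb) W2m.aestronglyMeasurable (Eventually.of_forall fun y => ?_)
    rw [Real.norm_eq_abs, abs_of_nonneg (W2b y).1]; exact (W2b y).2
  have Wut0 : ∀ᵐ x, 0 ≤ W2 x * ut x := by
    filter_upwards [ut0] with x hx; exact mul_nonneg (W2b x).1 hx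
  set U : ℝ → Euc N → ℝ := fun v y => moll ut v y + v⁻¹ with hUdef
  have Us : ∀ v, 0 < v → ContDiff ℝ (⊤ : ℕ∞) (U v) := fun v hv =>
    (moll_contDiff iut.locallyIntegrable hv).add contDiff_const
  have U0 : ∀ v, 0 < v → ∀ x, 0 < U v x := fun v hv x =>
    add_pos_of_nonneg_of_pos (moll_nonneg ut0 hv x) (inv_pos.mpr hv)
  have hcv : ∀ v, 0 < v → KCtx S K Φ (U v) G p a b A B := fun v hv => hc _ (Us v hv) (U0 v hv)
  have g0 : ∀ x, 0 ≤ G (‖x‖ ^ 2) * Φ x := fun x => mul_nonneg (c1.G0 _) (c1.Φ0 _)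
  have gK : ∀ x, x ∉ annK K a b → G (‖x‖ ^ 2) * Φ x = 0 := fun x hx =>
    image_eq_zero_of_notMem_tsupport (f := fun x => G (‖x‖ ^ 2) * Φ x) fun h => hx (c1.gΦ.2 h)
  obtain ⟨Mg, hMg⟩ : ∃ C, ∀ x, ‖G (‖x‖ ^ 2) * Φ x‖ ≤ C :=
    (c1.hc c1.gΦ.2).exists_bound_of_continuous c1.gΦ.1.continuous
  have xi_eq : ∀ v x, kxi (U v) G p Φ x =
    (kh p Φ x * (U v x + kh p Φ x)⁻¹) * (kh p Φ x * (U v x + kh p Φ x)⁻¹) * (G (‖x‖ ^ 2) * Φ x) :=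
    fun v x => rfl
  have xi_b : ∀ v, 0 < v → ∀ x, |kxi (U v) G p Φ x| ≤ G (‖x‖ ^ 2) * Φ x := by
    intro v hv x
    obtain ⟨-, -, -, h4, h5⟩ := kw_le (U0 v hv x).le (c1.h0 x)
    rw [abs_of_nonneg ((hcv v hv).xi0 x), xi_eq]
    calc _ ≤ 1 * 1 * (G (‖x‖ ^ 2) * Φ x) := by gcongr; exact g0 x
      _ = _ := by ring
  set D := Real.sqrt ((Jr N (fun t => χ t ^ 2 / t) * (Es V Φ - lam1 S V * sm (fun x => Φ x ^ 2))) *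
      (Jr N (KCtx.cc1 G p (lam1 S V)) * sm (fun x => Φ x ^ 2) + Jr N (KCtx.cc2 G p) * sm (qg Φ))) with hD
  -- limits
  have lim1 : ∀ᵐ x, Tendsto (fun v => moll ut v x) atTop (𝓝 (ut x)) := moll_ae_tendsto iut.locallyIntegrable
  have lim2 : ∀ᵐ x, Tendsto (fun v => moll (fun y => W2 y * ut y) v x) atTop (𝓝 (W2 x * ut x)) :=
    moll_ae_tendsto iW.locallyIntegrable
  have limU : ∀ᵐ x, x ∈ annK K a b → Tendsto (fun v => U v x) atTop (𝓝 (u x)) := by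
    filter_upwards [lim1] with x hx hxK
    have h1 : ut x = u x := Set.indicator_of_mem (hball x hxK (mem_closedBall_self hρ.le)) _
    have := hx.add tendsto_inv_atTop_zero
    rw [add_zero, h1] at this
    exact this
  -- upper bound of mollification
  have mle : ∀ᵐ x, x ∈ annK K a b → ∀ v, 0 < v → 2 * v⁻¹ ≤ ρ → moll ut v x ≤ u x := by
    filter_upwards [moll_le_ae hN hO hu] with x hx hxK v hv hvρ
    have hvi : 0 < v⁻¹ := inv_pos.mpr hv
    have h1 : moll ut v x = moll u v x := moll_congr (ρ := ρ) hv (by linarith)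
      fun y hy => Set.indicator_of_mem (hball x hxK hy) _
    rw [h1]
    exact hx (hK1Ω hxK) v hv ((closedBall_subset_closedBall hvρ).trans ((hball x hxK).trans hρΩ))
  have ev : ∀ᶠ v : ℝ in atTop, 0 < v ∧ 2 * v⁻¹ ≤ ρ ∧ v⁻¹ ≤ 1 := by
    filter_upwards [eventually_gt_atTop 0, eventually_ge_atTop (2 / ρ), eventually_ge_atTop 1] with v h1 h2 h3
    refine ⟨h1, ?_, inv_le_one_of_one_le₀ h3⟩
    rw [div_le_iff₀ hρ] at h2
    rw [← div_eq_mul_inv, div_le_iff₀ h1]; linarith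
  set e : ℝ → Euc N → ℝ := fun v x =>
    (-moll (fun y => W2 y * ut y) v x + W x * U v x) * kxi (U v) G p Φ x with he
  set F : ℝ → Euc N → ℝ := fun v x => Φ x * kw (U v) p Φ x * KCtx.NN N G lm (‖x‖ ^ 2) with hF
  -- integrability of e
  have iWU : ∀ v, 0 < v → Integrable (fun x => W x * U v x * kxi (U v) G p Φ x) := by
    intro v hv
    have c := hcv v hv
    have h := integrable_off_zero_mul hV (integrable_Vfk hS.2.1 (c1.psi_test hχ ha' hb' hχa) c.zt_test)
    refine h.congr (Eventually.of_forall fun x => ?_)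
    simp only [hW]
    by_cases hx : x ∈ annK K a b
    · obtain ⟨h1, h2⟩ := KCtx.mem_annK_norm c.hKS hS.2.1 a0.le hx
      rw [hχ1 _ h1 h2, one_mul, KCtx.ztΦ]; ring
    · have h1 : kzt (U v) G p Φ x = 0 := image_eq_zero_of_notMem_tsupport fun h => hx (c.zt_supp h)
      have h2 : kxi (U v) G p Φ x = 0 := image_eq_zero_of_notMem_tsupport fun h => hx (c.xi_supp h)
      rw [h1, h2]; simp
  have imxi : ∀ v, 0 < v → ∀ {k : Euc N → ℝ}, Continuous k → Integrable (fun x => k x * kxi (U v) G p Φ x) := by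
    intro v hv k hk
    exact (hk.mul (hcv v hv).xi_smooth.continuous).integrable_of_hasCompactSupport
      ((hcv v hv).hc (hcv v hv).xi_supp).mul_left
  have main : ∀ᶠ v : ℝ in atTop, -D ≤ (∫ x, e v x) + ∫ x, F v x := by
    filter_upwards [ev] with v hv
    obtain ⟨hv, hvρ, -⟩ := hv
    have hvi : 0 < v⁻¹ := inv_pos.mpr hv
    have c := hcv v hv
    have hlap : ∀ x ∈ annK K a b, lap (U v) x ≤ -moll (fun y => W2 y * ut y) v x := fun x hx =>
      reg_lap hsup iut.locallyIntegrable hv (by linarith) (hball x hx) hρΩ _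
    have hlap0 : ∀ x ∈ annK K a b, lap (U v) x ≤ 0 := fun x hx =>
      (hlap x hx).trans (neg_nonpos.mpr (moll_nonneg Wut0 hv x))
    obtain ⟨-, h1⟩ := c.key_smooth hV hl hode hχ ha' hb' hχa hχ1
    have hB : BB V (lam1 S V) (fun x => χ (‖x‖ ^ 2) * Φ x) (kzt (U v) G p Φ) ≤ D := by
      apply Real.le_sqrt_of_sq_le
      refine (BB_cs hN hS hV (c.psi_test hχ ha' hb' hχa) c.zt_test).trans ?_
      rw [← c.BB_psi hN hV hχ]
      exact mul_le_mul_of_nonneg_left (c.BB_zeta hN hV hlap0)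
        (BB_nonneg hN hS hV (c.psi_test hχ ha' hb' hχa))
    have i1 : Integrable (fun x => (lap (U v) x + V x * U v x / ‖x‖ ^ 2) * kxi (U v) G p Φ x) := by
      refine ((imxi v hv (continuous_lap ((Us v hv).of_le two_le_infty))).add (iWU v hv)).congr
        (Eventually.of_forall fun x => ?_)
      simp only [hW, Pi.add_apply]; ring
    have i2 : Integrable (e v) := by
      refine ((imxi v hv (moll_contDiff iW.locallyIntegrable hv).continuous.neg).add (iWU v hv)).congr
        (Eventually.of_forall fun x => ?_)
      simp only [he, Pi.add_apply, Pi.neg_apply]; ring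
    have h2 : ∫ x, (lap (U v) x + V x * U v x / ‖x‖ ^ 2) * kxi (U v) G p Φ x ≤ ∫ x, e v x := by
      refine integral_mono i1 i2 fun x => ?_
      by_cases hx : x ∈ annK K a b
      · refine mul_le_mul_of_nonneg_right ?_ (c.xi0 x)
        have := hlap x hx
        have e2 : W x * U v x = V x * U v x / ‖x‖ ^ 2 := by simp only [hW]; ring
        rw [e2]; linarith
      · have h2 : kxi (U v) G p Φ x = 0 := image_eq_zero_of_notMem_tsupport fun h => hx (c.xi_supp h)
        simp only [he]
        rw [h2]; simp
    linarith
  have Tm : ∀ v, 0 < v → Measurable (U v) := fun v hv => (Us v hv).continuous.measurable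
  have lime : Tendsto (fun v => ∫ x, e v x) atTop (𝓝 0) := by
    have := tendsto_integral_filter_of_dominated_convergence (μ := volume) (l := (atTop : Filter ℝ))
      (F := e) (f := fun _ => (0:ℝ)) (fun x => (2 * Wb * |ut x| + Wb) * (G (‖x‖ ^ 2) * Φ x)) ?_ ?_ ?_ ?_
    · simpa using this
    · filter_upwards [ev] with v hv
      have := (moll_contDiff iW.locallyIntegrable hv.1).continuous.measurable
      have h2 := (hcv v hv.1).xi_smooth.continuous.measurable
      exact (((this.neg).add (Wm.mul (Tm v hv.1))).mul h2).aestronglyMeasurable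
    · filter_upwards [ev] with v hv
      filter_upwards [mle] with x hx
      rw [Real.norm_eq_abs]
      by_cases hxK : x ∈ annK K a b
      · have hin : x ∈ K2 := hball x hxK (mem_closedBall_self hρ.le)
        have h1 := hx hxK v hv.1 hv.2.1
        have h2 := moll_mul_le ut0 iut (fun x => (W2b x).2) iW hv.1 x
        have h3 := moll_nonneg Wut0 hv.1 x
        have h3' := moll_nonneg ut0 hv.1 x
        have h4 : ut x = u x := Set.indicator_of_mem hin _
        simp only [he]
        rw [abs_mul]
        refine mul_le_mul ?_ (xi_b v hv.1 x) (abs_nonneg _) (by positivity)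
        rw [h4, abs_of_nonneg (h3'.trans h1)]
        have h5 : Wb * moll ut v x ≤ Wb * u x := mul_le_mul_of_nonneg_left h1 hWb0
        have h6 : W x * U v x ≤ Wb * (u x + 1) :=
          mul_le_mul (hWb x hin) (add_le_add h1 hv.2.2) (U0 v hv.1 x).le hWb0
        have h7 : 0 ≤ W x * U v x := mul_nonneg (W0 x) (U0 v hv.1 x).le
        have h8 : 0 ≤ Wb * u x := mul_nonneg hWb0 (h3'.trans h1)
        rw [abs_le]; constructor <;> nlinarith
      · have h2 : kxi (U v) G p Φ x = 0 :=
          image_eq_zero_of_notMem_tsupport fun h => hxK ((hcv v hv.1).xi_supp h)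
        simp only [he]
        rw [h2, gK x hxK]; simp
    · have h1 : Integrable (fun x => 2 * Wb * |ut x| * (G (‖x‖ ^ 2) * Φ x)) :=
        ((iut.abs).const_mul (2 * Wb)).mul_bdd (c := Mg) c1.gΦ.1.continuous.aestronglyMeasurable
          (Eventually.of_forall hMg)
      have h2 : Integrable (fun x => Wb * (G (‖x‖ ^ 2) * Φ x)) :=
        (c1.gΦ.1.continuous.integrable_of_hasCompactSupport (c1.hc c1.gΦ.2)).const_mul Wb
      refine (h1.add h2).congr (Eventually.of_forall fun x => ?_)
      simp only [Pi.add_apply]; ring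
    · filter_upwards [lim2, limU] with x h2 hU
      by_cases hxK : x ∈ annK K a b
      · have hin : x ∈ K2 := hball x hxK (mem_closedBall_self hρ.le)
        have hU := hU hxK
        have e1 : W2 x * ut x = W x * u x := by
          rw [hW2, hut, Set.indicator_of_mem hin, Set.indicator_of_mem hin]
        rw [e1] at h2
        have h3 : Tendsto (fun v => -moll (fun y => W2 y * ut y) v x + W x * U v x) atTop (𝓝 0) := by
          have := h2.neg.add (hU.const_mul (W x))
          rwa [neg_add_cancel] at this
        refine squeeze_zero_norm' (a := fun v => |-moll (fun y => W2 y * ut y) v x + W x * U v x| *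
          (G (‖x‖ ^ 2) * Φ x)) ?_ ?_
        · filter_upwards [ev] with v hv
          simp only [he]
          rw [Real.norm_eq_abs, abs_mul]
          exact mul_le_mul_of_nonneg_left (xi_b v hv.1 x) (abs_nonneg _)
        · have := h3.abs.mul_const (G (‖x‖ ^ 2) * Φ x)
          simpa using this
      · refine tendsto_const_nhds.congr' ?_
        filter_upwards [ev] with v hv
        have h2 : kxi (U v) G p Φ x = 0 :=
          image_eq_zero_of_notMem_tsupport fun h => hxK ((hcv v hv.1).xi_supp h)
        simp only [he]
        rw [h2]; simp
  have NK : ∀ x, x ∉ annK K a b → Φ x * KCtx.NN N G lm (‖x‖ ^ 2) = 0 := by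
    intro x hx
    by_contra hne
    have h1 := left_ne_zero_of_mul hne
    have h2 := KCtx.NN_supp c1.Ga _ (right_ne_zero_of_mul hne)
    exact hx ⟨c1.hK0 x h1, by have := norm_nonneg x; nlinarith [c1.a0], by
      have := norm_nonneg x
      exact abs_le_of_sq_le_sq' (by linarith [h2.2]) c1.b0.le |>.2⟩
  have iB : Integrable (fun x => Φ x * kh p Φ x * KCtx.NN N G lm (‖x‖ ^ 2)) := by
    have := integrable_radial_hom (N := N) (c := KCtx.NN N G lm) (KCtx.continuousOn_NN c1.Gs) c1.a0 c1.b0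
      (KCtx.NN_supp c1.Ga) (Z := fun x => Φ x * kh p Φ x)
      ((HomTest.continuousOn c1.hΦ).mul c1.h_smooth.continuous.continuousOn)
    refine this.congr (Eventually.of_forall fun x => ?_)
    simp only; ring
  have limF0 : ∀ᵐ x, Tendsto (fun v => F v x) atTop (𝓝 (Φ x * kw u p Φ x * KCtx.NN N G lm (‖x‖ ^ 2))) := by
    filter_upwards [limU, hu.2.1] with x hU hu0
    by_cases hxK : x ∈ annK K a b
    · exact ((kw_tendsto (hu0 (hK1Ω hxK)) (c1.h0 x) (hU hxK)).const_mul (Φ x)).mul_const _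
    · have := NK x hxK
      have e1 : ∀ w : ℝ, Φ x * w * KCtx.NN N G lm (‖x‖ ^ 2) = 0 := fun w => by
        calc _ = w * (Φ x * KCtx.NN N G lm (‖x‖ ^ 2)) := by ring
          _ = 0 := by rw [this, mul_zero]
      simp only [hF, e1]
      exact tendsto_const_nhds
  have Fm : ∀ᶠ v : ℝ in atTop, AEStronglyMeasurable (F v) volume := by
    filter_upwards [ev] with v hv
    exact ((hcv v hv.1).key_smooth hV hl hode hχ ha' hb' hχa hχ1).1.aestronglyMeasurable
  have Fb : ∀ᶠ v : ℝ in atTop, ∀ x, ‖F v x‖ ≤ |Φ x * kh p Φ x * KCtx.NN N G lm (‖x‖ ^ 2)| := by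
    filter_upwards [ev] with v hv
    intro x
    obtain ⟨h1, h2, -⟩ := kw_le (U0 v hv.1 x).le (c1.h0 x)
    simp only [hF]
    rw [Real.norm_eq_abs, abs_mul, abs_mul, abs_mul, abs_mul]
    have h3 : |kw (U v) p Φ x| ≤ |kh p Φ x| := by
      rw [abs_of_nonneg (c1.h0 x), abs_of_nonneg]
      · exact h2
      · exact h1
    gcongr
  have limF := tendsto_integral_filter_of_dominated_convergence (μ := volume) (l := (atTop : Filter ℝ))
      (F := F) (f := fun x => Φ x * kw u p Φ x * KCtx.NN N G lm (‖x‖ ^ 2)) _ Fm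
      (Fb.mono fun v h => Eventually.of_forall h) iB.abs limF0
  constructor
  · refine iB.abs.mono' ?_ ?_
    · obtain ⟨v0, hv0⟩ := eventually_atTop.mp Fm
      have h1 : Tendsto (fun n : ℕ => v0 + (n : ℝ)) atTop atTop :=
        tendsto_atTop_add_const_left _ _ tendsto_natCast_atTop_atTop
      refine aestronglyMeasurable_of_tendsto_ae (atTop : Filter ℕ) (f := fun n => F (v0 + (n:ℝ)))
        (fun n => hv0 _ (by simp)) ?_
      filter_upwards [limF0] with x hx
      exact hx.comp h1
    · filter_upwards [limF0] with x hx
      exact le_of_tendsto hx.norm (Fb.mono fun v h => h x)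
  · have := lime.add limF
    rw [zero_add] at this
    exact ge_of_tendsto this main

end

set_option linter.unusedSimpArgs false
noncomputable section

/-- smooth step from 0 (for `τ ≤ 1`) to 1 (for `τ ≥ 2`) -/
def MM (τ : ℝ) : ℝ := Real.smoothTransition (τ - 1)

theorem MM_smooth : ContDiff ℝ (⊤ : ℕ∞) MM :=
  Real.smoothTransition.contDiff.comp (contDiff_id.sub contDiff_const)
theorem MM_mono : Monotone MM := fun a b h => Real.smoothTransition.monotone (by linarith)
theorem MM_zero {τ : ℝ} (h : τ ≤ 1) : MM τ = 0 := Real.smoothTransition.zero_of_nonpos (by linarith)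
theorem MM_one {τ : ℝ} (h : 2 ≤ τ) : MM τ = 1 := Real.smoothTransition.one_of_one_le (by linarith)
theorem MM_deriv_nonneg (τ : ℝ) : 0 ≤ deriv MM τ := MM_mono.deriv_nonneg
theorem MM_deriv_smooth : ContDiff ℝ (⊤ : ℕ∞) (deriv MM) := smooth_deriv MM_smooth
theorem MM_deriv_supp {τ : ℝ} (h : deriv MM τ ≠ 0) : 1 ≤ τ ∧ τ ≤ 2 := by
  constructor
  · by_contra hlt
    push Not at hlt
    apply h
    have : MM =ᶠ[𝓝 τ] fun _ => 0 := by
      filter_upwards [gt_mem_nhds hlt] with s hs; exact MM_zero hs.le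
    rw [this.deriv_eq]; simp
  · by_contra hlt
    push Not at hlt
    apply h
    have : MM =ᶠ[𝓝 τ] fun _ => 1 := by
      filter_upwards [lt_mem_nhds hlt] with s hs; exact MM_one hs.le
    rw [this.deriv_eq]; simp

theorem smooth_cut {F : ℝ → ℝ} (hF : ContDiff ℝ (⊤ : ℕ∞) F) {a : ℝ} (ha : 0 < a)
    (h0 : ∀ t, t ≤ a → F t = 0) (q : ℝ) : ContDiff ℝ (⊤ : ℕ∞) (fun t => t ^ q * F t) := by
  rw [contDiff_iff_contDiffAt]
  intro t
  rcases lt_or_ge t a with h | h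
  · have : (fun t => t ^ q * F t) =ᶠ[𝓝 t] fun _ => 0 := by
      filter_upwards [gt_mem_nhds h] with s hs; rw [h0 s hs.le, mul_zero]
    exact contDiffAt_const.congr_of_eventuallyEq this
  · exact (contDiffAt_id.rpow_const_of_ne (by simp; linarith)).mul hF.contDiffAt

theorem smooth_prim {g : ℝ → ℝ} (hg : ContDiff ℝ (⊤ : ℕ∞) g) :
    (∀ t, HasDerivAt (fun t => ∫ s in (0:ℝ)..t, g s) (g t) t) ∧
    ContDiff ℝ (⊤ : ℕ∞) (fun t => ∫ s in (0:ℝ)..t, g s) := by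
  have h1 : ∀ t, HasDerivAt (fun t => ∫ s in (0:ℝ)..t, g s) (g t) t := fun t =>
    (intervalIntegral.integral_hasDerivAt_right (hg.continuous.intervalIntegrable _ _)
      (hg.continuous.stronglyMeasurableAtFilter _ _) hg.continuous.continuousAt)
  refine ⟨h1, ?_⟩
  have : ContDiff ℝ ((⊤ : ℕ∞) : WithTop ℕ∞) (fun t => ∫ s in (0:ℝ)..t, g s) := by
    rw [contDiff_infty_iff_deriv]
    refine ⟨fun t => (h1 t).differentiableAt, ?_⟩
    have : deriv (fun t => ∫ s in (0:ℝ)..t, g s) = g := funext fun t => (h1 t).deriv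
    rw [this]; exact hg
  exact this

/-- the function `n` -/
def nn (κ ρ ℓ t : ℝ) : ℝ := MM (ℓ * t / ρ) - (1 + ℓ ^ (-κ)) * MM (t / ρ) + ℓ ^ (-κ) * MM (t / (ℓ * ρ))

def nn' (κ ρ ℓ t : ℝ) : ℝ := deriv MM (t / (ρ / ℓ)) / (ρ / ℓ) - (1 + ℓ ^ (-κ)) * (deriv MM (t / ρ) / ρ)
  + ℓ ^ (-κ) * (deriv MM (t / (ρ * ℓ)) / (ρ * ℓ))

theorem nn_hasDerivAt {κ ρ ℓ : ℝ} (hρ : 0 < ρ) (hℓ : 0 < ℓ) (t : ℝ) :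
    HasDerivAt (nn κ ρ ℓ) (nn' κ ρ ℓ t) t := by
  have hM : ∀ c : ℝ, 0 < c → HasDerivAt (fun t => MM (t / c)) (deriv MM (t / c) / c) t := by
    intro c hc
    have h1 : HasDerivAt MM (deriv MM (t / c)) (t / c) :=
      ((MM_smooth.differentiable infty_ne_zero) _).hasDerivAt
    have h2 := h1.comp t ((hasDerivAt_id t).div_const c)
    exact h2.congr_deriv (by ring)
  have h := ((hM (ρ / ℓ) (by positivity)).sub ((hM ρ hρ).const_mul (1 + ℓ ^ (-κ)))).add
    ((hM (ρ * ℓ) (by positivity)).const_mul (ℓ ^ (-κ)))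
  refine HasDerivAt.congr_of_eventuallyEq h (Eventually.of_forall fun s => ?_)
  simp only [nn, Pi.add_apply, Pi.sub_apply]
  rw [show s / (ρ / ℓ) = ℓ * s / ρ by field_simp, mul_comm ρ ℓ]

theorem exists_G {N : ℕ} {κ ρ ℓ : ℝ} (hρ : 0 < ρ) (hℓ : 1 ≤ ℓ) :
    ∃ G : ℝ → ℝ, ContDiff ℝ (⊤ : ℕ∞) G ∧ (∀ t, 0 ≤ G t) ∧ (∀ t, G t ≠ 0 → ρ / ℓ ≤ t ∧ t ≤ 2 * ρ * ℓ) ∧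
      ∀ t, 0 < t → KCtx.NN N G (κ ^ 2 - (((N:ℝ) - 2) / 2) ^ 2) t =
        -4 * (t ^ ((κ - ((N:ℝ) - 2) / 2) / 2) * nn' κ ρ ℓ t) := by
  have hℓ0 : 0 < ℓ := by linarith
  have hρℓ : 0 < ρ / ℓ := by positivity
  have hρℓ' : ρ / ℓ ≤ ρ := div_le_self hρ.le hℓ
  set m : ℝ → ℝ := fun s => MM (ℓ * s / ρ) - MM (s / ρ) with hm
  have ms : ContDiff ℝ (⊤ : ℕ∞) m :=
    (MM_smooth.comp ((contDiff_const.mul contDiff_id).div_const _)).sub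
      (MM_smooth.comp (contDiff_id.div_const _))
  have m0 : ∀ s, s ≤ ρ / ℓ → m s = 0 := by
    intro s hs
    have h1 : ℓ * s / ρ ≤ 1 := by
      rw [div_le_one hρ]; rw [le_div_iff₀ hℓ0] at hs; linarith
    have h2 : s / ρ ≤ 1 := by rw [div_le_one hρ]; linarith
    simp only [hm]; rw [MM_zero h1, MM_zero h2, sub_zero]
  have m1 : ∀ s, 2 * ρ ≤ s → m s = 0 := by
    intro s hs
    have h2 : 2 ≤ s / ρ := by rw [le_div_iff₀ hρ]; linarith
    have h1 : 2 ≤ ℓ * s / ρ := by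
      rw [le_div_iff₀ hρ]; nlinarith
    simp only [hm]; rw [MM_one h1, MM_one h2, sub_self]
  have mp : ∀ s, 0 ≤ s → 0 ≤ m s := by
    intro s hs
    have : s / ρ ≤ ℓ * s / ρ := by gcongr; nlinarith
    have := MM_mono this
    simp only [hm]; linarith
  set g : ℝ → ℝ := fun s => s ^ (κ - 1) * m s with hg
  have gs : ContDiff ℝ (⊤ : ℕ∞) g := smooth_cut ms hρℓ m0 _
  have g0 : ∀ s, s ≤ ρ / ℓ → g s = 0 := fun s hs => by simp only [hg]; rw [m0 s hs, mul_zero]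
  have g1 : ∀ s, 2 * ρ ≤ s → g s = 0 := fun s hs => by simp only [hg]; rw [m1 s hs, mul_zero]
  have gp : ∀ s, 0 ≤ g s := by
    intro s
    rcases le_total s 0 with h | h
    · rw [g0 s (by linarith)]
    · exact mul_nonneg (Real.rpow_nonneg h _) (mp s h)
  obtain ⟨ed, es⟩ := smooth_prim gs
  set e : ℝ → ℝ := fun t => ∫ s in (0:ℝ)..t, g s with he
  have e_mono : Monotone e := monotone_of_deriv_nonneg (fun t => (ed t).differentiableAt)
    (fun t => by rw [(ed t).deriv]; exact gp t)
  have e_sub : ∀ s t, e t - e s = ∫ x in s..t, g x := fun s t =>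
    intervalIntegral.integral_interval_sub_left (gs.continuous.intervalIntegrable _ _)
      (gs.continuous.intervalIntegrable _ _)
  set Q : ℝ → ℝ := fun t => e t - e (t / ℓ) with hQ
  have Qs : ContDiff ℝ (⊤ : ℕ∞) Q := es.sub (es.comp (contDiff_id.div_const _))
  have zero_int : ∀ s t, (∀ x ∈ Set.uIoc s t, g x = 0) → ∫ x in s..t, g x = 0 := by
    intro s t h
    apply intervalIntegral.integral_zero_ae
    filter_upwards with x hx; exact h x hx
  have Q0 : ∀ t, t ≤ ρ / ℓ → Q t = 0 := by
    intro t ht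
    simp only [hQ]; rw [e_sub]
    apply zero_int
    intro x hx
    apply g0
    have h2 : t / ℓ ≤ ρ / ℓ := by gcongr; linarith
    exact (Set.mem_uIoc.mp hx).elim (fun h => h.2.trans ht) (fun h => h.2.trans h2)
  have Q1 : ∀ t, 2 * ρ * ℓ ≤ t → Q t = 0 := by
    intro t ht
    simp only [hQ]; rw [e_sub]
    apply zero_int
    intro x hx
    have h1 : 2 * ρ ≤ t / ℓ := by rw [le_div_iff₀ hℓ0]; exact ht
    have h2 : t / ℓ ≤ t := div_le_self (by nlinarith [mul_pos hρ hℓ0]) hℓ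
    rw [Set.uIoc_of_le h2] at hx
    exact g1 x (h1.trans hx.1.le)
  have Qp : ∀ t, 0 ≤ Q t := by
    intro t
    rcases le_total t 0 with h | h
    · rw [Q0 t (by linarith)]
    · have h2 : t / ℓ ≤ t := div_le_self h hℓ
      have := e_mono h2
      simp only [hQ]; linarith
  have Qd : ∀ t, 0 < t → HasDerivAt Q (t ^ (κ - 1) * nn κ ρ ℓ t) t := by
    intro t ht
    have h := (ed t).sub ((ed (t / ℓ)).comp t ((hasDerivAt_id t).div_const ℓ))
    refine h.congr_deriv ?_
    simp only [hg, hm, nn]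
    rw [Real.div_rpow ht.le hℓ0.le, Real.rpow_sub_one hℓ0.ne', Real.rpow_neg hℓ0.le,
      show ℓ * (t / ℓ) / ρ = t / ρ by field_simp, show t / ℓ / ρ = t / (ℓ * ρ) by field_simp]
    have : ℓ ^ κ ≠ 0 := (Real.rpow_pos_of_pos hℓ0 κ).ne'
    field_simp
    ring
  set β : ℝ := -(κ + ((N:ℝ) - 2) / 2) / 2 with hβ
  set G : ℝ → ℝ := fun t => t ^ β * Q t with hG
  have G1 : ∀ t, 0 < t → HasDerivAt G (β * t ^ (β - 1) * Q t + t ^ (β + κ - 1) * nn κ ρ ℓ t) t := by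
    intro t ht
    have h := (Real.hasDerivAt_rpow_const (p := β) (Or.inl ht.ne')).mul (Qd t ht)
    refine h.congr_deriv ?_
    rw [show β + κ - 1 = β + (κ - 1) by ring, Real.rpow_add ht]; ring
  refine ⟨G, smooth_cut Qs hρℓ Q0 β, ?_, ?_, ?_⟩
  · intro t
    rcases le_total t 0 with h | h
    · simp only [hG]; rw [Q0 t (by linarith), mul_zero]
    · exact mul_nonneg (Real.rpow_nonneg h _) (Qp t)
  · intro t ht
    constructor
    · by_contra hlt
      exact ht (by simp only [hG]; rw [Q0 t (by linarith), mul_zero])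
    · by_contra hlt
      exact ht (by simp only [hG]; rw [Q1 t (by linarith), mul_zero])
  · intro t ht
    have d1 : deriv G =ᶠ[𝓝 t] fun t => β * t ^ (β - 1) * Q t + t ^ (β + κ - 1) * nn κ ρ ℓ t := by
      filter_upwards [lt_mem_nhds ht] with s hs; exact (G1 s hs).deriv
    have d2 : HasDerivAt (fun t => β * t ^ (β - 1) * Q t + t ^ (β + κ - 1) * nn κ ρ ℓ t)
        ((β * ((β - 1) * t ^ (β - 1 - 1))) * Q t + (β * t ^ (β - 1)) * (t ^ (κ - 1) * nn κ ρ ℓ t) +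
          (((β + κ - 1) * t ^ (β + κ - 1 - 1)) * nn κ ρ ℓ t + t ^ (β + κ - 1) * nn' κ ρ ℓ t)) t :=
      (((Real.hasDerivAt_rpow_const (p := β - 1) (Or.inl ht.ne')).const_mul β).mul (Qd t ht)).add
        ((Real.hasDerivAt_rpow_const (p := β + κ - 1) (Or.inl ht.ne')).mul (nn_hasDerivAt hρ hℓ0 t))
    unfold KCtx.NN
    rw [d1.deriv_eq, d2.deriv, (G1 t ht).deriv]
    have hk : (κ - ((N:ℝ) - 2) / 2) / 2 = β + κ := by rw [hβ]; ring
    rw [hk]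
    simp only [hG]
    simp only [Real.rpow_sub_one ht.ne', Real.rpow_add ht]
    have hNβ : (N : ℝ) = 2 - 2 * κ - 4 * β := by rw [hβ]; ring
    generalize nn κ ρ ℓ t = n1
    generalize nn' κ ρ ℓ t = n2
    generalize t ^ β = b1
    generalize t ^ κ = k1
    generalize Q t = q
    rw [hNβ]
    field_simp
    ring

end

set_option linter.unusedSimpArgs false
noncomputable section

def pw (δ α t : ℝ) : ℝ := δ * t ^ (α / 2)

/-- radial weight -/
def mw (α ρ t : ℝ) : ℝ := t ^ (α / 2) * (deriv MM (t / ρ) / ρ)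

def XI {N : ℕ} (u : Euc N → ℝ) (δ α : ℝ) (Φ : Euc N → ℝ) (ρ : ℝ) (x : Euc N) : ℝ :=
  Φ x * kw u (pw δ α) Φ x * mw α ρ (‖x‖ ^ 2)

theorem mw_nonneg {α ρ t : ℝ} (hρ : 0 < ρ) (ht : 0 ≤ t) : 0 ≤ mw α ρ t :=
  mul_nonneg (Real.rpow_nonneg ht _) (div_nonneg (MM_deriv_nonneg _) hρ.le)

theorem mw_supp {α ρ t : ℝ} (hρ : 0 < ρ) (h : mw α ρ t ≠ 0) : ρ ≤ t ∧ t ≤ 2 * ρ := by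
  have h1 : deriv MM (t / ρ) ≠ 0 := fun h0 => h (by simp [mw, h0])
  have h2 := MM_deriv_supp h1
  rw [le_div_iff₀ hρ, div_le_iff₀ hρ] at h2
  exact ⟨by linarith, h2.2⟩

theorem mw_cont {α ρ : ℝ} : ContinuousOn (mw α ρ) (Set.Ioi 0) := by
  refine ContinuousOn.mul (continuousOn_id.rpow_const fun x hx => Or.inl (ne_of_gt hx)) ?_
  exact ((MM_deriv_smooth.continuous.comp (continuous_id.div_const _)).div_const _).continuousOn

theorem pw_cont {δ α : ℝ} : ContinuousOn (pw δ α) (Set.Ioi 0) :=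
  continuousOn_const.mul (continuousOn_id.rpow_const fun x hx => Or.inl (ne_of_gt hx))

theorem mem_coneLike_of {N : ℕ} {S : Set (Euc N)} {Φ : Euc N → ℝ}
    (hΦ : HomTest S Φ) {r : ℝ} (hr : 0 < r) {x : Euc N} (h1 : Φ x ≠ 0) (h2 : ‖x‖ ^ 2 < r ^ 2) : x ∈ coneLike S r := by
  obtain ⟨K, -, hKS, hK⟩ := hΦ.2.2
  exact ⟨sphCone_mono hKS (hK x h1), by
    rw [mem_ball_zero_iff]; exact lt_of_pow_lt_pow_left₀ 2 hr.le h2⟩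

theorem cone_ne_zero {N : ℕ} {S : Set (Euc N)} (hS : S ⊆ sphere (0 : Euc N) 1) {x : Euc N}
    (h : x ∈ sphCone S) : x ≠ 0 := by
  rintro rfl
  obtain ⟨s, hs, σ, hσ, h⟩ := h
  have hn : ‖σ‖ = 1 := by simpa using hS hσ
  have h2 := congrArg norm h
  rw [norm_smul, hn, norm_zero, mul_one] at h2
  exact hs.ne' (by simpa using h2.symm)

theorem XI_bound {N : ℕ} {S : Set (Euc N)} {r : ℝ} (hr : 0 < r)
    {u : Euc N → ℝ} (hu : SH (coneLike S r) u) {Φ : Euc N → ℝ} (hΦ : HomTest S Φ) (Φ0 : ∀ x, 0 ≤ Φ x)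
    {δ α ρ : ℝ} (hδ : 0 ≤ δ) (hρ : 0 < ρ) (hρr : 2 * ρ < r ^ 2) :
    ∀ᵐ x, 0 ≤ XI u δ α Φ ρ x ∧
      XI u δ α Φ ρ x ≤ pw δ α (‖x‖ ^ 2) * mw α ρ (‖x‖ ^ 2) * Φ x ^ 2 ∧
      XI u δ α Φ ρ x ≤ Φ x * u x * mw α ρ (‖x‖ ^ 2) ∧
      (pw δ α (‖x‖ ^ 2) * Φ x ≤ u x →
        1 / 2 * (pw δ α (‖x‖ ^ 2) * mw α ρ (‖x‖ ^ 2) * Φ x ^ 2) ≤ XI u δ α Φ ρ x) := by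
  filter_upwards [hu.2.1] with x hx
  by_cases h : Φ x * mw α ρ (‖x‖ ^ 2) = 0
  · have e1 : XI u δ α Φ ρ x = 0 := by
      unfold XI
      calc _ = kw u (pw δ α) Φ x * (Φ x * mw α ρ (‖x‖ ^ 2)) := by ring
        _ = 0 := by rw [h, mul_zero]
    have e2 : pw δ α (‖x‖ ^ 2) * mw α ρ (‖x‖ ^ 2) * Φ x ^ 2 = 0 := by
      calc _ = pw δ α (‖x‖ ^ 2) * Φ x * (Φ x * mw α ρ (‖x‖ ^ 2)) := by ring
        _ = 0 := by rw [h, mul_zero]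
    have e3 : Φ x * u x * mw α ρ (‖x‖ ^ 2) = 0 := by
      calc _ = u x * (Φ x * mw α ρ (‖x‖ ^ 2)) := by ring
        _ = 0 := by rw [h, mul_zero]
    rw [e1, e2, e3]; simp
  · have hΦx := left_ne_zero_of_mul h
    have hm := mw_supp hρ (right_ne_zero_of_mul h)
    have hu0 := hx (mem_coneLike_of hΦ hr hΦx (by linarith))
    have m0 : 0 ≤ mw α ρ (‖x‖ ^ 2) := mw_nonneg hρ (by positivity)
    have p0 : 0 ≤ pw δ α (‖x‖ ^ 2) := mul_nonneg hδ (Real.rpow_nonneg (by positivity) _)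
    have h0 : 0 ≤ kh (pw δ α) Φ x := mul_nonneg p0 (Φ0 x)
    obtain ⟨k1, k2, k3, -, -⟩ := kw_le hu0 h0
    have e : kw u (pw δ α) Φ x = u x * (kh (pw δ α) Φ x * (u x + kh (pw δ α) Φ x)⁻¹) := rfl
    rw [← e] at k1 k2 k3
    have hP := Φ0 x
    unfold XI
    refine ⟨by positivity, ?_, ?_, ?_⟩
    · calc _ ≤ Φ x * kh (pw δ α) Φ x * mw α ρ (‖x‖ ^ 2) := by gcongr
        _ = _ := by unfold kh; ring
    · gcongr
    · intro hle
      have k4 : 1 / 2 * kh (pw δ α) Φ x ≤ kw u (pw δ α) Φ x := by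
        have hle' : kh (pw δ α) Φ x ≤ u x := hle
        rcases hu0.eq_or_lt with hu1 | hu1
        · have : kh (pw δ α) Φ x = 0 := le_antisymm (by rw [hu1]; exact hle') h0
          rw [this]; simpa using k1
        · rw [e]
          have hs : 0 < u x + kh (pw δ α) Φ x := by linarith
          rw [← div_eq_mul_inv, mul_div_assoc', le_div_iff₀ hs]
          nlinarith
      calc _ = Φ x * (1 / 2 * kh (pw δ α) Φ x) * mw α ρ (‖x‖ ^ 2) := by unfold kh; ring
        _ ≤ _ := by gcongr

theorem pm_integrable {N : ℕ} {Z : Euc N → ℝ} (hZ : ContinuousOn Z {0}ᶜ)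
    {δ α ρ : ℝ} (hρ : 0 < ρ) :
    Integrable (fun x => pw δ α (‖x‖ ^ 2) * mw α ρ (‖x‖ ^ 2) * Z x) := by
  refine integrable_radial_hom (N := N) (c := fun t => pw δ α t * mw α ρ t) (pw_cont.mul mw_cont)
    (a := √ρ) (b := √(2 * ρ)) (by positivity) (by positivity) ?_ hZ
  intro t ht
  rw [Real.sq_sqrt hρ.le, Real.sq_sqrt (by positivity)]
  exact mw_supp hρ (right_ne_zero_of_mul ht)

theorem XI_integrable {N : ℕ} {S : Set (Euc N)} (hS : IsSphereDomain N S) {r : ℝ} (hr : 0 < r)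
    {u : Euc N → ℝ} (hu : SH (coneLike S r) u) {Φ : Euc N → ℝ} (hΦ : HomTest S Φ) (Φ0 : ∀ x, 0 ≤ Φ x)
    {δ α ρ : ℝ} (hδ : 0 ≤ δ) (hρ : 0 < ρ) (hρr : 2 * ρ < r ^ 2) : Integrable (XI u δ α Φ ρ) := by
  refine (pm_integrable (δ := δ) (α := α) (Z := fun x => Φ x ^ 2) (hΦ.continuousOn.pow 2) hρ).mono' ?_ ?_
  · have hO := isOpen_coneLike hS r
    have e : XI u δ α Φ ρ = (coneLike S r).indicator (XI u δ α Φ ρ) := by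
      ext x
      by_cases hx : x ∈ coneLike S r
      · rw [Set.indicator_of_mem hx]
      · rw [Set.indicator_of_notMem hx]
        by_contra hne
        have h1 := right_ne_zero_of_mul hne
        have h2 := left_ne_zero_of_mul (left_ne_zero_of_mul hne)
        exact hx (mem_coneLike_of hΦ hr h2 (by linarith [(mw_supp hρ h1).2]))
    rw [e, aestronglyMeasurable_indicator_iff hO.measurableSet]
    have hsub : coneLike S r ⊆ {0}ᶜ := fun x hx => cone_ne_zero hS.2.1 hx.1
    have mu : AEMeasurable u (volume.restrict (coneLike S r)) := hu.1.aestronglyMeasurable.aemeasurable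
    have mΦ : AEMeasurable Φ (volume.restrict (coneLike S r)) :=
      ((hΦ.continuousOn.mono hsub).aestronglyMeasurable hO.measurableSet).aemeasurable
    have hn : Set.MapsTo (fun x : Euc N => ‖x‖ ^ 2) (coneLike S r) (Set.Ioi 0) := fun x hx => by
      have := hsub hx
      have : x ≠ 0 := this
      simp only [Set.mem_Ioi]; positivity
    have mp : AEMeasurable (fun x : Euc N => pw δ α (‖x‖ ^ 2)) (volume.restrict (coneLike S r)) :=
      ((pw_cont.comp (by fun_prop) hn).aestronglyMeasurable hO.measurableSet).aemeasurable
    have mm : AEMeasurable (fun x : Euc N => mw α ρ (‖x‖ ^ 2)) (volume.restrict (coneLike S r)) :=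
      ((mw_cont.comp (by fun_prop) hn).aestronglyMeasurable hO.measurableSet).aemeasurable
    have mh : AEMeasurable (kh (pw δ α) Φ) (volume.restrict (coneLike S r)) := mp.mul mΦ
    exact ((mΦ.mul (mu.mul (mh.mul (mu.add mh).inv))).mul mm).aestronglyMeasurable
  · filter_upwards [XI_bound (α := α) hr hu hΦ Φ0 hδ hρ hρr] with x hx
    rw [Real.norm_eq_abs, abs_of_nonneg hx.1]; exact hx.2.1

set_option maxHeartbeats 1000000 in
theorem step {N : ℕ} (hN : 3 ≤ N) {S : Set (Euc N)} (hS : IsSphereDomain N S) {r : ℝ} (hr : 0 < r)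
    {u V : Euc N → ℝ} (hu : SH (coneLike S r) u) {Vm : ℝ} (hV : IsPot V Vm)
    (hsup : ∀ φ : Euc N → ℝ, IsTestFun (coneLike S r) φ → (∀ x, 0 ≤ φ x) →
      ∫ x, u x * lap φ x ≤ -∫ x, V x / ‖x‖ ^ 2 * u x * φ x)
    {κ : ℝ} (hl : lam1 S V ≤ κ ^ 2 - (((N:ℝ) - 2) / 2) ^ 2)
    {δ ρ ℓ : ℝ} (hδ : 0 ≤ δ) (hρ : 0 < ρ) (hℓ : 1 ≤ ℓ) (hρr : 2 * ρ * ℓ < r ^ 2) :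
    ∃ C : ℝ, 0 ≤ C ∧ ∀ Φ, HomTest S Φ → (∀ x, 0 ≤ Φ x) → sm (fun x => Φ x ^ 2) = 1 →
      ∀ ε : ℝ, 0 ≤ ε → ε ≤ 1 → Es V Φ ≤ lam1 S V + ε →
      ℓ ^ (-κ) * (∫ x, XI u δ (κ - ((N:ℝ) - 2) / 2) Φ (ρ * ℓ) x) ≤
        (1 + ℓ ^ (-κ)) * (∫ x, XI u δ (κ - ((N:ℝ) - 2) / 2) Φ ρ x) + C * √ε := by
  have hℓ0 : 0 < ℓ := by linarith
  set α : ℝ := κ - ((N:ℝ) - 2) / 2 with hα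
  obtain ⟨G, Gs, G0, Ga, GN⟩ := exists_G (N := N) (κ := κ) hρ hℓ
  have hρℓ : 0 < ρ / ℓ := by positivity
  have hle1 : ρ / ℓ ≤ ρ := div_le_self hρ.le hℓ
  have hle2 : ρ ≤ ρ * ℓ := le_mul_of_one_le_right hρ.le hℓ
  set a := √(ρ / ℓ) with ha
  set b := √(2 * ρ * ℓ) with hb
  have a2 : a ^ 2 = ρ / ℓ := Real.sq_sqrt hρℓ.le
  have b2 : b ^ 2 = 2 * ρ * ℓ := Real.sq_sqrt (by positivity)
  obtain ⟨χ, χs, χb, χ1, χa⟩ := exists_cutoff (a := ρ / ℓ / 2) (b := 2 * ρ * ℓ + 1) (by positivity)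
    (by nlinarith)
  set A := √(ρ / ℓ / 2 / 2) with hA
  set B := √(2 * ρ * ℓ + 1 + ρ / ℓ / 2 / 2) with hB
  have A2 : A ^ 2 = ρ / ℓ / 2 / 2 := Real.sq_sqrt (by positivity)
  have B2 : B ^ 2 = 2 * ρ * ℓ + 1 + ρ / ℓ / 2 / 2 := Real.sq_sqrt (by positivity)
  set p : ℝ → ℝ := fun t => δ * (t ^ (α / 2) * χ t) with hp
  have ps : ContDiff ℝ (⊤ : ℕ∞) p := by
    refine contDiff_const.mul (smooth_cut χs (a := ρ / ℓ / 2 / 2 / 2) (by positivity) ?_ _)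
    intro t ht
    by_contra hne
    have := (χa t hne).1
    linarith
  have ppw : ∀ t, ρ / ℓ / 2 ≤ t → t ≤ 2 * ρ * ℓ + 1 → p t = pw δ α t := by
    intro t h1 h2
    simp only [hp, pw]; rw [χ1 t h1 h2, mul_one]
  have hA0 : 0 < A := by positivity
  have hB0 : 0 < B := by positivity
  have hχa : ∀ t, χ t ≠ 0 → A ^ 2 ≤ t ∧ t ≤ B ^ 2 := by
    intro t ht; rw [A2, B2]; exact χa t ht
  have hode : ∀ t, a ^ 2 ≤ t → t ≤ b ^ 2 → 2 * N * deriv p t + 4 * t * deriv (deriv p) t =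
      (κ ^ 2 - (((N:ℝ) - 2) / 2) ^ 2) * p t / t := by
    intro t h1 h2
    rw [a2] at h1; rw [b2] at h2
    have ht : 0 < t := by linarith
    have hloc : Set.Ioo (ρ / ℓ / 2) (2 * ρ * ℓ + 1) ∈ 𝓝 t := Ioo_mem_nhds (by linarith) (by linarith)
    have e1 : ∀ s ∈ Set.Ioo (ρ / ℓ / 2) (2 * ρ * ℓ + 1), HasDerivAt p (δ * (α / 2 * s ^ (α / 2 - 1))) s := by
      intro s hs
      have hs0 : 0 < s := by have := hs.1; linarith
      have h := (Real.hasDerivAt_rpow_const (p := α / 2) (Or.inl hs0.ne')).const_mul δ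
      refine h.congr_of_eventuallyEq ?_
      filter_upwards [Ioo_mem_nhds hs.1 hs.2] with y hy
      exact ppw y hy.1.le hy.2.le
    have e2 : deriv p =ᶠ[𝓝 t] fun s => δ * (α / 2 * s ^ (α / 2 - 1)) := by
      filter_upwards [hloc] with s hs; exact (e1 s hs).deriv
    have e3 : HasDerivAt (fun s : ℝ => δ * (α / 2 * s ^ (α / 2 - 1)))
        (δ * (α / 2 * ((α / 2 - 1) * t ^ (α / 2 - 1 - 1)))) t :=
      ((Real.hasDerivAt_rpow_const (p := α / 2 - 1) (Or.inl ht.ne')).const_mul (α / 2)).const_mul δ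
    rw [(e1 t (mem_of_mem_nhds hloc)).deriv, e2.deriv_eq, e3.deriv, ppw t (by linarith) (by linarith)]
    unfold pw
    simp only [Real.rpow_sub_one ht.ne']
    have hNα : (N : ℝ) = 2 * κ - 2 * α + 2 := by rw [hα]; ring
    generalize t ^ (α / 2) = y
    rw [hNα]
    field_simp
    ring
  set J1 := Jr N (fun t => χ t ^ 2 / t) with hJ1
  set J2 := Jr N (KCtx.cc1 G p (lam1 S V)) with hJ2
  set J3 := Jr N (KCtx.cc2 G p) with hJ3
  have J1p : 0 ≤ J1 := Jr_nonneg fun t ht => by positivity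
  have J2p : 0 ≤ J2 := Jr_nonneg fun t ht => by unfold KCtx.cc1; positivity
  have J3p : 0 ≤ J3 := Jr_nonneg fun t ht => by unfold KCtx.cc2; positivity
  have Vm0 : 0 ≤ Vm := (hV.2.2 0).1.trans (hV.2.2 0).2
  refine ⟨1 / 4 * √(J1 * (J2 + J3 * (|lam1 S V| + 1 + Vm))), by positivity, ?_⟩
  intro Φ hΦ Φ0 hΦ1 ε hε hε1 hE
  obtain ⟨K, hK, hKS, hK0⟩ := hΦ.2.2
  have hc : ∀ U : Euc N → ℝ, ContDiff ℝ (⊤ : ℕ∞) U → (∀ x, 0 < U x) → KCtx S K Φ U G p a b A B := by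
    intro U hU U0
    refine ⟨hS, hΦ, Φ0, hU, U0, Gs, G0, ?_, by positivity, by positivity, ps, ?_, ?_, hA0, hB0, hK, hKS, hK0⟩
    · intro t ht; rw [a2, b2]; exact Ga t ht
    · intro t
      by_cases h : χ t = 0
      · simp [hp, h]
      · have := (χa t h).1
        have ht : 0 < t := by linarith [show 0 < ρ / ℓ / 2 / 2 by positivity]
        exact mul_nonneg hδ (mul_nonneg (Real.rpow_nonneg ht.le _) (χb t).1)
    · intro t ht
      exact hχa t (right_ne_zero_of_mul (right_ne_zero_of_mul ht))
  have hbr : b < r := by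
    rw [hb]; exact (Real.sqrt_lt' hr).mpr hρr
  obtain ⟨-, hkey⟩ := key_limit hN hS hu hV hsup hbr hc hl hode χs hA0 hB0 hχa
    (fun t h1 h2 => χ1 t (by rw [a2] at h1; linarith) (by rw [b2] at h2; linarith))
  rw [hΦ1, mul_one, mul_one, ← hJ1, ← hJ2, ← hJ3] at hkey
  -- D bound
  have hsm : sm (qg Φ) ≤ |lam1 S V| + 1 + Vm := by
    have h1 := sm_VPhi_le hV hΦ
    rw [hΦ1] at h1
    have h2 : Es V Φ = sm (qg Φ) - sm (fun x => V x * Φ x ^ 2) := rfl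
    have := le_abs_self (lam1 S V)
    linarith
  have hDle : √(J1 * (Es V Φ - lam1 S V) * (J2 + J3 * sm (qg Φ))) ≤
      √(J1 * (J2 + J3 * (|lam1 S V| + 1 + Vm))) * √ε := by
    rw [← Real.sqrt_mul (by positivity)]
    apply Real.sqrt_le_sqrt
    have hq := sm_qg_nonneg Φ
    calc J1 * (Es V Φ - lam1 S V) * (J2 + J3 * sm (qg Φ)) ≤ J1 * ε * (J2 + J3 * sm (qg Φ)) := by
          gcongr; linarith
      _ ≤ J1 * ε * (J2 + J3 * (|lam1 S V| + 1 + Vm)) := by gcongr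
      _ = _ := by ring
  -- integral identity
  have i1 := XI_integrable (α := α) hS hr hu hΦ Φ0 hδ hρℓ (by nlinarith)
  have i2 := XI_integrable (α := α) hS hr hu hΦ Φ0 hδ hρ (by nlinarith)
  have i3 := XI_integrable (α := α) hS hr hu hΦ Φ0 hδ (ρ := ρ * ℓ) (by positivity) (by linarith)
  have hid : ∫ x, Φ x * kw u p Φ x * KCtx.NN N G (κ ^ 2 - (((N:ℝ) - 2) / 2) ^ 2) (‖x‖ ^ 2) =
      -4 * ((∫ x, XI u δ α Φ (ρ / ℓ) x) - (1 + ℓ ^ (-κ)) * (∫ x, XI u δ α Φ ρ x) +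
        ℓ ^ (-κ) * ∫ x, XI u δ α Φ (ρ * ℓ) x) := by
    have i4 : Integrable (fun x => XI u δ α Φ (ρ / ℓ) x - (1 + ℓ ^ (-κ)) * XI u δ α Φ ρ x) :=
      i1.sub (i2.const_mul _)
    rw [← integral_const_mul, ← integral_const_mul, ← integral_sub i1 (i2.const_mul _),
      ← integral_add i4 (i3.const_mul _), ← integral_const_mul]
    refine integral_congr_ae ?_
    filter_upwards [KCtx.ae_ne_zero hS] with x hx
    have ht : 0 < ‖x‖ ^ 2 := by positivity
    have key : XI u δ α Φ (ρ / ℓ) x - (1 + ℓ ^ (-κ)) * XI u δ α Φ ρ x + ℓ ^ (-κ) * XI u δ α Φ (ρ * ℓ) x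
      = Φ x * kw u (pw δ α) Φ x * ((‖x‖ ^ 2) ^ (α / 2) * nn' κ ρ ℓ (‖x‖ ^ 2)) := by
      simp only [XI, mw, nn']; ring
    have := GN _ ht
    rw [key, this]
    by_cases hn : nn' κ ρ ℓ (‖x‖ ^ 2) = 0
    · rw [hn]; simp
    · have h2 : KCtx.NN N G (κ ^ 2 - (((N:ℝ) - 2) / 2) ^ 2) (‖x‖ ^ 2) ≠ 0 := by
        rw [this]
        have := (Real.rpow_pos_of_pos ht ((κ - ((N:ℝ) - 2) / 2) / 2)).ne'
        positivity
      have h3 := KCtx.NN_supp (a := a) (b := b) (by intro t ht; rw [a2, b2]; exact Ga t ht) _ h2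
      rw [a2, b2] at h3
      have h4 : kw u p Φ x = kw u (pw δ α) Φ x := by
        unfold kw ki kh
        rw [ppw _ (by linarith) (by linarith)]
      rw [h4]; ring
  have h0 : 0 ≤ ∫ x, XI u δ α Φ (ρ / ℓ) x := by
    refine integral_nonneg_of_ae ?_
    filter_upwards [XI_bound (α := α) hr hu hΦ Φ0 hδ hρℓ (by nlinarith)] with x hx
    exact hx.1
  rw [hid] at hkey
  linarith

end

set_option linter.unusedSimpArgs false
noncomputable section

theorem lower_on_compact {N : ℕ} (hN : 3 ≤ N) {S : Set (Euc N)} (hS : IsSphereDomain N S) {r : ℝ} (hr : 0 < r)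
    {u : Euc N → ℝ} (hu : SH (coneLike S r) u) (hpos : ∀ᵐ x, x ∈ coneLike S r → 0 < u x)
    {K : Set (Euc N)} (hK : IsCompact K) (hKΩ : K ⊆ coneLike S r) :
    ∃ c0 : ℝ, 0 < c0 ∧ ∀ᵐ x, x ∈ K → c0 ≤ u x := by
  have hO := isOpen_coneLike hS r
  have hpre : IsPreconnected (coneLike S r) := by
    rw [coneLike_eq_annC hS.2.1]; exact isPreconnected_annC hS le_rfl
  obtain ⟨σ, hσ⟩ := hS.1
  have hn : ‖σ‖ = 1 := by simpa using hS.2.1 hσ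
  have hx0 : (r / 2) • σ ∈ coneLike S r := by
    refine ⟨⟨r / 2, by positivity, σ, hσ, rfl⟩, ?_⟩
    rw [mem_ball_zero_iff, norm_smul, hn, Real.norm_eq_abs, abs_of_pos (by positivity)]; linarith
  obtain ⟨ρ, hρ, hball⟩ := nhds_basis_closedBall.mem_iff.mp (hO.mem_nhds hx0)
  obtain ⟨C, hC, h⟩ := harnack hN hO hpre hK hKΩ (isCompact_closedBall ((r / 2) • σ) ρ) hball
  have h := h u hu
  set I := ∫⁻ z in closedBall ((r / 2) • σ) ρ, ENNReal.ofReal (u z) with hI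
  have hI0 : 0 < I := by
    rw [pos_iff_ne_zero]
    intro h0
    have hm : AEMeasurable (fun z => ENNReal.ofReal (u z)) (volume.restrict (closedBall ((r / 2) • σ) ρ)) :=
      ((hu.1.integrableOn_compact_subset hball (isCompact_closedBall _ _)).aestronglyMeasurable.aemeasurable).ennreal_ofReal
    rw [hI, lintegral_eq_zero_iff' hm] at h0
    have h1 : ∀ᵐ z, z ∈ closedBall ((r / 2) • σ) ρ → ENNReal.ofReal (u z) = 0 := by
      have := (ae_restrict_iff' (isCompact_closedBall _ _).measurableSet).mp h0
      exact this
    have h2 : ∀ᵐ z, z ∉ closedBall ((r / 2) • σ) ρ := by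
      filter_upwards [h1, hpos] with z hz hp hmem
      have h3 := hp (hball hmem)
      have h4 := ENNReal.ofReal_eq_zero.mp (hz hmem)
      linarith
    have h3 : volume (closedBall ((r / 2) • σ) ρ) = 0 := by
      exact measure_eq_zero_iff_ae_notMem.mpr h2
    exact (measure_closedBall_pos volume _ hρ).ne' h3
  set I1 := min I 1 with hI1
  have hI1p : 0 < I1 := lt_min hI0 one_pos
  have hI1t : I1 ≠ ⊤ := ne_top_of_le_ne_top ENNReal.one_ne_top (min_le_right _ _)
  have hi : 0 < I1.toReal := ENNReal.toReal_pos hI1p.ne' hI1t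
  refine ⟨I1.toReal / (C.toReal + 1), by positivity, ?_⟩
  filter_upwards [h, hpos] with x hx hp hxK
  have h1 := (min_le_left I 1).trans (hx hxK)
  have hu0 := hp (hKΩ hxK)
  have h2 : I1.toReal ≤ C.toReal * u x := by
    have := ENNReal.toReal_mono (ENNReal.mul_ne_top hC ENNReal.ofReal_ne_top) h1
    rwa [ENNReal.toReal_mul, ENNReal.toReal_ofReal hu0.le] at this
  rw [div_le_iff₀ (by positivity)]
  nlinarith

theorem mw_scale {α ρ t : ℝ} (hρ : 0 < ρ) (ht : 0 ≤ t) : mw α ρ (ρ * t) = ρ ^ (α / 2 - 1) * mw α 1 t := by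
  unfold mw
  rw [Real.mul_rpow hρ.le ht, Real.rpow_sub_one hρ.ne', mul_div_cancel_left₀ _ hρ.ne', div_one, div_one]
  field_simp

theorem pm_scale {N : ℕ} {Z : Euc N → ℝ} (hZ : ∀ s : ℝ, 0 < s → ∀ x, Z (s • x) = Z x) {δ κ α ρ : ℝ}
    (hρ : 0 < ρ) (hα : α = κ - ((N:ℝ) - 2) / 2) :
    ∫ x, pw δ α (‖x‖ ^ 2) * mw α ρ (‖x‖ ^ 2) * Z x =
      δ * ρ ^ κ * ∫ x, pw 1 α (‖x‖ ^ 2) * mw α 1 (‖x‖ ^ 2) * Z x := by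
  have h := Measure.integral_comp_smul (volume : Measure (Euc N))
    (fun x => pw δ α (‖x‖ ^ 2) * mw α ρ (‖x‖ ^ 2) * Z x) (√ρ)
  have hs : 0 < √ρ := Real.sqrt_pos.mpr hρ
  have e : (fun x : Euc N => pw δ α (‖√ρ • x‖ ^ 2) * mw α ρ (‖√ρ • x‖ ^ 2) * Z (√ρ • x)) =
      fun x => (δ * (ρ ^ (α / 2) * ρ ^ (α / 2 - 1))) * (pw 1 α (‖x‖ ^ 2) * mw α 1 (‖x‖ ^ 2) * Z x) := by
    ext x
    rw [hZ _ hs, norm_smul, Real.norm_eq_abs, abs_of_pos hs, mul_pow, Real.sq_sqrt hρ.le,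
      mw_scale hρ (by positivity)]
    unfold pw
    rw [Real.mul_rpow hρ.le (by positivity)]
    ring
  rw [e, integral_const_mul, finrank_euclideanSpace_fin, abs_of_pos (by positivity)] at h
  have hN2 : √ρ ^ N = ρ ^ ((N:ℝ) / 2) := by
    rw [Real.sqrt_eq_rpow, ← Real.rpow_natCast, ← Real.rpow_mul hρ.le]; congr 1; ring
  rw [hN2, smul_eq_mul] at h
  have hp : 0 < ρ ^ ((N:ℝ) / 2) := Real.rpow_pos_of_pos hρ _
  have hk : ρ ^ κ = ρ ^ ((N:ℝ) / 2) * (ρ ^ (α / 2) * ρ ^ (α / 2 - 1)) := by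
    rw [← Real.rpow_add hρ, ← Real.rpow_add hρ]; congr 1; rw [hα]; ring
  rw [hk]
  field_simp at h ⊢
  linarith

def cJ (N : ℕ) (α : ℝ) : ℝ := Jr N (fun t => pw 1 α t * mw α 1 t)

theorem cJ_pos {N : ℕ} (hN : 3 ≤ N) (α : ℝ) : 0 < cJ N α := by
  have h0 : 0 ≤ cJ N α := Jr_nonneg fun t ht =>
    mul_nonneg (mul_nonneg zero_le_one (Real.rpow_nonneg ht.le _)) (mw_nonneg one_pos ht.le)
  refine h0.lt_of_ne fun hz => ?_
  have h1 := Jr_mul_sm_one hN (fun t => pw 1 α t * mw α 1 t)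
  change _ = cJ N α * _ at h1
  rw [← hz, zero_mul] at h1
  have hi : Integrable (fun x : Euc N => pw 1 α (‖x‖ ^ 2) * mw α 1 (‖x‖ ^ 2)) := by
    have := pm_integrable (N := N) (Z := fun _ => 1) (δ := 1) (α := α) (ρ := 1) continuousOn_const one_pos
    simpa using this
  have hnn : 0 ≤ fun x : Euc N => pw 1 α (‖x‖ ^ 2) * mw α 1 (‖x‖ ^ 2) := fun x =>
    mul_nonneg (mul_nonneg zero_le_one (Real.rpow_nonneg (by positivity) _)) (mw_nonneg one_pos (by positivity))
  have hpos : 0 < ∫ x : Euc N, pw 1 α (‖x‖ ^ 2) * mw α 1 (‖x‖ ^ 2) := by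
    rw [integral_pos_iff_support_of_nonneg hnn hi]
    obtain ⟨τ, hτ, hd⟩ := exists_deriv_eq_slope MM (by norm_num : (1:ℝ) < 2)
      MM_smooth.continuous.continuousOn (MM_smooth.differentiable infty_ne_zero).differentiableOn
    rw [MM_one le_rfl, MM_zero le_rfl] at hd
    have hO : IsOpen {x : Euc N | x ≠ 0 ∧ 0 < deriv MM (‖x‖ ^ 2)} :=
      isOpen_ne.inter (isOpen_lt continuous_const (MM_deriv_smooth.continuous.comp (by fun_prop)))
    have hne : {x : Euc N | x ≠ 0 ∧ 0 < deriv MM (‖x‖ ^ 2)}.Nonempty := by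
      have hτ0 : 0 < τ := by linarith [hτ.1]
      have hfin : (0:ℕ) < N := by omega
      refine ⟨EuclideanSpace.single ⟨0, hfin⟩ (√τ), ?_, ?_⟩
      · intro h
        have := congrArg norm h
        simp at this
        exact (Real.sqrt_pos.mpr hτ0).ne' this
      · rw [EuclideanSpace.norm_single, Real.norm_eq_abs, sq_abs, Real.sq_sqrt hτ0.le, hd]; norm_num
    refine (hO.measure_pos volume hne).trans_le (measure_mono ?_)
    rintro x ⟨hx, hd⟩
    have ht : 0 < ‖x‖ ^ 2 := by positivity
    rw [Function.mem_support]
    have h3 := Real.rpow_pos_of_pos ht (α / 2)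
    have : 0 < pw 1 α (‖x‖ ^ 2) * mw α 1 (‖x‖ ^ 2) := by
      unfold pw mw; rw [div_one, div_one]; positivity
    exact this.ne'
  linarith

theorem mw_bdd (α : ℝ) : ∃ m1 : ℝ, 0 < m1 ∧ ∀ ρ t, 0 < ρ → 0 ≤ t → mw α ρ t ≤ ρ ^ (α / 2 - 1) * m1 := by
  obtain ⟨C, hC⟩ := (isCompact_Icc (a := (1:ℝ)) (b := 2)).exists_bound_of_continuousOn
    ((mw_cont (α := α) (ρ := 1)).mono fun t ht => lt_of_lt_of_le one_pos ht.1)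
  refine ⟨|C| + 1, by positivity, fun ρ t hρ ht => ?_⟩
  have e : t = ρ * (t / ρ) := by field_simp
  rw [e, mw_scale hρ (by positivity)]
  refine mul_le_mul_of_nonneg_left ?_ (Real.rpow_nonneg hρ.le _)
  by_cases h : mw α 1 (t / ρ) = 0
  · rw [h]; positivity
  · have h2 := mw_supp one_pos h
    have := hC (t / ρ) ⟨h2.1, by linarith [h2.2]⟩
    have h3 := (le_abs_self _).trans this
    have := le_abs_self C
    linarith

theorem measurable_E {N : ℕ} {S K0 : Set (Euc N)} (hS : S ⊆ sphere (0 : Euc N) 1) (hK : IsCompact K0)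
    (hKS : K0 ⊆ S) {Φ : Euc N → ℝ} (hΦ : HomTest S Φ) (Λ : ℝ) :
    MeasurableSet {x | x ∈ sphCone K0 ∧ Φ x ≤ Λ} := by
  have hc : IsClosed (K0 ∩ Φ ⁻¹' Set.Iic Λ) := by
    refine ContinuousOn.preimage_isClosed_of_isClosed (hΦ.continuousOn.mono fun x hx => ?_) hK.isClosed isClosed_Iic
    intro h0
    have h0 : x = 0 := h0
    have := hS (hKS hx)
    rw [h0] at this; simp at this
  have hm : Measurable (fun x : Euc N => ‖x‖⁻¹ • x) := by fun_prop
  have e : {x | x ∈ sphCone K0 ∧ Φ x ≤ Λ} = {0}ᶜ ∩ (fun x : Euc N => ‖x‖⁻¹ • x) ⁻¹' (K0 ∩ Φ ⁻¹' Set.Iic Λ) := by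
    ext x
    simp only [Set.mem_ofPred_eq, Set.mem_inter_iff, Set.mem_compl_iff, Set.mem_singleton_iff, Set.mem_preimage,
      Set.mem_Iic, mem_sphCone_iff (hKS.trans hS)]
    constructor
    · rintro ⟨⟨h1, h2⟩, h3⟩
      exact ⟨h1, h2, by rw [hΦ.1 _ (by positivity)]; exact h3⟩
    · rintro ⟨h1, h2, h3⟩
      rw [hΦ.1 _ (by positivity)] at h3
      exact ⟨⟨h1, h2⟩, h3⟩
  rw [e]
  exact (measurableSet_singleton _).compl.inter (hm hc.measurableSet)

end

set_option linter.unusedSimpArgs false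
noncomputable section

def EE {N : ℕ} (K0 : Set (Euc N)) (Φ : Euc N → ℝ) (Λ : ℝ) : Set (Euc N) := {x | x ∈ sphCone K0 ∧ Φ x ≤ Λ}

theorem pm_total {N : ℕ} (hN : 3 ≤ N) {S : Set (Euc N)} {Φ : Euc N → ℝ} (hΦ : HomTest S Φ)
    (h1 : sm (fun x => Φ x ^ 2) = 1) {δ κ α ρ : ℝ} (hρ : 0 < ρ) (hα : α = κ - ((N:ℝ) - 2) / 2) :
    ∫ x, pw δ α (‖x‖ ^ 2) * mw α ρ (‖x‖ ^ 2) * Φ x ^ 2 = δ * ρ ^ κ * cJ N α := by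
  have hZ : ∀ s : ℝ, 0 < s → ∀ x, (fun x => Φ x ^ 2) (s • x) = (fun x => Φ x ^ 2) x := by
    intro s hs x
    simp only [hΦ.1 s hs x]
  have h2 := pm_scale (Z := fun x => Φ x ^ 2) hZ (δ := δ) (κ := κ) (α := α) hρ hα
  have h3 := hom_polar (Z := fun x => Φ x ^ 2) hN (fun t => pw 1 α t * mw α 1 t) hZ
  rw [h2, h3, h1, mul_one, cJ]

theorem pm_compl {N : ℕ} (hN : 3 ≤ N) {S K0 : Set (Euc N)} (hS : S ⊆ sphere (0 : Euc N) 1)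
    (hK : IsCompact K0) (hKS : K0 ⊆ S) {Φ : Euc N → ℝ} (hΦ : HomTest S Φ) {Λ η : ℝ}
    (hη : sm ((EE K0 Φ Λ)ᶜ.indicator (fun x => Φ x ^ 2)) ≤ η)
    {δ κ α ρ : ℝ} (hδ : 0 ≤ δ) (hρ : 0 < ρ) (hα : α = κ - ((N:ℝ) - 2) / 2) :
    ∫ x in (EE K0 Φ Λ)ᶜ, pw δ α (‖x‖ ^ 2) * mw α ρ (‖x‖ ^ 2) * Φ x ^ 2 ≤ δ * ρ ^ κ * cJ N α * η := by
  have hm : MeasurableSet (EE K0 Φ Λ) := measurable_E hS hK hKS hΦ Λ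
  set Z := (EE K0 Φ Λ)ᶜ.indicator (fun x => Φ x ^ 2) with hZd
  have hZ : ∀ s : ℝ, 0 < s → ∀ x, Z (s • x) = Z x := by
    intro s hs x
    have : s • x ∈ (EE K0 Φ Λ)ᶜ ↔ x ∈ (EE K0 Φ Λ)ᶜ := by
      simp only [EE, Set.mem_compl_iff, Set.mem_ofPred_eq, smul_mem_sphCone_iff hs, hΦ.1 s hs x]
    by_cases hx : x ∈ (EE K0 Φ Λ)ᶜ
    · rw [hZd, Set.indicator_of_mem hx, Set.indicator_of_mem (this.mpr hx), hΦ.1 s hs x]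
    · rw [hZd, Set.indicator_of_notMem hx, Set.indicator_of_notMem (fun h => hx (this.mp h))]
  have h2 := pm_scale (Z := Z) hZ (δ := δ) (κ := κ) (α := α) hρ hα
  have h3 := hom_polar hN (fun t => pw 1 α t * mw α 1 t) hZ
  rw [← integral_indicator hm.compl]
  have h4 : ((EE K0 Φ Λ)ᶜ.indicator fun x => pw δ α (‖x‖ ^ 2) * mw α ρ (‖x‖ ^ 2) * Φ x ^ 2) =
      fun x => pw δ α (‖x‖ ^ 2) * mw α ρ (‖x‖ ^ 2) * Z x := by
    funext x
    by_cases hx : x ∈ (EE K0 Φ Λ)ᶜ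
    · rw [hZd, Set.indicator_of_mem hx, Set.indicator_of_mem hx]
    · rw [hZd, Set.indicator_of_notMem hx, Set.indicator_of_notMem hx, mul_zero]
  rw [h4, h2, h3]
  have h5 := cJ_pos hN α
  have h6 : 0 ≤ δ * ρ ^ κ * cJ N α := by positivity
  calc _ = δ * ρ ^ κ * cJ N α * sm Z := by rw [cJ]; ring
    _ ≤ _ := mul_le_mul_of_nonneg_left hη h6

theorem phi_sq_contOn {N : ℕ} {S : Set (Euc N)} {Φ : Euc N → ℝ} (hΦ : HomTest S Φ) :
    ContinuousOn (fun x => Φ x ^ 2) {0}ᶜ := by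
  intro x hx
  exact ((hΦ.2.1 x hx).continuousAt.pow 2).continuousWithinAt

theorem XI_lower {N : ℕ} (hN : 3 ≤ N) {S K0 : Set (Euc N)} (hS : IsSphereDomain N S)
    (hK : IsCompact K0) (hKS : K0 ⊆ S) {r : ℝ} (hr : 0 < r)
    {u : Euc N → ℝ} (hu : SH (coneLike S r) u) {Φ : Euc N → ℝ} (hΦ : HomTest S Φ) (Φ0 : ∀ x, 0 ≤ Φ x)
    (h1 : sm (fun x => Φ x ^ 2) = 1) {Λ η : ℝ}
    (hη : sm ((EE K0 Φ Λ)ᶜ.indicator (fun x => Φ x ^ 2)) ≤ η)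
    {δ κ α ρ c0 : ℝ} (hδ : 0 ≤ δ) (hρ : 0 < ρ) (hρr : 2 * ρ < r ^ 2) (hα : α = κ - ((N:ℝ) - 2) / 2)
    (hc : ∀ᵐ x, x ∈ annK K0 (√ρ) (√(2 * ρ)) → c0 ≤ u x)
    (hc' : ∀ t, ρ ≤ t → t ≤ 2 * ρ → pw δ α t * Λ ≤ c0) :
    1 / 2 * (δ * ρ ^ κ * cJ N α * (1 - η)) ≤ ∫ x, XI u δ α Φ ρ x := by
  have hm : MeasurableSet (EE K0 Φ Λ) := measurable_E hS.2.1 hK hKS hΦ Λ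
  have hXi := XI_integrable hS hr hu hΦ Φ0 hδ hρ hρr (α := α)
  have hpi := pm_integrable (phi_sq_contOn hΦ) (δ := δ) (α := α) hρ
  have ht := pm_total hN hΦ h1 (δ := δ) (κ := κ) hρ hα
  have hcm := pm_compl hN hS.2.1 hK hKS hΦ hη hδ hρ hα (κ := κ)
  have hs := integral_add_compl hm hpi
  have hb := XI_bound hr hu hΦ Φ0 hδ hρ hρr (α := α)
  have e1 : ∫ x in EE K0 Φ Λ, XI u δ α Φ ρ x ≤ ∫ x, XI u δ α Φ ρ x :=
    setIntegral_le_integral hXi (hb.mono fun x hx => hx.1)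
  have e2 : ∫ x in EE K0 Φ Λ, 1 / 2 * (pw δ α (‖x‖ ^ 2) * mw α ρ (‖x‖ ^ 2) * Φ x ^ 2) ≤
      ∫ x in EE K0 Φ Λ, XI u δ α Φ ρ x := by
    refine setIntegral_mono_ae_restrict (hpi.const_mul _).integrableOn hXi.integrableOn ?_
    rw [EventuallyLE, ae_restrict_iff' hm]
    filter_upwards [hb, hc] with x hx hcx hxE
    by_cases hmw : mw α ρ (‖x‖ ^ 2) = 0
    · rw [hmw]; simpa using hx.1
    · obtain ⟨q1, q2⟩ := mw_supp hρ hmw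
      apply hx.2.2.2
      have q3 : x ∈ annK K0 (√ρ) (√(2 * ρ)) :=
        ⟨hxE.1, by rw [Real.sqrt_le_left (norm_nonneg _)]; exact q1, Real.le_sqrt_of_sq_le q2⟩
      refine le_trans ?_ (hcx q3)
      refine le_trans ?_ (hc' _ q1 q2)
      refine mul_le_mul_of_nonneg_left hxE.2 ?_
      unfold pw
      positivity
  rw [integral_const_mul] at e2
  nlinarith

theorem XI_upper {N : ℕ} (hN : 3 ≤ N) {S K0 : Set (Euc N)} (hS : IsSphereDomain N S)
    (hK : IsCompact K0) (hKS : K0 ⊆ S) {r : ℝ} (hr : 0 < r)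
    {u : Euc N → ℝ} (hu : SH (coneLike S r) u) {Φ : Euc N → ℝ} (hΦ : HomTest S Φ) (Φ0 : ∀ x, 0 ≤ Φ x)
    {Λ η : ℝ} (hΛ : 0 ≤ Λ)
    (hη : sm ((EE K0 Φ Λ)ᶜ.indicator (fun x => Φ x ^ 2)) ≤ η)
    {δ κ α R m1 : ℝ} (hδ : 0 ≤ δ) (hR : 0 < R) (hRr : 3 * R ^ 2 ≤ r ^ 2) (hα : α = κ - ((N:ℝ) - 2) / 2)
    (hm0 : 0 < m1) (hm1 : ∀ ρ t, 0 < ρ → 0 ≤ t → mw α ρ t ≤ ρ ^ (α / 2 - 1) * m1) :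
    ∫ x, XI u δ α Φ (R ^ 2) x ≤ Λ * ((R ^ 2) ^ (α / 2 - 1) * m1) * (∫ x in annK K0 R (3 / 2 * R), u x) +
      δ * (R ^ 2) ^ κ * cJ N α * η := by
  have hρ : 0 < R ^ 2 := by positivity
  have hρr : 2 * R ^ 2 < r ^ 2 := by linarith
  have hm : MeasurableSet (EE K0 Φ Λ) := measurable_E hS.2.1 hK hKS hΦ Λ
  have hXi := XI_integrable hS hr hu hΦ Φ0 hδ hρ hρr (α := α)
  have hpi := pm_integrable (phi_sq_contOn hΦ) (δ := δ) (α := α) hρ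
  have hcm := pm_compl hN hS.2.1 hK hKS hΦ hη hδ hρ hα (κ := κ)
  have hs := integral_add_compl hm hXi
  have hb := XI_bound hr hu hΦ Φ0 hδ hρ hρr (α := α)
  have e1 : ∫ x in (EE K0 Φ Λ)ᶜ, XI u δ α Φ (R ^ 2) x ≤
      ∫ x in (EE K0 Φ Λ)ᶜ, pw δ α (‖x‖ ^ 2) * mw α (R ^ 2) (‖x‖ ^ 2) * Φ x ^ 2 :=
    setIntegral_mono_ae hXi.integrableOn hpi.integrableOn (hb.mono fun x hx => hx.2.1)
  have hKc := isCompact_annK (hKS.trans hS.2.1) hK hR (b := 3 / 2 * R)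
  have hsub : annK K0 R (3 / 2 * R) ⊆ coneLike S r := by
    intro x hx
    refine ⟨sphCone_mono hKS hx.1, ?_⟩
    rw [mem_ball_zero_iff]
    refine lt_of_le_of_lt hx.2.2 ?_
    nlinarith
  have hui : IntegrableOn u (annK K0 R (3 / 2 * R)) := hu.1.integrableOn_compact_subset hsub hKc
  have e2 : ∫ x in EE K0 Φ Λ, XI u δ α Φ (R ^ 2) x ≤
      Λ * ((R ^ 2) ^ (α / 2 - 1) * m1) * (∫ x in annK K0 R (3 / 2 * R), u x) := by
    rw [← integral_const_mul, ← integral_indicator hm, ← integral_indicator hKc.measurableSet]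
    refine integral_mono_ae (hXi.indicator hm)
      (IntegrableOn.integrable_indicator (hui.const_mul _) hKc.measurableSet) ?_
    filter_upwards [hb, hu.2.1] with x hx hux
    have hc0 : 0 ≤ Λ * ((R ^ 2) ^ (α / 2 - 1) * m1) := by positivity
    have hr0 : 0 ≤ (annK K0 R (3 / 2 * R)).indicator
        (fun x => Λ * ((R ^ 2) ^ (α / 2 - 1) * m1) * u x) x := by
      refine Set.indicator_apply_nonneg fun h => mul_nonneg hc0 (hux (hsub h))
    by_cases hxE : x ∈ EE K0 Φ Λ
    · rw [Set.indicator_of_mem hxE]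
      by_cases hmw : mw α (R ^ 2) (‖x‖ ^ 2) = 0
      · refine le_trans (hx.2.2.1) ?_
        rw [hmw, mul_zero]; exact hr0
      · obtain ⟨q1, q2⟩ := mw_supp hρ hmw
        have q3 : x ∈ annK K0 R (3 / 2 * R) := by
          refine ⟨hxE.1, ?_, ?_⟩
          · exact le_of_sq_le_sq q1 (norm_nonneg _)
          · refine le_of_sq_le_sq ?_ (by positivity)
            nlinarith
        rw [Set.indicator_of_mem q3]
        refine le_trans (hx.2.2.1) ?_
        have u0 := hux (hsub q3)
        calc Φ x * u x * mw α (R ^ 2) (‖x‖ ^ 2) ≤ Λ * u x * ((R ^ 2) ^ (α / 2 - 1) * m1) := by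
              refine mul_le_mul ?_ (hm1 _ _ hρ (by positivity)) (mw_nonneg hρ (by positivity)) (by positivity)
              exact mul_le_mul_of_nonneg_right hxE.2 u0
          _ = _ := by ring
    · rw [Set.indicator_of_notMem hxE]; exact hr0
  linarith

set_option maxHeartbeats 1000000 in
theorem lower_avg {N : ℕ} (hN : 3 ≤ N) {S : Set (Euc N)} (hS : IsSphereDomain N S) {r : ℝ} (hr : 0 < r)
    {u V : Euc N → ℝ} (hu : SH (coneLike S r) u) (hpos : ∀ᵐ x, x ∈ coneLike S r → 0 < u x)
    {Vm : ℝ} (hV : IsPot V Vm)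
    (hsup : ∀ φ : Euc N → ℝ, IsTestFun (coneLike S r) φ → (∀ x, 0 ≤ φ x) →
      ∫ x, u x * lap φ x ≤ -∫ x, V x / ‖x‖ ^ 2 * u x * φ x)
    {κ : ℝ} (hκ : 0 ≤ κ) (hl : lam1 S V ≤ κ ^ 2 - (((N:ℝ) - 2) / 2) ^ 2) :
    ∃ K0, IsCompact K0 ∧ K0 ⊆ S ∧ ∃ c : ℝ, 0 < c ∧ ∀ R : ℝ, 0 < R → 3 * R ^ 2 ≤ r ^ 2 →
      c * R ^ (κ - ((N:ℝ) - 2) / 2 + N) ≤ ∫ x in annK K0 R (3 / 2 * R), u x := by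
  obtain ⟨K0, hK, hKS, Λ, hΛ, ht⟩ := tight hN hS (1 + Vm + |lam1 S V|) (show (0:ℝ) < 1 / 10 by norm_num)
  set α := κ - ((N:ℝ) - 2) / 2 with hα
  set ρT := r ^ 2 / 3 with hρT
  have hρT0 : 0 < ρT := by positivity
  have hρTr : 2 * ρT < r ^ 2 := by rw [hρT]; nlinarith [sq_pos_of_pos hr]
  have hsub : annK K0 (√ρT) (√(2 * ρT)) ⊆ coneLike S r := by
    intro x hx
    refine ⟨sphCone_mono hKS hx.1, ?_⟩
    rw [mem_ball_zero_iff]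
    refine lt_of_le_of_lt hx.2.2 ?_
    rw [Real.sqrt_lt' hr]; exact hρTr
  obtain ⟨c0, hc0, hc⟩ := lower_on_compact hN hS hr hu hpos
    (isCompact_annK (hKS.trans hS.2.1) hK (Real.sqrt_pos.mpr hρT0)) hsub
  obtain ⟨m1, hm0, hm1⟩ := mw_bdd α
  obtain ⟨P, hP⟩ := isCompact_Icc.exists_bound_of_continuousOn (s := Set.Icc ρT (2 * ρT))
    (f := fun t : ℝ => t ^ (α / 2)) (by
      intro t ht
      have : t ≠ 0 := by have := ht.1; intro h; linarith
      exact (Real.continuousAt_rpow_const t _ (Or.inl this)).continuousWithinAt)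
  set δ := c0 / (Λ * (|P| + 1)) with hδd
  have hδ : 0 < δ := by positivity
  have hc' : ∀ t, ρT ≤ t → t ≤ 2 * ρT → pw δ α t * Λ ≤ c0 := by
    intro t h1 h2
    have h3 := hP t ⟨h1, h2⟩
    have h4 : t ^ (α / 2) ≤ |P| + 1 := by
      have := le_abs_self (t ^ (α / 2))
      have := le_abs_self P
      rw [Real.norm_eq_abs] at h3
      linarith
    unfold pw
    calc δ * t ^ (α / 2) * Λ ≤ δ * (|P| + 1) * Λ := by gcongr
      _ = c0 := by rw [hδd]; field_simp
  have hcJ := cJ_pos hN α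
  refine ⟨K0, hK, hKS, δ * cJ N α / (10 * Λ * m1), by positivity, ?_⟩
  intro R hR hRr
  have hρ : 0 < R ^ 2 := by positivity
  set ρ := R ^ 2 with hρd
  set ℓ := ρT / ρ with hℓd
  have hℓ : 1 ≤ ℓ := by
    rw [hℓd, one_le_div hρ, hρT]; linarith
  have hρℓ : ρ * ℓ = ρT := by rw [hℓd]; field_simp
  obtain ⟨C, hC, hst⟩ := step hN hS hr hu hV hsup hl hδ.le hρ hℓ (by rw [mul_assoc, hρℓ]; exact hρTr)
  set A := δ * ρ ^ κ * cJ N α with hA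
  have hA0 : 0 < A := by positivity
  set ε := min 1 ((A / (20 * (C + 1))) ^ 2) with hε
  have hε0 : 0 < ε := lt_min one_pos (by positivity)
  have hCε : C * √ε ≤ A / 20 := by
    have : √ε ≤ A / (20 * (C + 1)) := by
      rw [Real.sqrt_le_left (by positivity)]; exact min_le_right _ _
    calc C * √ε ≤ (C + 1) * (A / (20 * (C + 1))) := by gcongr; linarith
      _ = A / 20 := by field_simp
  obtain ⟨Φ, hΦ, Φ0, h1, hE⟩ := almost_min hS hV hε0
  have hM : sm (qg Φ) ≤ 1 + Vm + |lam1 S V| := by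
    have q1 := sm_VPhi_le hV hΦ
    rw [h1] at q1
    have q2 := le_abs_self (lam1 S V)
    have q3 : ε ≤ 1 := min_le_left _ _
    unfold Es at hE
    linarith
  have hη := ht Φ hΦ Φ0 h1 hM
  have hlow := XI_lower hN hS hK hKS hr hu hΦ Φ0 h1 hη hδ.le hρT0 hρTr hα hc hc'
  have hup := XI_upper hN hS hK hKS hr hu hΦ Φ0 hΛ.le hη hδ.le hR hRr hα hm0 hm1
  have hs := hst Φ hΦ Φ0 h1 ε hε0.le (min_le_left _ _) hE
  rw [hρℓ] at hs
  rw [← hρd, ← hA] at hup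
  set L := ℓ ^ (-κ) with hL
  have hL0 : 0 < L := by rw [hL]; positivity
  have hL1 : L ≤ 1 := Real.rpow_le_one_of_one_le_of_nonpos hℓ (by linarith)
  have hLρ : L * ρT ^ κ = ρ ^ κ := by
    rw [hL, Real.rpow_neg (by positivity), hℓd, Real.div_rpow hρT0.le hρ.le]
    field_simp
  have hlow2 : 9 / 20 * A ≤ L * ∫ x, XI u δ α Φ ρT x := by
    calc 9 / 20 * A = L * (1 / 2 * (δ * ρT ^ κ * cJ N α * (1 - 1 / 10))) := by
          rw [hA, ← hLρ]; ring
      _ ≤ _ := mul_le_mul_of_nonneg_left hlow hL0.le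
  set I := ∫ x in annK K0 R (3 / 2 * R), u x with hI
  set X := ∫ x, XI u δ α Φ ρ x with hX
  have hX0 : 0 ≤ X := by
    refine integral_nonneg_of_ae ?_
    exact (XI_bound hr hu hΦ Φ0 hδ.le hρ (by linarith) (α := α)).mono fun x hx => hx.1
  have h5 : (1 + L) * X ≤ 2 * X := by nlinarith
  have h6 : A / 10 ≤ Λ * (ρ ^ (α / 2 - 1) * m1) * I := by linarith
  have h7 : ρ ^ κ = ρ ^ (α / 2 - 1) * R ^ (α + N) := by
    have : R ^ (α + N) = ρ ^ ((α + N) / 2) := by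
      rw [hρd, ← Real.rpow_natCast R 2, ← Real.rpow_mul hR.le]
      congr 1; push_cast; ring
    rw [this, ← Real.rpow_add hρ]
    congr 1; rw [hα]; ring
  have h8 : 0 < ρ ^ (α / 2 - 1) := by positivity
  rw [hA, h7] at h6
  have h9 : (ρ ^ (α / 2 - 1)) * (δ * cJ N α / 10 * R ^ (α + N)) ≤ (ρ ^ (α / 2 - 1)) * (Λ * m1 * I) := by
    calc _ = _ := by ring
      _ ≤ _ := h6
      _ = _ := by ring
  have h10 := le_of_mul_le_mul_left h9 h8
  rw [← mul_le_mul_iff_right₀ (show 0 < Λ * m1 by positivity)]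
  calc _ = δ * cJ N α / 10 * R ^ (α + N) := by field_simp
    _ ≤ _ := h10

end

set_option linter.unusedSimpArgs false
noncomputable section

theorem integrable_loc_mul {N : ℕ} {Ω K : Set (Euc N)} {w g : Euc N → ℝ} (hw : LocallyIntegrableOn w Ω)
    (hK : IsCompact K) (hKΩ : K ⊆ Ω) (hg : Continuous g) (hgK : ∀ x, x ∉ K → g x = 0) :
    Integrable (fun x => w x * g x) := by
  have h1 : IntegrableOn w K := hw.integrableOn_compact_subset hKΩ hK
  have h2 : IntegrableOn (fun x => w x * g x) K := h1.mul_continuousOn hg.continuousOn hK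
  rw [integrableOn_iff_integrable_of_support_subset] at h2
  · exact h2
  · intro x hx
    by_contra h
    exact hx (by simp [hgK x h])

theorem rpow_compare {R t α : ℝ} (ht : 0 < t) (h1 : R / 2 ≤ t) (h2 : t ≤ R) :
    (2:ℝ) ^ (-|α|) * t ^ α ≤ R ^ α := by
  have hR : 0 < R := by linarith
  have hs1 : 1 ≤ R / t := by rw [one_le_div ht]; exact h2
  have hs2 : R / t ≤ 2 := by rw [div_le_iff₀ ht]; linarith
  have e1 : (2:ℝ) ^ (-|α|) ≤ (R / t) ^ (-|α|) :=
    Real.rpow_le_rpow_of_nonpos (by positivity) hs2 (by simp)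
  have e2 : (R / t) ^ (-|α|) ≤ (R / t) ^ α := Real.rpow_le_rpow_of_exponent_le hs1 (neg_abs_le α)
  have e3 : R ^ α = (R / t) ^ α * t ^ α := by
    rw [← Real.mul_rpow (by positivity) ht.le]; congr 1; field_simp
  rw [e3]
  exact mul_le_mul_of_nonneg_right (e1.trans e2) (by positivity)

set_option maxHeartbeats 1000000 in
theorem lower_main {N : ℕ} (hN : 3 ≤ N) {S : Set (Euc N)} (hS : IsSphereDomain N S) {r : ℝ} (hr : 0 < r)
    {u V : Euc N → ℝ} (hu : SH (coneLike S r) u) (hpos : ∀ᵐ x, x ∈ coneLike S r → 0 < u x)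
    {Vm : ℝ} (hV : IsPot V Vm)
    (hsup : ∀ φ : Euc N → ℝ, IsTestFun (coneLike S r) φ → (∀ x, 0 ≤ φ x) →
      ∫ x, u x * lap φ x ≤ -∫ x, V x / ‖x‖ ^ 2 * u x * φ x)
    {κ : ℝ} (hκ : 0 ≤ κ) (hl : lam1 S V ≤ κ ^ 2 - (((N:ℝ) - 2) / 2) ^ 2)
    {K1 : Set (Euc N)} (hK1 : IsCompact K1) (hK1S : K1 ⊆ S) :
    ∃ c : ℝ, 0 < c ∧ ∀ᵐ x, x ∈ coneLike K1 (r / 2) → c * ‖x‖ ^ (κ - ((N:ℝ) - 2) / 2) ≤ u x := by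
  obtain ⟨K0, hK0, hK0S, c, hc, hI⟩ := lower_avg hN hS hr hu hpos hV hsup hκ hl
  obtain ⟨cH, hcH, hH⟩ := harnack_cone hN hS hK0 hK0S hK1 hK1S
  set α := κ - ((N:ℝ) - 2) / 2 with hα
  have hR0 : ∀ j : ℕ, 0 < r / 2 * (1 / 2 : ℝ) ^ j := fun j => by positivity
  have hRr : ∀ j : ℕ, r / 2 * (1 / 2 : ℝ) ^ j ≤ r / 2 := fun j => by
    have : (1 / 2 : ℝ) ^ j ≤ 1 := pow_le_one₀ (by norm_num) (by norm_num)
    nlinarith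
  have key : ∀ᵐ x, ∀ j : ℕ, x ∈ annK K1 (r / 2 * (1 / 2 : ℝ) ^ j / 2) (r / 2 * (1 / 2 : ℝ) ^ j) →
      cH * c * (r / 2 * (1 / 2 : ℝ) ^ j) ^ α ≤ u x := by
    rw [ae_all_iff]
    intro j
    set R := r / 2 * (1 / 2 : ℝ) ^ j with hRd
    have hR := hR0 j
    have hRr' := hRr j
    rw [← hRd] at hR hRr'
    have hsub : coneLike S (2 * R) ⊆ coneLike S r := by
      intro x hx
      exact ⟨hx.1, ball_subset_ball (by linarith) hx.2⟩
    have h1 := hI R hR (by nlinarith)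
    filter_upwards [hH R hR u (SH_mono hsub hu)] with x hx hmem
    refine le_trans ?_ (hx hmem)
    calc cH * c * R ^ α = cH * (R ^ N)⁻¹ * (c * R ^ (α + N)) := by
          rw [Real.rpow_add hR, Real.rpow_natCast]; field_simp
      _ ≤ _ := by gcongr
  refine ⟨cH * c * 2 ^ (-|α|), by positivity, ?_⟩
  filter_upwards [key] with x hx hmem
  have hx0 : 0 < ‖x‖ := norm_pos_iff.mpr ((mem_sphCone_iff (hK1S.trans hS.2.1)).mp hmem.1).1
  have hxr : ‖x‖ < r / 2 := by simpa using hmem.2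
  obtain ⟨j, hj1, hj2⟩ := exists_nat_pow_near_of_lt_one (x := ‖x‖ / (r / 2)) (y := (1/2:ℝ))
    (by positivity) (by rw [div_le_one (by positivity)]; exact hxr.le) (by norm_num) (by norm_num)
  rw [lt_div_iff₀ (by positivity)] at hj1
  rw [div_le_iff₀ (by positivity)] at hj2
  have g1 : r / 2 * (1 / 2 : ℝ) ^ j / 2 ≤ ‖x‖ := by rw [pow_succ] at hj1; linarith
  have g2 : ‖x‖ ≤ r / 2 * (1 / 2 : ℝ) ^ j := by linarith
  refine le_trans ?_ (hx j ⟨hmem.1, g1, g2⟩)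
  rw [mul_assoc]
  exact mul_le_mul_of_nonneg_left (rpow_compare hx0 g1 g2) (by positivity)

end

/-- **Lemma 2.1.** Lower estimate for positive distributional supersolutions of
`-Δu - V(x/|x|)|x|⁻²u ≥ f ≥ 0` on a cone-like domain: on any compactly contained subcone,
`u(x) ≥ C |x|^{(2-N)/2 + √(μ_V(C_Σ))}`. -/
theorem lower_bound_coneLike {N : ℕ} (hN : 3 ≤ N) (S : Set (Euc N))
    (hS : IsSphereDomain N S) (r : ℝ) (hr : 0 < r)
    (V : Euc N → ℝ) (hVmeas : Measurable V)
    (hV : ∀ σ ∈ S, 0 ≤ V σ ∧ V σ ≤ hardyConst (sphCone S))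
    (u f : Euc N → ℝ)
    (hupos : ∀ᵐ x ∂volume, x ∈ coneLike S r → 0 < u x)
    (huloc : LocallyIntegrableOn u (coneLike S r) volume)
    (hVu : LocallyIntegrableOn (fun x => V (‖x‖⁻¹ • x) * ‖x‖ ^ (-2 : ℝ) * u x) (coneLike S r) volume)
    (hfloc : LocallyIntegrableOn f (coneLike S r) volume)
    (hf0 : ∀ᵐ x ∂volume, x ∈ coneLike S r → 0 ≤ f x)
    (hfnt : ¬ (∀ᵐ x ∂volume, x ∈ coneLike S r → f x = 0))
    (hsuper : ∀ φ : Euc N → ℝ, IsTestFun (coneLike S r) φ → (∀ x, 0 ≤ φ x) →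
      ∫ x in coneLike S r, f x * φ x ≤
        ∫ x in coneLike S r, u x * (-(lap φ x) - V (‖x‖⁻¹ • x) * ‖x‖ ^ (-2 : ℝ) * φ x)) :
    ∀ S' : Set (Euc N), IsSphereDomain N S' → S' ⊆ S →
      closure S' ⊆ S → IsCompact (closure S') →
      ∃ C : ℝ, 0 < C ∧ ∀ᵐ x ∂volume, x ∈ coneLike S' (r / 2) →
        C * ‖x‖ ^ (((2 : ℝ) - N) / 2 + Real.sqrt (hardyConstV S V)) ≤ u x := by
  intro S' hS' hS'S hcl hclc
  have hSs := hS.2.1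
  have hΩo := isOpen_coneLike hS r
  have hSm : MeasurableSet S := by
    obtain ⟨U, hU, hSU⟩ := hS.2.2.1
    rw [hSU]
    exact hU.measurableSet.inter isClosed_sphere.measurableSet
  set W : Euc N → ℝ := fun x => S.indicator V (‖x‖⁻¹ • x) with hW
  have hWV : ∀ x ∈ sphCone S, V (‖x‖⁻¹ • x) = W x := by
    intro x hx
    rw [hW]
    simp only
    rw [Set.indicator_of_mem ((mem_sphCone_iff hSs).mp hx).2]
  have hP : IsPot W (max (hardyConst (sphCone S)) 0) := by
    refine ⟨?_, ?_, ?_⟩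
    · intro s hs x
      simp only [hW]
      rw [unit_smul x hs]
    · exact (hVmeas.indicator hSm).comp (measurable_norm.inv.smul measurable_id)
    · intro x
      simp only [hW]
      by_cases h : ‖x‖⁻¹ • x ∈ S
      · rw [Set.indicator_of_mem h]
        exact ⟨(hV _ h).1, le_max_of_le_left (hV _ h).2⟩
      · rw [Set.indicator_of_notMem h]
        exact ⟨le_rfl, le_max_right _ _⟩
  have hsup : ∀ φ : Euc N → ℝ, IsTestFun (coneLike S r) φ → (∀ x, 0 ≤ φ x) →
      ∫ x, u x * lap φ x ≤ -∫ x, W x / ‖x‖ ^ 2 * u x * φ x := by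
    intro φ hφ φ0
    have h0 := hsuper φ hφ φ0
    have hf : 0 ≤ ∫ x in coneLike S r, f x * φ x := by
      refine setIntegral_nonneg_of_ae_restrict ?_
      rw [EventuallyLE, ae_restrict_iff' hΩo.measurableSet]
      filter_upwards [hf0] with x hx hm
      exact mul_nonneg (hx hm) (φ0 x)
    have z1 : ∀ x, x ∉ tsupport φ → lap φ x = 0 := fun x hx => lap_eq_zero_of_notMem_tsupport hx
    have z2 : ∀ x, x ∉ tsupport φ → φ x = 0 := fun x hx =>
      image_eq_zero_of_notMem_tsupport (f := φ) hx
    have i1 : Integrable (fun x => u x * lap φ x) :=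
      integrable_loc_mul huloc hφ.2.1 hφ.2.2 (continuous_lap (hφ.1.of_le two_le_infty)) z1
    have i2 : Integrable (fun x => V (‖x‖⁻¹ • x) * ‖x‖ ^ (-2 : ℝ) * u x * φ x) :=
      integrable_loc_mul hVu hφ.2.1 hφ.2.2 hφ.1.continuous z2
    rw [setIntegral_eq_integral_of_forall_compl_eq_zero
      (f := fun x => u x * (-(lap φ x) - V (‖x‖⁻¹ • x) * ‖x‖ ^ (-2 : ℝ) * φ x))] at h0
    · have e1 : ∫ x, u x * (-(lap φ x) - V (‖x‖⁻¹ • x) * ‖x‖ ^ (-2 : ℝ) * φ x) =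
          -(∫ x, u x * lap φ x) - ∫ x, V (‖x‖⁻¹ • x) * ‖x‖ ^ (-2 : ℝ) * u x * φ x := by
        have i3 : Integrable (fun x => -(u x * lap φ x)) := i1.neg
        rw [← integral_neg, ← integral_sub i3 i2]
        refine integral_congr_ae (Eventually.of_forall fun x => ?_)
        simp only
        ring
      have e2 : ∫ x, W x / ‖x‖ ^ 2 * u x * φ x =
          ∫ x, V (‖x‖⁻¹ • x) * ‖x‖ ^ (-2 : ℝ) * u x * φ x := by
        refine integral_congr_ae (Eventually.of_forall fun x => ?_)
        simp only
        by_cases hx : x ∈ tsupport φ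
        · rw [← hWV x (hφ.2.2 hx).1, Real.rpow_neg (norm_nonneg _), div_eq_mul_inv]
          norm_num
        · rw [z2 x hx, mul_zero, mul_zero]
      rw [e2]
      linarith
    · intro x hx
      have hx' : x ∉ tsupport φ := fun h => hx (hφ.2.2 h)
      rw [z1 x hx', z2 x hx']
      simp
  have hu : SH (coneLike S r) u := by
    refine ⟨huloc, hupos.mono fun x hx h => (hx h).le, fun φ hφ φ0 => (hsup φ hφ φ0).trans ?_⟩
    rw [neg_nonpos]
    refine integral_nonneg_of_ae ?_
    filter_upwards [hupos] with x hx
    by_cases hm : x ∈ tsupport φ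
    · have h1 := hx (hφ.2.2 hm)
      have h2 := (hP.2.2 x).1
      have h3 := φ0 x
      simp only [Pi.zero_apply]
      positivity
    · have : φ x = 0 := image_eq_zero_of_notMem_tsupport (f := φ) hm
      simp [this]
  have hmu := mu1_le_hardyConstV hN hS hP hWV
  set μ := lam1 S W + ((N:ℝ) - 2) ^ 2 / 4 with hμ
  set κ := √(max μ 0) with hκd
  have hκ0 : 0 ≤ κ := Real.sqrt_nonneg _
  have hκ2 : κ ^ 2 = max μ 0 := Real.sq_sqrt (le_max_right _ _)
  have hκl : κ ≤ √(hardyConstV S V) := by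
    rcases le_total μ 0 with h | h
    · rw [hκd, max_eq_right h, Real.sqrt_zero]; exact Real.sqrt_nonneg _
    · rw [hκd, max_eq_left h]; exact Real.sqrt_le_sqrt hmu
  have hl : lam1 S W ≤ κ ^ 2 - (((N:ℝ) - 2) / 2) ^ 2 := by
    rw [hκ2]
    have := le_max_left μ 0
    rw [hμ] at this ⊢
    linarith
  obtain ⟨c, hc, hae⟩ := lower_main hN hS hr hu hupos hP hsup hκ0 hl hclc hcl
  set α := κ - ((N:ℝ) - 2) / 2 with hα
  set β := ((2 : ℝ) - N) / 2 + √(hardyConstV S V) with hβ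
  have hαβ : 0 ≤ β - α := by rw [hα, hβ]; linarith
  refine ⟨c / r ^ (β - α), by positivity, ?_⟩
  filter_upwards [hae] with x hx hmem
  have hmem2 : x ∈ coneLike (closure S') (r / 2) := ⟨sphCone_mono subset_closure hmem.1, hmem.2⟩
  have hx0 : 0 < ‖x‖ := norm_pos_iff.mpr ((mem_sphCone_iff hS'.2.1).mp hmem.1).1
  have hxr : ‖x‖ < r / 2 := by simpa using hmem.2
  refine le_trans ?_ (hx hmem2)
  have h1 : ‖x‖ ^ β = ‖x‖ ^ α * ‖x‖ ^ (β - α) := by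
    rw [← Real.rpow_add hx0]; congr 1; ring
  have h2 : ‖x‖ ^ (β - α) ≤ r ^ (β - α) := Real.rpow_le_rpow hx0.le (by linarith) hαβ
  have h3 : 0 < r ^ (β - α) := by positivity
  calc c / r ^ (β - α) * ‖x‖ ^ β ≤ c / r ^ (β - α) * (‖x‖ ^ α * r ^ (β - α)) := by
        rw [h1]; gcongr
    _ = c * ‖x‖ ^ α := by field_simp
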